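/- There exist constants c₃ > 0 and C₃ > 0 such that for every integer q ≥ 3, every real T ≥ 1, and every real σ with 0 ≤ σ ≤ 1, one has ∑_{χ mod q} N(σ,T,χ) ≤ C₃·(qT)^{c₃(1−σ)}, where the sum runs over all Dirichlet characters χ mod q. -/

import Mathlib

open scoped Classical

/-- The multiplicity of `z` as a zero of `f` (the analytic order, truncated to `ℕ`). -/
noncomputable def zeroMult (f : ℂ → ℂ) (z : ℂ) : ℕ :=
  if h : AnalyticAt ℂ f z then (analyticOrderAt f z).toNat else 0

/-- `zeroCount q σ T χ = N(σ,T,χ)`, the number of zeros `ρ` of `L(s,χ)` with `Re ρ ≥ σ` and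
`|Im ρ| ≤ T`, counted with multiplicity. -/
noncomputable def zeroCount (q : ℕ) [NeZero q] (σ T : ℝ)
    (χ : DirichletCharacter ℂ q) : ℕ :=
  ∑ᶠ ρ ∈ {ρ : ℂ | χ.LFunction ρ = 0 ∧ σ ≤ ρ.re ∧ |ρ.im| ≤ T},
    zeroMult χ.LFunction ρ

lemma sum_inv_prime_dyadic_le (k : ℕ) (hk : 1 ≤ k) :
    ∑ p ∈ (Finset.Ico (2 ^ k) (2 ^ (k + 1))).filter Nat.Prime, (1 / (p : ℝ)) ≤ 4 / k := by
  set S := (Finset.Ico (2 ^ k) (2 ^ (k + 1))).filter Nat.Prime with hS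
  have h1 : (2 ^ k) ^ S.card ≤ ∏ p ∈ S, p := by
    rw [← Finset.prod_const]
    refine Finset.prod_le_prod' fun p hp => ?_
    simp only [hS, Finset.mem_filter, Finset.mem_Ico] at hp
    exact hp.1.1
  have h2 : ∏ p ∈ S, p ≤ primorial (2 ^ (k + 1)) := by
    unfold primorial
    refine Finset.prod_le_prod_of_subset_of_one_le' ?_ ?_
    · intro p hp
      simp only [hS, Finset.mem_filter, Finset.mem_Ico] at hp
      simp only [Finset.mem_filter, Finset.mem_range]
      exact ⟨by omega, hp.2⟩
    · intro p hp _
      simp only [Finset.mem_filter] at hp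
      exact hp.2.one_lt.le
  have h3 : 2 ^ (k * S.card) ≤ 2 ^ (2 * 2 ^ (k + 1)) := by
    rw [pow_mul, pow_mul]
    exact (h1.trans h2).trans (primorial_le_four_pow _)
  have h4 : k * S.card ≤ 2 * 2 ^ (k + 1) := (Nat.pow_le_pow_iff_right (by norm_num)).1 h3
  have h5 : (k : ℝ) * S.card ≤ 4 * 2 ^ k := by
    have : ((k * S.card : ℕ) : ℝ) ≤ ((2 * 2 ^ (k + 1) : ℕ) : ℝ) := by exact_mod_cast h4
    push_cast at this
    rw [pow_succ] at this
    linarith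
  have h6 : ∑ p ∈ S, (1 / (p : ℝ)) ≤ S.card * (1 / 2 ^ k) := by
    rw [← nsmul_eq_mul]
    refine Finset.sum_le_card_nsmul _ _ _ fun p hp => ?_
    simp only [hS, Finset.mem_filter, Finset.mem_Ico] at hp
    have : (2 : ℝ) ^ k ≤ p := by exact_mod_cast hp.1.1
    exact one_div_le_one_div_of_le (by positivity) this
  refine h6.trans ?_
  have hk' : (0 : ℝ) < k := by exact_mod_cast hk
  rw [mul_one_div, div_le_div_iff₀ (by positivity) hk']
  linarith

/-- Summation over primes by dyadic blocks. -/
lemma sum_prime_div_le_dyadic (S : Finset ℕ) (hS : ∀ p ∈ S, p.Prime) (g : ℕ → ℝ) (G : ℕ → ℝ)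
    (hG : ∀ k, 0 ≤ G k) (hg : ∀ p ∈ S, g p ≤ G (Nat.log 2 p)) (K : ℕ)
    (hK : ∀ p ∈ S, Nat.log 2 p ≤ K) :
    ∑ p ∈ S, g p / p ≤ ∑ k ∈ Finset.Icc 1 K, 4 / (k : ℝ) * G k := by
  have hmaps : ∀ p ∈ S, Nat.log 2 p ∈ Finset.Icc 1 K := by
    intro p hp
    exact Finset.mem_Icc.2 ⟨Nat.log_pos (by norm_num) (hS p hp).two_le, hK p hp⟩
  rw [← Finset.sum_fiberwise_of_maps_to hmaps]
  refine Finset.sum_le_sum fun k hk => ?_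
  have hk1 := (Finset.mem_Icc.1 hk).1
  calc ∑ p ∈ S with Nat.log 2 p = k, g p / p
      ≤ ∑ p ∈ S with Nat.log 2 p = k, G k * (1 / (p : ℝ)) := by
        refine Finset.sum_le_sum fun p hp => ?_
        rw [Finset.mem_filter] at hp
        rw [mul_one_div]
        gcongr
        have := hg p hp.1
        rwa [hp.2] at this
    _ = G k * ∑ p ∈ S with Nat.log 2 p = k, (1 / (p : ℝ)) := by rw [Finset.mul_sum]
    _ ≤ G k * ∑ p ∈ (Finset.Ico (2 ^ k) (2 ^ (k + 1))).filter Nat.Prime, (1 / (p : ℝ)) := by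
        refine mul_le_mul_of_nonneg_left ?_ (hG k)
        refine Finset.sum_le_sum_of_subset_of_nonneg ?_ fun _ _ _ => by positivity
        intro p hp
        rw [Finset.mem_filter] at hp ⊢
        have hp0 : p ≠ 0 := (hS p hp.1).ne_zero
        refine ⟨Finset.mem_Ico.2 ⟨?_, ?_⟩, hS p hp.1⟩
        · rw [← hp.2]; exact Nat.pow_log_le_self 2 hp0
        · rw [← hp.2]; exact Nat.lt_pow_succ_log_self (by norm_num) p
    _ ≤ G k * (4 / k) := mul_le_mul_of_nonneg_left (sum_inv_prime_dyadic_le k hk1) (hG k)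
    _ = 4 / (k : ℝ) * G k := mul_comm _ _

lemma log_le_two_mul_natLog (p : ℕ) (hp : 2 ≤ p) : Real.log p ≤ 2 * (Nat.log 2 p : ℝ) := by
  have h1 : (p : ℝ) ≤ 2 ^ (Nat.log 2 p + 1) := by
    exact_mod_cast (Nat.lt_pow_succ_log_self (by norm_num : 1 < 2) p).le
  have h2 : Real.log p ≤ (Nat.log 2 p + 1 : ℕ) * Real.log 2 := by
    rw [← Real.log_pow]
    exact Real.log_le_log (by exact_mod_cast (by omega : 0 < p)) h1
  have h3 : 1 ≤ Nat.log 2 p := Nat.log_pos (by norm_num) hp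
  have h4 : (1 : ℝ) ≤ Nat.log 2 p := by exact_mod_cast h3
  have h5 := Real.log_two_lt_d9
  push_cast at h2
  nlinarith [(Real.log_pos one_lt_two)]

lemma natLog_mul_log_two_le (p : ℕ) (hp : p ≠ 0) : (Nat.log 2 p : ℝ) * Real.log 2 ≤ Real.log p := by
  rw [← Real.log_pow]
  refine Real.log_le_log (by positivity) ?_
  exact_mod_cast Nat.pow_log_le_self 2 hp

lemma sum_min_one_sq_div_le (a : ℝ) (ha : 0 < a) (K : ℕ) :
    ∑ k ∈ Finset.Icc 1 K, min 1 ((k * a) ^ 2) / (k : ℝ) ≤ 2 * Real.log (1 + K * a) := by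
  induction K with
  | zero => simp
  | succ n ih =>
    rw [Finset.sum_Icc_succ_top (by omega)]
    have hn : (0 : ℝ) ≤ n := Nat.cast_nonneg n
    have hx : 0 < ((n + 1 : ℕ) : ℝ) * a := by positivity
    have hA : 0 < 1 + (n : ℝ) * a := by positivity
    have hB : 0 < 1 + ((n + 1 : ℕ) : ℝ) * a := by positivity
    have h1 : min 1 ((((n + 1 : ℕ) : ℝ) * a) ^ 2) ≤
        2 * (((n + 1 : ℕ) : ℝ) * a) / (1 + ((n + 1 : ℕ) : ℝ) * a) := by
      set x := ((n + 1 : ℕ) : ℝ) * a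
      rw [le_div_iff₀ hB]
      rcases le_total x 1 with h | h
      · have : min 1 (x ^ 2) ≤ x ^ 2 := min_le_right _ _
        nlinarith
      · have : min 1 (x ^ 2) ≤ 1 := min_le_left _ _
        nlinarith
    have h2 : min 1 ((((n + 1 : ℕ) : ℝ) * a) ^ 2) / ((n + 1 : ℕ) : ℝ) ≤
        2 * (a / (1 + ((n + 1 : ℕ) : ℝ) * a)) := by
      rw [div_le_iff₀ (by positivity)]
      refine h1.trans (le_of_eq ?_)
      ring
    have h3 : a / (1 + ((n + 1 : ℕ) : ℝ) * a) ≤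
        Real.log (1 + ((n + 1 : ℕ) : ℝ) * a) - Real.log (1 + n * a) := by
      have := Real.log_le_sub_one_of_pos (div_pos hA hB)
      rw [Real.log_div hA.ne' hB.ne'] at this
      have h4 : (1 + (n : ℝ) * a) / (1 + ((n + 1 : ℕ) : ℝ) * a) - 1 =
          -(a / (1 + ((n + 1 : ℕ) : ℝ) * a)) := by
        field_simp
        push_cast
        ring
      rw [h4] at this
      linarith
    linarith

/-- A truncated Mertens type estimate. -/
lemma sum_prime_min_le (S : Finset ℕ) (hS : ∀ p ∈ S, p.Prime) (L B τ : ℝ) (hL : 0 < L) (hB : 0 < B)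
    (hτ : 0 < τ) (hSB : ∀ p ∈ S, Real.log p ≤ B * L) :
    ∑ p ∈ S, min 4 ((τ * Real.log p / L) ^ 2) / p ≤ 32 * Real.log (1 + 2 * B * τ) := by
  have ha : 0 < τ / L := by positivity
  have hBL : 0 ≤ B * L / Real.log 2 := by have := (Real.log_pos one_lt_two); positivity
  refine (sum_prime_div_le_dyadic S hS _ (fun k => 4 * min 1 ((k * (τ / L)) ^ 2))
    (fun k => by positivity) ?_ ⌊B * L / Real.log 2⌋₊ ?_).trans ?_
  · intro p hp
    have h2 := (hS p hp).two_le
    have hlog := log_le_two_mul_natLog p h2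
    have hlog0 : 0 ≤ Real.log p := Real.log_nonneg (by exact_mod_cast (by omega : 1 ≤ p))
    have : (τ * Real.log p / L) ^ 2 ≤ 4 * ((Nat.log 2 p : ℝ) * (τ / L)) ^ 2 := by
      have : τ * Real.log p / L ≤ 2 * ((Nat.log 2 p : ℝ) * (τ / L)) := by
        calc τ * Real.log p / L = Real.log p * (τ / L) := by ring
          _ ≤ (2 * (Nat.log 2 p : ℝ)) * (τ / L) := by gcongr
          _ = _ := by ring
      calc (τ * Real.log p / L) ^ 2 ≤ (2 * ((Nat.log 2 p : ℝ) * (τ / L))) ^ 2 := by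
            gcongr
        _ = _ := by ring
    rw [mul_min_of_nonneg _ _ (by norm_num : (0:ℝ) ≤ 4), mul_one]
    exact min_le_min le_rfl this
  · intro p hp
    refine Nat.le_floor ?_
    rw [le_div_iff₀ (Real.log_pos one_lt_two)]
    exact (natLog_mul_log_two_le p (hS p hp).ne_zero).trans (hSB p hp)
  · set K := ⌊B * L / Real.log 2⌋₊
    have h1 : ∑ k ∈ Finset.Icc 1 K, 4 / (k : ℝ) * (4 * min 1 ((k * (τ / L)) ^ 2)) =
        16 * ∑ k ∈ Finset.Icc 1 K, min 1 ((k * (τ / L)) ^ 2) / (k : ℝ) := by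
      rw [Finset.mul_sum]
      refine Finset.sum_congr rfl fun k _ => by ring
    rw [h1]
    have h2 := sum_min_one_sq_div_le (τ / L) ha K
    have h3 : (K : ℝ) * (τ / L) ≤ 2 * B * τ := by
      have : (K : ℝ) ≤ 2 * (B * L) := by
        refine (Nat.floor_le hBL).trans ?_
        rw [div_le_iff₀ (Real.log_pos one_lt_two)]
        have := Real.log_two_gt_d9
        nlinarith [mul_pos hB hL]
      calc (K : ℝ) * (τ / L) ≤ 2 * (B * L) * (τ / L) := by gcongr
        _ = 2 * B * τ := by field_simp
    have h4 : Real.log (1 + K * (τ / L)) ≤ Real.log (1 + 2 * B * τ) := by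
      refine Real.log_le_log (by positivity) (by linarith)
    linarith

lemma sum_inv_sqrt_geom_le (r : ℝ) (hr : 0 < r) (K : ℕ) :
    ∑ k ∈ Finset.Icc 1 K, (1 / √(k : ℝ)) * (1 / (1 + √(r * k)) ^ 2) ≤
      2 * (√K / (1 + √(r * K))) := by
  induction K with
  | zero => simp
  | succ n ih =>
    rw [Finset.sum_Icc_succ_top (by omega)]
    have hs : ∀ x : ℝ, √(r * x) = √r * √x := fun x => Real.sqrt_mul hr.le x
    simp only [hs] at ih ⊢
    have hR : 0 < √r := Real.sqrt_pos.2 hr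
    have hx : 0 ≤ √(n : ℝ) := Real.sqrt_nonneg _
    have hy : 0 < √((n + 1 : ℕ) : ℝ) := Real.sqrt_pos.2 (by positivity)
    have hxy : √(n : ℝ) ≤ √((n + 1 : ℕ) : ℝ) := Real.sqrt_le_sqrt (by push_cast; linarith)
    have hd : √((n + 1 : ℕ) : ℝ) ^ 2 - √(n : ℝ) ^ 2 = 1 := by
      rw [Real.sq_sqrt (by positivity), Real.sq_sqrt (by positivity)]; push_cast; ring
    set x := √(n : ℝ)
    set y := √((n + 1 : ℕ) : ℝ)
    set R := √r
    have h1 : y / (1 + R * y) - x / (1 + R * x) = (y - x) / ((1 + R * y) * (1 + R * x)) := by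
      field_simp; ring
    have h2 : 1 / y * (1 / (1 + R * y) ^ 2) ≤ 2 * ((y - x) / ((1 + R * y) * (1 + R * x))) := by
      have h3 : 1 / y ≤ 2 * (y - x) := by
        rw [div_le_iff₀ hy]; nlinarith
      have h4 : 1 / (1 + R * y) ^ 2 ≤ 1 / ((1 + R * y) * (1 + R * x)) := by
        refine one_div_le_one_div_of_le (by positivity) ?_
        rw [sq]; gcongr
      calc _ ≤ 2 * (y - x) * (1 / ((1 + R * y) * (1 + R * x))) := by
            refine mul_le_mul h3 h4 (by positivity) ?_
            have : 0 < 1 / y := by positivity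
            linarith
        _ = _ := by ring
    linarith

/-- `∑ √(log p) p^{-1-r} ≪ r^{-1/2}`, uniformly over finite sets of primes. -/
lemma sum_prime_sqrt_log_rpow_le (S : Finset ℕ) (hS : ∀ p ∈ S, p.Prime) (r : ℝ) (hr : 0 < r) :
    ∑ p ∈ S, √(Real.log p) * (p : ℝ) ^ (-r) / p ≤ 64 / √r := by
  have hl2 := Real.log_two_gt_d9
  have hR : 0 < √r := Real.sqrt_pos.2 hr
  refine (sum_prime_div_le_dyadic S hS _
    (fun k => √(2 * k) * (3 * (1 / (1 + √(r * k)) ^ 2))) (fun k => by positivity) ?_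
    (S.sup (Nat.log 2)) (fun p hp => Finset.le_sup (f := Nat.log 2) hp)).trans ?_
  · intro p hp
    have h2 := (hS p hp).two_le
    have hp0 : (0 : ℝ) < p := by exact_mod_cast (hS p hp).pos
    refine mul_le_mul (Real.sqrt_le_sqrt (log_le_two_mul_natLog p h2)) ?_ (by positivity)
      (by positivity)
    set k := Nat.log 2 p
    rw [Real.rpow_def_of_pos hp0]
    have h1 : (k : ℝ) * Real.log 2 ≤ Real.log p := natLog_mul_log_two_le p (hS p hp).ne_zero
    have h3 : Real.exp (Real.log p * -r) ≤ Real.exp (-(r * k * Real.log 2)) := by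
      refine Real.exp_le_exp.2 ?_
      nlinarith
    refine h3.trans ?_
    have hx : 0 ≤ r * k := by positivity
    have hsq : (1 + √(r * k)) ^ 2 ≤ 2 * (1 + r * k) := by
      have := Real.sq_sqrt hx
      nlinarith [sq_nonneg (√(r * k) - 1)]
    have hexp : 1 + r * k * Real.log 2 ≤ Real.exp (r * k * Real.log 2) := by
      linarith [Real.add_one_le_exp (r * k * Real.log 2)]
    rw [Real.exp_neg, mul_one_div, inv_le_comm₀ (Real.exp_pos _) (by positivity), inv_div,
      div_le_iff₀ (by norm_num)]
    nlinarith
  · set K := S.sup (Nat.log 2)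
    have h1 : ∀ k ∈ Finset.Icc 1 K,
        4 / (k : ℝ) * (√(2 * k) * (3 * (1 / (1 + √(r * k)) ^ 2))) =
        12 * √2 * ((1 / √(k : ℝ)) * (1 / (1 + √(r * k)) ^ 2)) := by
      intro k hk
      have hk1 : (0 : ℝ) < k := by exact_mod_cast (Finset.mem_Icc.1 hk).1
      have hk2 : 0 < √(k : ℝ) := Real.sqrt_pos.2 hk1
      have hk3 : √(k : ℝ) / k = 1 / √(k : ℝ) := Real.sqrt_div_self'
      rw [Real.sqrt_mul (by norm_num), ← hk3]
      ring
    rw [Finset.sum_congr rfl h1, ← Finset.mul_sum]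
    have h2 := sum_inv_sqrt_geom_le r hr K
    have h3 : √(K : ℝ) / (1 + √(r * K)) ≤ 1 / √r := by
      rw [div_le_div_iff₀ (by positivity) hR, Real.sqrt_mul hr.le]
      nlinarith [Real.sqrt_nonneg (K : ℝ)]
    have h4 : √2 ≤ 1.5 := by
      rw [Real.sqrt_le_left (by norm_num)]; norm_num
    have h5 : 12 * √2 ≤ 18 := by linarith
    have h6 : 0 < 1 / √r := by positivity
    calc _ ≤ 18 * (2 * (1 / √r)) := by
          refine mul_le_mul h5 (by linarith) ?_ (by norm_num)
          exact Finset.sum_nonneg fun k _ => by positivity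
      _ ≤ 64 / √r := by rw [← mul_one_div (64:ℝ)]; linarith

/-- A smooth cutoff equal to `1` on `[-1,1]` and vanishing outside `(-2,2)`. -/
noncomputable def sieveBump : ContDiffBump (0 : ℝ) := ⟨1, 2, one_pos, one_lt_two⟩

lemma sieveBump_eq_one {x : ℝ} (h : |x| ≤ 1) : sieveBump x = 1 :=
  sieveBump.one_of_mem_closedBall (by simpa [sieveBump] using h)

lemma sieveBump_eq_zero {x : ℝ} (h : 2 ≤ |x|) : sieveBump x = 0 :=
  sieveBump.zero_of_le_dist (by simpa [sieveBump] using h)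

/-- Laplace–Fourier representation of the cutoff. -/
lemma exists_sieveBump_eq_integral : ∃ f : ℝ → ℂ, Continuous f ∧
    (∀ k : ℕ, MeasureTheory.Integrable (fun t => ‖f t‖ * (1 + |t|) ^ k)) ∧
    ∀ u : ℝ, ((sieveBump u : ℝ) : ℂ) =
      ∫ t : ℝ, f t * Complex.exp (-(u * (1 - 2 * Real.pi * t * Complex.I))) := by
  let ψ : ℝ → ℂ := fun u => ((Real.exp u * sieveBump u : ℝ) : ℂ)
  have h1 : HasCompactSupport ψ := by
    refine sieveBump.hasCompactSupport.mono ?_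
    intro x hx
    simp only [Function.mem_support, ψ] at hx ⊢
    intro h
    exact hx (by simp [h])
  have h2 : ContDiff ℝ (⊤ : ℕ∞) ψ := by
    refine Complex.ofRealCLM.contDiff.comp ?_
    exact Real.contDiff_exp.mul sieveBump.contDiff
  let g : SchwartzMap ℝ ℂ := h1.toSchwartzMap h2
  let F : SchwartzMap ℝ ℂ := FourierTransform.fourier g
  refine ⟨F, F.continuous, fun k => ?_, fun u => ?_⟩
  · have hi : MeasureTheory.Integrable (fun t => 2 ^ k * (‖F t‖ + |t| ^ k * ‖F t‖)) := by
      refine (MeasureTheory.Integrable.add F.integrable.norm ?_).const_mul _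
      simpa using F.integrable_pow_mul MeasureTheory.volume k
    refine hi.mono' (by fun_prop) (Filter.Eventually.of_forall fun t => ?_)
    have h3 : (1 + |t|) ^ k ≤ 2 ^ k * (1 + |t| ^ k) := by
      have := abs_nonneg t
      rcases le_total |t| 1 with h | h
      · calc (1 + |t|) ^ k ≤ 2 ^ k := by gcongr; linarith
          _ ≤ 2 ^ k * (1 + |t| ^ k) := le_mul_of_one_le_right (by positivity) (by
            have : 0 ≤ |t| ^ k := by positivity
            linarith)
      · calc (1 + |t|) ^ k ≤ (2 * |t|) ^ k := by gcongr; linarith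
          _ = 2 ^ k * |t| ^ k := mul_pow _ _ _
          _ ≤ 2 ^ k * (1 + |t| ^ k) := by gcongr; linarith
    rw [Real.norm_of_nonneg (by positivity)]
    calc ‖F t‖ * (1 + |t|) ^ k ≤ ‖F t‖ * (2 ^ k * (1 + |t| ^ k)) := by gcongr
      _ = _ := by ring
  · have h3 : FourierTransformInv.fourierInv F = g := FourierTransform.fourierInv_fourier_eq g
    have h4 : (FourierTransformInv.fourierInv F : SchwartzMap ℝ ℂ) u = ψ u := by
      rw [h3]; rfl
    rw [SchwartzMap.fourierInv_coe, Real.fourierInv_eq'] at h4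
    have h5 : ((sieveBump u : ℝ) : ℂ) = Complex.exp (-u) * ψ u := by
      simp only [ψ]
      push_cast
      rw [← mul_assoc, ← Complex.exp_add]
      simp
    rw [h5, ← h4, ← MeasureTheory.integral_const_mul]
    refine MeasureTheory.integral_congr_ae (Filter.Eventually.of_forall fun t => ?_)
    simp only [smul_eq_mul, RCLike.inner_apply, conj_trivial]
    rw [← mul_assoc, ← Complex.exp_add, mul_comm]
    congr 2
    push_cast
    ring

/-- Smoothed Möbius weight of the squarefree number with prime set `D`. -/
noncomputable def sieveTheta (L : ℝ) (D : Finset ℕ) : ℝ :=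
  (-1) ^ D.card * sieveBump (Real.log (∏ p ∈ D, (p : ℝ)) / L)

/-- The sieve weight of a number with set of prime factors `A`. -/
noncomputable def sieveB (L : ℝ) (A : Finset ℕ) : ℝ := ∑ D ∈ A.powerset, sieveTheta L D

lemma abs_sieveTheta_le_one (L : ℝ) (D : Finset ℕ) : |sieveTheta L D| ≤ 1 := by
  rw [sieveTheta, abs_mul, abs_pow, abs_neg, abs_one, one_pow, one_mul,
    abs_of_nonneg sieveBump.nonneg]
  exact sieveBump.le_one

lemma sieveTheta_eq_zero {L : ℝ} (hL : 0 < L) {D : Finset ℕ}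
    (h : Real.exp (2 * L) ≤ ∏ p ∈ D, (p : ℝ)) : sieveTheta L D = 0 := by
  rw [sieveTheta, sieveBump_eq_zero, mul_zero]
  have h1 : 2 * L ≤ Real.log (∏ p ∈ D, (p : ℝ)) := by
    rw [Real.le_log_iff_exp_le ((Real.exp_pos _).trans_le h)]
    exact h
  exact (le_abs_self _).trans' ((le_div_iff₀ hL).2 h1)

lemma sieveB_empty (L : ℝ) : sieveB L ∅ = 1 := by
  simp [sieveB, sieveTheta, sieveBump_eq_one]

lemma one_le_prod_of_forall_one_le {ι : Type*} (s : Finset ι) (f : ι → ℝ) (h : ∀ i ∈ s, 1 ≤ f i) :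
    1 ≤ ∏ i ∈ s, f i := by
  calc (1 : ℝ) = ∏ i ∈ s, (1 : ℝ) := by simp
    _ ≤ _ := Finset.prod_le_prod (fun _ _ => zero_le_one) h

lemma sieveB_eq_zero {L : ℝ} (hL : 0 < L) {A : Finset ℕ} (hA : ∀ p ∈ A, 1 ≤ p) (hne : A.Nonempty)
    (h : ∏ p ∈ A, (p : ℝ) ≤ Real.exp L) : sieveB L A = 0 := by
  have h1 : ∀ D ∈ A.powerset, sieveTheta L D = (((-1) ^ D.card : ℤ) : ℝ) := by
    intro D hD
    rw [Finset.mem_powerset] at hD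
    have hD1 : 1 ≤ ∏ p ∈ D, (p : ℝ) :=
      one_le_prod_of_forall_one_le _ _ fun p hp => by exact_mod_cast hA p (hD hp)
    have hD2 : ∏ p ∈ D, (p : ℝ) ≤ ∏ p ∈ A, (p : ℝ) := by
      rw [← Finset.prod_sdiff hD]
      refine le_mul_of_one_le_left (by linarith) ?_
      refine one_le_prod_of_forall_one_le _ _ fun p hp => ?_
      exact_mod_cast hA p (Finset.sdiff_subset hp)
    have hlog : Real.log (∏ p ∈ D, (p : ℝ)) ≤ L := by
      rw [Real.log_le_iff_le_exp (by linarith)]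
      linarith
    rw [sieveTheta, sieveBump_eq_one, mul_one]
    · push_cast; rfl
    · rw [abs_of_nonneg (div_nonneg (Real.log_nonneg hD1) hL.le), div_le_one hL]
      exact hlog
  rw [sieveB, Finset.sum_congr rfl h1, ← Int.cast_sum, Finset.sum_powerset_neg_one_pow_card,
    if_neg hne.ne_empty, Int.cast_zero]

/-- The local factor dominating `|1 - p^{-(1 - 2 π i t)/L}|²`. -/
noncomputable def sieveG (L t : ℝ) (p : ℕ) : ℝ :=
  min 4 ((7 * (1 + |t|) * Real.log p / L) ^ 2)

lemma sieveG_nonneg (L t : ℝ) (p : ℕ) : 0 ≤ sieveG L t p := le_min (by norm_num) (sq_nonneg _)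

lemma sieveG_le_four (L t : ℝ) (p : ℕ) : sieveG L t p ≤ 4 := min_le_left _ _

lemma prod_sieveG_le (L t : ℝ) (A : Finset ℕ) : ∏ p ∈ A, sieveG L t p ≤ 4 ^ A.card := by
  rw [← Finset.prod_const]
  exact Finset.prod_le_prod (fun p _ => sieveG_nonneg L t p) fun p _ => sieveG_le_four L t p

lemma norm_one_sub_exp_neg_le {w : ℂ} (hw : 0 ≤ w.re) : ‖1 - Complex.exp (-w)‖ ≤ min 2 ‖w‖ := by
  have h2 : ‖Complex.exp (-w)‖ ≤ 1 := by
    rw [Complex.norm_exp]; simpa using hw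
  refine le_min ?_ ?_
  · calc ‖1 - Complex.exp (-w)‖ ≤ ‖(1:ℂ)‖ + ‖Complex.exp (-w)‖ := norm_sub_le _ _
      _ ≤ 2 := by rw [norm_one]; linarith
  · have h : ∀ z ∈ {z : ℂ | 0 ≤ z.re}, HasDerivWithinAt (fun z => Complex.exp (-z))
        (-Complex.exp (-z)) {z : ℂ | 0 ≤ z.re} z := by
      intro z _
      have := ((hasDerivAt_id z).neg).cexp
      simpa using this.hasDerivWithinAt
    have hconv : Convex ℝ {z : ℂ | 0 ≤ z.re} := convex_halfSpace_re_ge 0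
    have := hconv.norm_image_sub_le_of_norm_hasDerivWithin_le h (C := 1) ?_
      (show w ∈ {z : ℂ | 0 ≤ z.re} from hw) (show (0:ℂ) ∈ {z : ℂ | 0 ≤ z.re} by simp)
    · simpa using this
    · intro z hz
      rw [norm_neg, Complex.norm_exp]
      simpa using hz

lemma norm_one_sub_exp_sq_le_sieveG {L : ℝ} (hL : 0 < L) (t : ℝ) {p : ℕ} (hp : 1 ≤ p) :
    ‖1 - Complex.exp (-((Real.log p / L : ℝ) * (1 - 2 * Real.pi * t * Complex.I)))‖ ^ 2 ≤
      sieveG L t p := by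
  have hlog : 0 ≤ Real.log p / L := div_nonneg (Real.log_nonneg (by exact_mod_cast hp)) hL.le
  set x := Real.log p / L with hx
  have h1 := norm_one_sub_exp_neg_le (w := (x : ℂ) * (1 - 2 * Real.pi * t * Complex.I))
    (by simpa using hlog)
  have h2 : ‖(x : ℂ) * (1 - 2 * Real.pi * t * Complex.I)‖ ≤ 7 * (1 + |t|) * Real.log p / L := by
    rw [norm_mul, Complex.norm_real, Real.norm_of_nonneg hlog]
    have : ‖(1 - 2 * Real.pi * t * Complex.I : ℂ)‖ ≤ 1 + 2 * Real.pi * |t| := by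
      refine (norm_sub_le _ _).trans ?_
      simp [abs_of_pos Real.pi_pos]
    have hpi := Real.pi_lt_d2
    have h3 : 1 + 2 * Real.pi * |t| ≤ 7 * (1 + |t|) := by nlinarith [abs_nonneg t]
    calc _ ≤ x * (7 * (1 + |t|)) := by gcongr; linarith
      _ = _ := by rw [hx]; ring
  refine le_min ?_ ?_
  · calc _ ≤ (2 : ℝ) ^ 2 := by gcongr; exact h1.trans (min_le_left _ _)
      _ = 4 := by norm_num
  · gcongr
    exact (h1.trans (min_le_right _ _)).trans h2

lemma continuous_sieveG (L : ℝ) (p : ℕ) : Continuous fun t => sieveG L t p := by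
  unfold sieveG; fun_prop

/-- Pointwise domination of the squared sieve weight by an average of multiplicative functions. -/
lemma exists_sieveB_sq_le : ∃ F : ℝ → ℝ, (∀ t, 0 ≤ F t) ∧ Continuous F ∧
    (∀ k : ℕ, MeasureTheory.Integrable (fun t => F t * (1 + |t|) ^ k)) ∧
    ∀ L : ℝ, 0 < L → ∀ A : Finset ℕ, (∀ p ∈ A, 1 ≤ p) →
      sieveB L A ^ 2 ≤ ∫ t, F t * ∏ p ∈ A, sieveG L t p := by
  obtain ⟨f, hfc, hfi, hf⟩ := exists_sieveBump_eq_integral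
  set M := ∫ t, ‖f t‖ with hM
  have hf0 : MeasureTheory.Integrable (fun t => ‖f t‖) := by simpa using hfi 0
  have hM0 : 0 ≤ M := MeasureTheory.integral_nonneg fun t => norm_nonneg _
  refine ⟨fun t => M * ‖f t‖, fun t => by positivity, by fun_prop, fun k => ?_, ?_⟩
  · simpa [mul_assoc] using (hfi k).const_mul M
  intro L hL A hA
  let P : ℝ → ℂ := fun t => ∏ p ∈ A,
    (1 - Complex.exp (-((Real.log p / L : ℝ) * (1 - 2 * Real.pi * t * Complex.I))))
  have hPc : Continuous P := by fun_prop
  have hP2 : ∀ t, ‖P t‖ ^ 2 ≤ ∏ p ∈ A, sieveG L t p := by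
    intro t
    simp only [P, norm_prod, ← Finset.prod_pow]
    refine Finset.prod_le_prod (fun _ _ => by positivity) fun p hp => ?_
    exact norm_one_sub_exp_sq_le_sieveG hL t (hA p hp)
  have hPb : ∀ t, ‖P t‖ ≤ 2 ^ A.card := by
    intro t
    have h4 : ∏ p ∈ A, sieveG L t p ≤ 4 ^ A.card :=
      prod_sieveG_le L t _
    have h5 : ‖P t‖ ^ 2 ≤ (2 ^ A.card) ^ 2 := by
      refine (hP2 t).trans (h4.trans (le_of_eq ?_))
      rw [← pow_mul, mul_comm, pow_mul]; norm_num
    exact le_of_sq_le_sq h5 (by positivity)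
  have hrep : ((sieveB L A : ℝ) : ℂ) = ∫ t, f t * P t := by
    have h1 : ∀ D ∈ A.powerset, ((sieveTheta L D : ℝ) : ℂ) = ∫ t, f t *
        ∏ p ∈ D, (-Complex.exp (-((Real.log p / L : ℝ) * (1 - 2 * Real.pi * t * Complex.I)))) := by
      intro D hD
      rw [Finset.mem_powerset] at hD
      rw [sieveTheta, Complex.ofReal_mul, hf, ← MeasureTheory.integral_const_mul]
      refine MeasureTheory.integral_congr_ae (Filter.Eventually.of_forall fun t => ?_)
      simp only
      rw [Finset.prod_neg, ← Complex.exp_sum, Real.log_prod (fun p hp => by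
        have := hA p (hD hp); positivity), Finset.sum_div]
      push_cast
      rw [Finset.sum_mul, Finset.sum_neg_distrib]
      ring
    rw [sieveB, Complex.ofReal_sum, Finset.sum_congr rfl h1, ← MeasureTheory.integral_finsetSum]
    · refine MeasureTheory.integral_congr_ae (Filter.Eventually.of_forall fun t => ?_)
      simp only [P]
      rw [← Finset.mul_sum, ← Finset.prod_one_add]
      simp [sub_eq_add_neg]
    · intro D hD
      rw [Finset.mem_powerset] at hD
      refine hf0.mono' (by fun_prop) (Filter.Eventually.of_forall fun t => ?_)
      rw [norm_mul, norm_prod]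
      refine mul_le_of_le_one_right (norm_nonneg _) ?_
      refine Finset.prod_le_one (fun _ _ => norm_nonneg _) fun p hp => ?_
      rw [norm_neg, Complex.norm_exp]
      have : 0 ≤ Real.log p / L :=
        div_nonneg (Real.log_nonneg (by exact_mod_cast hA p (hD hp))) hL.le
      have h6 : (-(((Real.log p / L : ℝ) : ℂ) * (1 - 2 * Real.pi * t * Complex.I))).re =
          -(Real.log p / L) := by
        rw [Complex.neg_re, Complex.re_ofReal_mul]; simp
      rw [h6, Real.exp_le_one_iff]
      linarith
  have hi1 : MeasureTheory.Integrable (fun t => ‖f t‖ * ‖P t‖) := by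
    refine (hf0.mul_const (2 ^ A.card)).mono' (by fun_prop) (Filter.Eventually.of_forall fun t => ?_)
    rw [Real.norm_of_nonneg (by positivity)]
    exact mul_le_mul_of_nonneg_left (hPb t) (norm_nonneg _)
  have hi2 : MeasureTheory.Integrable (fun t => ‖f t‖ * ‖P t‖ ^ 2) := by
    refine (hf0.mul_const ((2 ^ A.card) ^ 2)).mono' (by fun_prop)
      (Filter.Eventually.of_forall fun t => ?_)
    rw [Real.norm_of_nonneg (by positivity)]
    exact mul_le_mul_of_nonneg_left (by gcongr; exact hPb t) (norm_nonneg _)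
  have hGc : Continuous fun t => ∏ p ∈ A, sieveG L t p :=
    continuous_finsetProd _ fun p _ => continuous_sieveG L p
  have hi3 : MeasureTheory.Integrable (fun t => ‖f t‖ * ∏ p ∈ A, sieveG L t p) := by
    refine (hf0.mul_const (4 ^ A.card)).mono' (by fun_prop)
      (Filter.Eventually.of_forall fun t => ?_)
    have h0 : 0 ≤ ∏ p ∈ A, sieveG L t p := Finset.prod_nonneg fun p _ => sieveG_nonneg L t p
    rw [Real.norm_of_nonneg (by positivity)]
    exact mul_le_mul_of_nonneg_left
      (prod_sieveG_le L t _) (norm_nonneg _)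
  set I := ∫ t, ‖f t‖ * ‖P t‖ with hI
  set J := ∫ t, ‖f t‖ * ‖P t‖ ^ 2 with hJ
  have hBI : |sieveB L A| ≤ I := by
    have := MeasureTheory.norm_integral_le_integral_norm (μ := MeasureTheory.volume) (fun t : ℝ => f t * P t)
    rw [← hrep, Complex.norm_real] at this
    simpa [hI] using this
  have hI0 : 0 ≤ I := (abs_nonneg _).trans hBI
  have hCS : I ^ 2 ≤ M * J := by
    have hquad : ∀ x : ℝ, 0 ≤ M * (x * x) + (-2 * I) * x + J := by
      intro x
      have h : ∫ t, ‖f t‖ * (‖P t‖ - x) ^ 2 = M * (x * x) + (-2 * I) * x + J := by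
        have : ∀ t, ‖f t‖ * (‖P t‖ - x) ^ 2 =
            (x * x) * ‖f t‖ + (-2 * x) * (‖f t‖ * ‖P t‖) + ‖f t‖ * ‖P t‖ ^ 2 := fun t => by ring
        simp only [this]
        have h7 : MeasureTheory.Integrable
            (fun t => (x * x) * ‖f t‖ + (-2 * x) * (‖f t‖ * ‖P t‖)) :=
          (hf0.const_mul _).add (hi1.const_mul _)
        rw [MeasureTheory.integral_add h7 hi2,
          MeasureTheory.integral_add (hf0.const_mul _) (hi1.const_mul _),
          MeasureTheory.integral_const_mul, MeasureTheory.integral_const_mul]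
        ring
      rw [← h]
      exact MeasureTheory.integral_nonneg fun t => by positivity
    have := discrim_le_zero hquad
    rw [discrim] at this
    linarith
  have hJK : J ≤ ∫ t, ‖f t‖ * ∏ p ∈ A, sieveG L t p :=
    MeasureTheory.integral_mono hi2 hi3 fun t => mul_le_mul_of_nonneg_left (hP2 t) (norm_nonneg _)
  calc sieveB L A ^ 2 = |sieveB L A| ^ 2 := (sq_abs _).symm
    _ ≤ I ^ 2 := by gcongr
    _ ≤ M * J := hCS
    _ ≤ M * ∫ t, ‖f t‖ * ∏ p ∈ A, sieveG L t p := by gcongr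
    _ = _ := by rw [← MeasureTheory.integral_const_mul]; simp only [mul_assoc]

/-- Weighted sums of squared sieve weights from bounds for multiplicative functions. -/
lemma exists_sum_sieveB_sq_le : ∃ C : ℝ, 0 < C ∧ ∀ (L : ℝ), 0 < L → ∀ {ι : Type} (s : Finset ι)
    (w : ι → ℝ) (A : ι → Finset ℕ) (K : ℝ), (∀ i ∈ s, 0 ≤ w i) → (∀ i ∈ s, ∀ p ∈ A i, 1 ≤ p) →
    (∀ t, ∑ i ∈ s, w i * ∏ p ∈ A i, sieveG L t p ≤ K * (1 + |t|) ^ 64) →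
    ∑ i ∈ s, w i * sieveB L (A i) ^ 2 ≤ C * K := by
  obtain ⟨F, hF0, hFc, hFi, hF⟩ := exists_sieveB_sq_le
  have hC0 : 0 ≤ ∫ t, F t * (1 + |t|) ^ 64 :=
    MeasureTheory.integral_nonneg fun t => mul_nonneg (hF0 t) (by positivity)
  refine ⟨(∫ t, F t * (1 + |t|) ^ 64) + 1, by linarith, ?_⟩
  intro L hL ι s w A K hw hA hK
  have hFi0 : MeasureTheory.Integrable F := by simpa using hFi 0
  have hGc : ∀ i, Continuous fun t => ∏ p ∈ A i, sieveG L t p := fun i =>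
    continuous_finsetProd _ fun p _ => continuous_sieveG L p
  have hi : ∀ i, MeasureTheory.Integrable (fun t => F t * ∏ p ∈ A i, sieveG L t p) := by
    intro i
    have := hGc i
    refine (hFi0.mul_const (4 ^ (A i).card)).mono' (by fun_prop)
      (Filter.Eventually.of_forall fun t => ?_)
    have h0 : 0 ≤ ∏ p ∈ A i, sieveG L t p := Finset.prod_nonneg fun p _ => sieveG_nonneg L t p
    rw [Real.norm_of_nonneg (mul_nonneg (hF0 t) h0)]
    exact mul_le_mul_of_nonneg_left
      (prod_sieveG_le L t _) (hF0 t)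
  have hK0 : 0 ≤ K := by
    have h := hK 0
    simp only [abs_zero, add_zero, one_pow, mul_one] at h
    refine le_trans (Finset.sum_nonneg fun i hi => mul_nonneg (hw i hi) ?_) h
    exact Finset.prod_nonneg fun p _ => sieveG_nonneg L 0 p
  calc ∑ i ∈ s, w i * sieveB L (A i) ^ 2
      ≤ ∑ i ∈ s, w i * ∫ t, F t * ∏ p ∈ A i, sieveG L t p :=
        Finset.sum_le_sum fun i hi => mul_le_mul_of_nonneg_left (hF L hL _ (hA i hi)) (hw i hi)
    _ = ∫ t, F t * ∑ i ∈ s, w i * ∏ p ∈ A i, sieveG L t p := by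
        simp only [← MeasureTheory.integral_const_mul]
        rw [← MeasureTheory.integral_finsetSum _ fun i _ => (hi i).const_mul _]
        refine MeasureTheory.integral_congr_ae (Filter.Eventually.of_forall fun t => ?_)
        simp only [Finset.mul_sum]
        exact Finset.sum_congr rfl fun i _ => by ring
    _ ≤ ∫ t, K * (F t * (1 + |t|) ^ 64) := by
        refine MeasureTheory.integral_mono ?_ ((hFi 64).const_mul K) fun t => ?_
        · have : (fun t => F t * ∑ i ∈ s, w i * ∏ p ∈ A i, sieveG L t p) =
              fun t => ∑ i ∈ s, w i * (F t * ∏ p ∈ A i, sieveG L t p) := by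
            ext t
            rw [Finset.mul_sum]
            exact Finset.sum_congr rfl fun i _ => by ring
          rw [this]
          exact MeasureTheory.integrable_finsetSum _ fun i _ => (hi i).const_mul _
        · calc _ ≤ F t * (K * (1 + |t|) ^ 64) := mul_le_mul_of_nonneg_left (hK t) (hF0 t)
            _ = _ := by ring
    _ = (∫ t, F t * (1 + |t|) ^ 64) * K := by rw [MeasureTheory.integral_const_mul, mul_comm]
    _ ≤ _ := by gcongr; linarith

lemma prod_one_add_le_exp_sum {ι : Type*} (s : Finset ι) (x : ι → ℝ) (hx : ∀ i ∈ s, 0 ≤ x i) :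
    ∏ i ∈ s, (1 + x i) ≤ Real.exp (∑ i ∈ s, x i) := by
  rw [Real.exp_sum]
  refine Finset.prod_le_prod (fun i hi => by linarith [hx i hi]) fun i _ => ?_
  linarith [Real.add_one_le_exp (x i)]

lemma sum_prod_primeFactors_div_le (g : ℕ → ℝ) (hg : ∀ p, 0 ≤ g p) (Y : ℕ) :
    ∑ n ∈ Finset.Icc 1 Y, (1 / (n : ℝ)) * ∏ p ∈ n.primeFactors, g p ≤
      ∏ p ∈ (Y + 1).primesBelow, (1 + g p / (p - 1)) := by
  let f : ℕ → ℝ := fun n => (1 / (n : ℝ)) * ∏ p ∈ n.primeFactors, g p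
  have hf0 : ∀ n, 0 ≤ f n := fun n => mul_nonneg (by positivity) (Finset.prod_nonneg fun p _ => hg p)
  have hf1 : f 1 = 1 := by simp [f]
  have hmul : ∀ {m n : ℕ}, Nat.Coprime m n → f (m * n) = f m * f n := by
    intro m n h
    simp only [f]
    rw [Nat.Coprime.primeFactors_mul h, Finset.prod_union h.disjoint_primeFactors]
    push_cast
    ring
  have hpow : ∀ {p : ℕ}, p.Prime → HasSum (fun n : ℕ => f (p ^ n)) (1 + g p / (p - 1)) := by
    intro p hp
    have h1 : HasSum (fun n : ℕ => g p * (1 / (p : ℝ)) ^ n) (g p * (1 - 1 / (p : ℝ))⁻¹) := by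
      refine (hasSum_geometric_of_lt_one (by positivity) ?_).mul_left _
      rw [div_lt_one (by exact_mod_cast hp.pos)]
      exact_mod_cast hp.one_lt
    have h2 : HasSum (fun n : ℕ => if n = 0 then (1 - g p) else 0) (1 - g p) :=
      hasSum_ite_eq 0 _
    have hp1 : (p : ℝ) - 1 ≠ 0 := by
      have : (1 : ℝ) < p := by exact_mod_cast hp.one_lt
      linarith
    have hp0 : (p : ℝ) ≠ 0 := by exact_mod_cast hp.ne_zero
    convert h1.add h2 using 1
    · ext n
      rcases eq_or_ne n 0 with rfl | hn
      · simp [f]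
      · simp [f, Nat.primeFactors_prime_pow hn hp, hn, mul_comm]
    · field_simp
      ring
  have hE := EulerProduct.summable_and_hasSum_smoothNumbers_prod_primesBelow_tsum hf1 hmul
    (fun hp => by simpa using (hpow hp).summable.norm) (Y + 1)
  have hE2 := hE.2
  have h3 : ∏ p ∈ (Y + 1).primesBelow, ∑' n : ℕ, f (p ^ n) =
      ∏ p ∈ (Y + 1).primesBelow, (1 + g p / (p - 1)) :=
    Finset.prod_congr rfl fun p hp => (hpow (Nat.prime_of_mem_primesBelow hp)).tsum_eq
  rw [h3] at hE2
  have hmem : ∀ n ∈ Finset.Icc 1 Y, n ∈ (Y + 1).smoothNumbers := by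
    intro n hn
    rw [Finset.mem_Icc] at hn
    exact Nat.mem_smoothNumbers_of_lt (by omega) (by omega)
  have h4 : ∑ n ∈ Finset.Icc 1 Y, f n =
      ∑ n ∈ (Finset.Icc 1 Y).subtype (· ∈ (Y + 1).smoothNumbers), f n := by
    rw [Finset.sum_subtype_of_mem _ hmem]
  change ∑ n ∈ Finset.Icc 1 Y, f n ≤ _
  rw [h4]
  exact sum_le_hasSum _ (fun n _ => hf0 n) hE2

lemma log_le_prod_primesBelow (Y : ℕ) :
    Real.log (Y + 1) ≤ ∏ p ∈ (Y + 1).primesBelow, (1 - 1 / (p : ℝ))⁻¹ := by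
  have h := sum_prod_primeFactors_div_le (fun _ => 1) (fun _ => zero_le_one) Y
  simp only [Finset.prod_const_one, mul_one] at h
  have h1 : ∏ p ∈ (Y + 1).primesBelow, (1 + 1 / ((p : ℝ) - 1)) =
      ∏ p ∈ (Y + 1).primesBelow, (1 - 1 / (p : ℝ))⁻¹ := by
    refine Finset.prod_congr rfl fun p hp => ?_
    have hp2 : (1 : ℝ) < p := by exact_mod_cast (Nat.prime_of_mem_primesBelow hp).one_lt
    have h3 : (p : ℝ) - 1 ≠ 0 := by linarith
    have h4 : (p : ℝ) ≠ 0 := by linarith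
    field_simp
    ring
  rw [h1] at h
  refine le_trans ?_ h
  have h2 := log_add_one_le_harmonic Y
  rw [harmonic_eq_sum_Icc] at h2
  push_cast at h2
  simpa using h2

/-- Logarithmic mean square of the sieve weights. -/
lemma exists_sum_sieveB_sq_div_le (B : ℝ) (hB : 0 < B) : ∃ C : ℝ, 0 < C ∧ ∀ L : ℝ, 0 < L →
    ∀ Y : ℕ, Real.log Y ≤ B * L →
      ∑ n ∈ Finset.Icc 1 Y, (1 / (n : ℝ)) * sieveB L n.primeFactors ^ 2 ≤ C := by
  obtain ⟨C, hC, h⟩ := exists_sum_sieveB_sq_le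
  refine ⟨C * (1 + 14 * B) ^ 64, by positivity, fun L hL Y hY => ?_⟩
  refine h L hL _ _ _ _ (fun _ _ => by positivity)
    (fun n _ p hp => (Nat.prime_of_mem_primeFactors hp).one_le) fun t => ?_
  have ht := abs_nonneg t
  refine (sum_prod_primeFactors_div_le _ (sieveG_nonneg L t) Y).trans ?_
  have h1 : ∀ p ∈ (Y + 1).primesBelow, 1 + sieveG L t p / (p - 1) ≤ 1 + 2 * (sieveG L t p / p) := by
    intro p hp
    have hp2 : (2 : ℝ) ≤ p := by exact_mod_cast (Nat.prime_of_mem_primesBelow hp).two_le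
    have h3 : sieveG L t p / (p - 1) ≤ sieveG L t p / (p / 2) :=
      div_le_div_of_nonneg_left (sieveG_nonneg L t p) (by linarith) (by linarith)
    calc _ ≤ 1 + sieveG L t p / (p / 2) := by linarith
      _ = _ := by ring
  have h2 := sum_prime_min_le (Y + 1).primesBelow (fun p hp => Nat.prime_of_mem_primesBelow hp)
    L B (7 * (1 + |t|)) hL hB (by positivity) ?_
  · calc _ ≤ ∏ p ∈ (Y + 1).primesBelow, (1 + 2 * (sieveG L t p / p)) := by
          refine Finset.prod_le_prod (fun p hp => ?_) h1
          have hp2 : (2 : ℝ) ≤ p := by exact_mod_cast (Nat.prime_of_mem_primesBelow hp).two_le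
          have := div_nonneg (sieveG_nonneg L t p) (by linarith : (0 : ℝ) ≤ p - 1)
          linarith
      _ ≤ Real.exp (∑ p ∈ (Y + 1).primesBelow, 2 * (sieveG L t p / p)) :=
          prod_one_add_le_exp_sum _ _ fun p _ =>
            mul_nonneg two_pos.le (div_nonneg (sieveG_nonneg L t p) (Nat.cast_nonneg _))
      _ ≤ Real.exp (64 * Real.log (1 + 2 * B * (7 * (1 + |t|)))) := by
          rw [← Finset.mul_sum]
          refine Real.exp_le_exp.2 ?_
          have h3 : ∑ p ∈ (Y + 1).primesBelow, sieveG L t p / p ≤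
              32 * Real.log (1 + 2 * B * (7 * (1 + |t|))) := h2
          linarith
      _ = (1 + 2 * B * (7 * (1 + |t|))) ^ 64 := by
          rw [show (64 : ℝ) = ((64 : ℕ) : ℝ) by norm_num, Real.exp_nat_mul,
            Real.exp_log (by positivity)]
      _ ≤ ((1 + 14 * B) * (1 + |t|)) ^ 64 := by
          gcongr
          nlinarith
      _ = _ := mul_pow _ _ _
  · intro p hp
    refine le_trans (Real.log_le_log ?_ ?_) hY
    · exact_mod_cast (Nat.prime_of_mem_primesBelow hp).pos
    · have := Nat.lt_of_mem_primesBelow hp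
      exact_mod_cast (by omega : p ≤ Y)

/-- Diagonalisation of the sieve quadratic form. -/
lemma sum_sieveTheta_eq (L : ℝ) (S : Finset ℕ) :
    ∑ D₁ ∈ S.powerset, ∑ D₂ ∈ S.powerset, sieveTheta L D₁ * sieveTheta L D₂ *
        ∏ p ∈ D₁ ∪ D₂, (1 / (p : ℝ)) =
      ∑ A ∈ S.powerset, ((∏ p ∈ A, (1 / (p : ℝ))) * ∏ p ∈ S \ A, (1 - 1 / (p : ℝ))) *
        sieveB L A ^ 2 := by
  have h1 : ∀ E ⊆ S, ∑ A ∈ S.powerset with E ⊆ A,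
      ((∏ p ∈ A, (1 / (p : ℝ))) * ∏ p ∈ S \ A, (1 - 1 / (p : ℝ))) = ∏ p ∈ E, (1 / (p : ℝ)) := by
    intro E hE
    have h2 := Finset.prod_add (fun p : ℕ => 1 / (p : ℝ))
      (fun p => if p ∈ E then 0 else 1 - 1 / (p : ℝ)) S
    have h3 : ∏ p ∈ S, (1 / (p : ℝ) + if p ∈ E then 0 else 1 - 1 / (p : ℝ)) =
        ∏ p ∈ E, (1 / (p : ℝ)) := by
      rw [← Finset.prod_subset hE (f := fun p : ℕ => (1 / (p : ℝ) + if p ∈ E then 0 else 1 - 1 / (p : ℝ)))]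
      · exact Finset.prod_congr rfl fun p hp => by simp [hp]
      · intro p _ hp; simp [hp]
    rw [← h3, h2, Finset.sum_filter]
    refine Finset.sum_congr rfl fun A hA => ?_
    split_ifs with h
    · congr 1
      refine Finset.prod_congr rfl fun p hp => ?_
      rw [if_neg fun hpE => (Finset.mem_sdiff.1 hp).2 (h hpE)]
    · obtain ⟨p, hpE, hpA⟩ := Finset.not_subset.1 h
      rw [Finset.prod_eq_zero (i := p) (Finset.mem_sdiff.2 ⟨hE hpE, hpA⟩) (by simp [hpE]), mul_zero]
  have h4 : ∀ A ∈ S.powerset, sieveB L A ^ 2 = ∑ D₁ ∈ S.powerset, ∑ D₂ ∈ S.powerset,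
      if D₁ ∪ D₂ ⊆ A then sieveTheta L D₁ * sieveTheta L D₂ else 0 := by
    intro A hA
    rw [Finset.mem_powerset] at hA
    have h5 : sieveB L A = ∑ D ∈ S.powerset, if D ⊆ A then sieveTheta L D else 0 := by
      rw [← Finset.sum_filter, sieveB]
      refine Finset.sum_congr ?_ fun _ _ => rfl
      ext D
      simp only [Finset.mem_powerset, Finset.mem_filter]
      exact ⟨fun h => ⟨h.trans hA, h⟩, fun h => h.2⟩
    rw [sq, h5, Finset.sum_mul_sum]
    refine Finset.sum_congr rfl fun D₁ _ => Finset.sum_congr rfl fun D₂ _ => ?_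
    by_cases h6 : D₁ ⊆ A <;> by_cases h7 : D₂ ⊆ A <;> simp [h6, h7, Finset.union_subset_iff]
  symm
  calc _ = ∑ A ∈ S.powerset, ∑ D₁ ∈ S.powerset,
        ((∏ p ∈ A, (1 / (p : ℝ))) * ∏ p ∈ S \ A, (1 - 1 / (p : ℝ))) * ∑ D₂ ∈ S.powerset,
          if D₁ ∪ D₂ ⊆ A then sieveTheta L D₁ * sieveTheta L D₂ else 0 :=
        Finset.sum_congr rfl fun A hA => by rw [h4 A hA, Finset.mul_sum]
    _ = _ := ?_
  rw [Finset.sum_comm]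
  refine Finset.sum_congr rfl fun D₁ hD₁ => ?_
  rw [Finset.sum_congr rfl fun A hA => Finset.mul_sum _ _ _]
  rw [Finset.sum_comm]
  refine Finset.sum_congr rfl fun D₂ hD₂ => ?_
  rw [Finset.mem_powerset] at hD₁ hD₂
  rw [← h1 _ (Finset.union_subset hD₁ hD₂), Finset.sum_filter, Finset.mul_sum]
  refine Finset.sum_congr rfl fun A _ => ?_
  split_ifs <;> ring

/-- Bound for the sieve quadratic form over an arbitrary set of primes up to the level. -/
lemma exists_sieve_form_le : ∃ C : ℝ, 0 < C ∧ ∀ L : ℝ, 0 < L → ∀ S : Finset ℕ,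
    (∀ p ∈ S, p.Prime) → (∀ p ∈ S, Real.log p ≤ 2 * L) →
    ∑ D₁ ∈ S.powerset, ∑ D₂ ∈ S.powerset, sieveTheta L D₁ * sieveTheta L D₂ *
        ∏ p ∈ D₁ ∪ D₂, (1 / (p : ℝ)) ≤ C * ∏ p ∈ S, (1 - 1 / (p : ℝ)) := by
  obtain ⟨C, hC, h⟩ := exists_sum_sieveB_sq_le
  refine ⟨C * 29 ^ 64, by positivity, fun L hL S hS hSL => ?_⟩
  have hp2 : ∀ p ∈ S, (2 : ℝ) ≤ p := fun p hp => by exact_mod_cast (hS p hp).two_le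
  have hp3 : ∀ p ∈ S, 0 ≤ 1 / (p : ℝ) ∧ 1 / (p : ℝ) ≤ 1 / 2 := fun p hp =>
    ⟨by positivity, one_div_le_one_div_of_le two_pos (hp2 p hp)⟩
  rw [sum_sieveTheta_eq, mul_assoc]
  refine h L hL _ _ _ _ (fun A hA => ?_) (fun A hA p hp => ?_) fun t => ?_
  · rw [Finset.mem_powerset] at hA
    refine mul_nonneg (Finset.prod_nonneg fun p hp => (hp3 p (hA hp)).1)
      (Finset.prod_nonneg fun p hp => ?_)
    have := (hp3 p (Finset.sdiff_subset hp)).2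
    linarith
  · exact (hS p (Finset.mem_powerset.1 hA hp)).one_le
  · have h1 : ∑ A ∈ S.powerset, ((∏ p ∈ A, (1 / (p : ℝ))) * ∏ p ∈ S \ A, (1 - 1 / (p : ℝ))) *
        ∏ p ∈ A, sieveG L t p = ∏ p ∈ S, (sieveG L t p / p + (1 - 1 / (p : ℝ))) := by
      rw [Finset.prod_add]
      refine Finset.sum_congr rfl fun A _ => ?_
      rw [mul_right_comm, ← Finset.prod_mul_distrib]
      congr 1
      exact Finset.prod_congr rfl fun p _ => by ring
    have h2 := sum_prime_min_le S hS L 2 (7 * (1 + |t|)) hL two_pos (by positivity) hSL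
    have hG : ∀ p ∈ S, 0 ≤ sieveG L t p / p := fun p _ =>
      div_nonneg (sieveG_nonneg L t p) (Nat.cast_nonneg _)
    have hP : 0 ≤ ∏ p ∈ S, (1 - 1 / (p : ℝ)) :=
      Finset.prod_nonneg fun p hp => by linarith [(hp3 p hp).2]
    have ht := abs_nonneg t
    rw [h1]
    calc _ ≤ ∏ p ∈ S, ((1 + 2 * (sieveG L t p / p)) * (1 - 1 / (p : ℝ))) := by
          refine Finset.prod_le_prod (fun p hp => ?_) fun p hp => ?_
          · linarith [hG p hp, (hp3 p hp).2]
          · nlinarith [hG p hp, (hp3 p hp).2]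
      _ = (∏ p ∈ S, (1 + 2 * (sieveG L t p / p))) * ∏ p ∈ S, (1 - 1 / (p : ℝ)) :=
          Finset.prod_mul_distrib
      _ ≤ Real.exp (64 * Real.log (1 + 2 * 2 * (7 * (1 + |t|)))) * ∏ p ∈ S, (1 - 1 / (p : ℝ)) := by
          refine mul_le_mul_of_nonneg_right ?_ hP
          refine (prod_one_add_le_exp_sum _ _ fun p hp => by linarith [hG p hp]).trans ?_
          rw [← Finset.mul_sum]
          refine Real.exp_le_exp.2 ?_
          have h3 : ∑ p ∈ S, sieveG L t p / p ≤ 32 * Real.log (1 + 2 * 2 * (7 * (1 + |t|))) := h2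
          linarith
      _ = (1 + 2 * 2 * (7 * (1 + |t|))) ^ 64 * ∏ p ∈ S, (1 - 1 / (p : ℝ)) := by
          rw [show (64 : ℝ) = ((64 : ℕ) : ℝ) by norm_num, Real.exp_nat_mul,
            Real.exp_log (by positivity)]
      _ ≤ (29 * (1 + |t|)) ^ 64 * ∏ p ∈ S, (1 - 1 / (p : ℝ)) := by
          gcongr
          nlinarith
      _ = _ := by rw [mul_pow]; ring

/-- The primes up to `e^{2 L}` not dividing `q`. -/
noncomputable def sievePrimes (q : ℕ) (L : ℝ) : Finset ℕ :=
  (⌊Real.exp (2 * L)⌋₊ + 1).primesBelow.filter fun p => ¬ p ∣ q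

lemma prime_of_mem_sievePrimes {q : ℕ} {L : ℝ} {p : ℕ} (hp : p ∈ sievePrimes q L) : p.Prime :=
  Nat.prime_of_mem_primesBelow (Finset.mem_filter.1 hp).1

lemma prod_sievePrimes_le (q : ℕ) (hq : 1 ≤ q) (L : ℝ) (hL : 0 < L) :
    ∏ p ∈ sievePrimes q L, (1 - 1 / (p : ℝ)) ≤ q / (q.totient * (2 * L)) := by
  set Y := ⌊Real.exp (2 * L)⌋₊
  set P := (Y + 1).primesBelow
  have hfac : ∀ p : ℕ, p.Prime → 0 < 1 - 1 / (p : ℝ) ∧ 1 - 1 / (p : ℝ) ≤ 1 := by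
    intro p hp
    have : (2 : ℝ) ≤ p := by exact_mod_cast hp.two_le
    have h := one_div_le_one_div_of_le two_pos this
    have h' : 0 < 1 / (p : ℝ) := by positivity
    constructor <;> linarith
  have h1 : 2 * L ≤ ∏ p ∈ P, (1 - 1 / (p : ℝ))⁻¹ := by
    refine le_trans ?_ (log_le_prod_primesBelow Y)
    rw [Real.le_log_iff_exp_le (by positivity)]
    exact (Nat.lt_floor_add_one _).le
  have h2 : ∏ p ∈ P, (1 - 1 / (p : ℝ)) ≤ 1 / (2 * L) := by
    rw [Finset.prod_inv_distrib] at h1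
    rw [le_one_div _ (by positivity), one_div]
    · exact h1
    · exact Finset.prod_pos fun p hp => (hfac p (Nat.prime_of_mem_primesBelow hp)).1
  have hq0 : (0 : ℝ) < q := by exact_mod_cast hq
  have htot : (0 : ℝ) < q.totient := by exact_mod_cast Nat.totient_pos.2 hq
  have h3 : (q.totient : ℝ) = q * ∏ p ∈ q.primeFactors, (1 - 1 / (p : ℝ)) := by
    have := Nat.totient_eq_mul_prod_factors q
    have h4 : ((q.totient : ℚ) : ℝ) = ((q * ∏ p ∈ q.primeFactors, (1 - (p : ℚ)⁻¹) : ℚ) : ℝ) := by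
      rw [this]
    push_cast at h4
    simpa using h4
  have h4 : ∏ p ∈ q.primeFactors, (1 - 1 / (p : ℝ)) ≤ ∏ p ∈ P.filter (· ∣ q), (1 - 1 / (p : ℝ)) := by
    have hsub : P.filter (· ∣ q) ⊆ q.primeFactors := by
      intro p hp
      rw [Finset.mem_filter] at hp
      exact Nat.mem_primeFactors.2 ⟨Nat.prime_of_mem_primesBelow hp.1, hp.2, by omega⟩
    rw [← Finset.prod_sdiff hsub]
    refine mul_le_of_le_one_left (Finset.prod_nonneg fun p hp => ?_)
      (Finset.prod_le_one (fun p hp => ?_) fun p hp => ?_)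
    · exact (hfac p (Nat.prime_of_mem_primeFactors (hsub hp))).1.le
    · exact (hfac p (Nat.prime_of_mem_primeFactors (Finset.sdiff_subset hp))).1.le
    · exact (hfac p (Nat.prime_of_mem_primeFactors (Finset.sdiff_subset hp))).2
  have h5 := Finset.prod_filter_mul_prod_filter_not P (· ∣ q) fun p : ℕ => (1 - 1 / (p : ℝ))
  rw [← h5] at h2
  change ∏ p ∈ P.filter (fun p => ¬ p ∣ q), (1 - 1 / (p : ℝ)) ≤ _
  set V := ∏ p ∈ P.filter (fun p => ¬ p ∣ q), (1 - 1 / (p : ℝ))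
  have hV : 0 ≤ V := Finset.prod_nonneg fun p hp =>
    (hfac p (Nat.prime_of_mem_primesBelow (Finset.mem_filter.1 hp).1)).1.le
  rw [le_div_iff₀ (by positivity), h3]
  rw [le_div_iff₀ (by positivity)] at h2
  calc V * (q * (∏ p ∈ q.primeFactors, (1 - 1 / (p : ℝ))) * (2 * L))
      ≤ V * (q * (∏ p ∈ P.filter (· ∣ q), (1 - 1 / (p : ℝ))) * (2 * L)) := by gcongr
    _ = q * ((∏ p ∈ P.filter (· ∣ q), (1 - 1 / (p : ℝ))) * V * (2 * L)) := by ring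
    _ ≤ q * 1 := by gcongr
    _ = q := mul_one _

lemma abs_card_Ioc_modEq_sub_le (y H r v : ℕ) (hr : 0 < r) :
    |(((Finset.Ioc y (y + H)).filter fun n => n ≡ v [MOD r]).card : ℝ) - H / r| ≤ 1 := by
  have h := Nat.Ioc_filter_modEq_card y (y + H) hr v
  have hr' : (0 : ℚ) < r := by exact_mod_cast hr
  set A : ℚ := (((y + H : ℕ) : ℚ) - v) / r
  set B : ℚ := ((y : ℚ) - v) / r
  have hAB : A - B = H / r := by
    simp only [A, B]; push_cast; field_simp; ring
  have hAB0 : B ≤ A := by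
    have : (0 : ℚ) ≤ H / r := by positivity
    linarith
  rw [max_eq_left (sub_nonneg.2 (Int.floor_le_floor hAB0))] at h
  have h2 : ((((Finset.Ioc y (y + H)).filter fun n => n ≡ v [MOD r]).card : ℤ) : ℚ) =
      ((⌊A⌋ - ⌊B⌋ : ℤ) : ℚ) := by
    rw [← h]
  have h3 : |(((Finset.Ioc y (y + H)).filter fun n => n ≡ v [MOD r]).card : ℚ) - H / r| ≤ 1 := by
    rw [← hAB]
    push_cast at h2
    rw [h2, abs_le]
    have := Int.floor_le A
    have := Int.lt_floor_add_one A
    have := Int.floor_le B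
    have := Int.lt_floor_add_one B
    constructor <;> linarith
  have h4 := (Rat.cast_le (K := ℝ)).2 h3
  push_cast at h4
  exact h4

lemma abs_card_Ioc_modEq_dvd_sub_le (y H q a d : ℕ) (hq : 0 < q) (hd : 0 < d) (hqd : q.Coprime d) :
    |(((Finset.Ioc y (y + H)).filter fun n => n ≡ a [MOD q] ∧ d ∣ n).card : ℝ) - H / (q * d)| ≤ 1 := by
  have h := abs_card_Ioc_modEq_sub_le y H (q * d) (Nat.chineseRemainder hqd a 0) (by positivity)
  have h1 : (fun n => n ≡ a [MOD q] ∧ d ∣ n) =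
      fun n => n ≡ (Nat.chineseRemainder hqd a 0 : ℕ) [MOD q * d] := by
    ext n
    have hc := (Nat.chineseRemainder hqd a 0).2
    rw [← Nat.modEq_and_modEq_iff_modEq_mul hqd, ← Nat.modEq_zero_iff_dvd]
    exact ⟨fun h => ⟨h.1.trans hc.1.symm, h.2.trans hc.2.symm⟩,
      fun h => ⟨h.1.trans hc.1, h.2.trans hc.2⟩⟩
  simp only [h1]
  push_cast at h
  exact h

lemma prod_dvd_iff_subset_primeFactors {D : Finset ℕ} (hD : ∀ p ∈ D, p.Prime) {n : ℕ} (hn : n ≠ 0) :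
    ∏ p ∈ D, p ∣ n ↔ D ⊆ n.primeFactors := by
  constructor
  · intro h p hp
    exact Nat.mem_primeFactors.2 ⟨hD p hp, (Finset.dvd_prod_of_mem _ hp).trans h, hn⟩
  · intro h
    exact Finset.prod_primes_dvd n (fun p hp => (hD p hp).prime)
      fun p hp => Nat.dvd_of_mem_primeFactors (h hp)

/-- The index sets of the sieve weights of level `e^{2 L}` coprime to `q`. -/
noncomputable def sieveIndex (q : ℕ) (L : ℝ) : Finset (Finset ℕ) :=
  (sievePrimes q L).powerset.filter fun D => ∏ p ∈ D, (p : ℝ) < Real.exp (2 * L)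

lemma prime_of_mem_sieveIndex {q : ℕ} {L : ℝ} {D : Finset ℕ} (hD : D ∈ sieveIndex q L) :
    ∀ p ∈ D, p.Prime := fun _ hp =>
  prime_of_mem_sievePrimes ((Finset.mem_powerset.1 (Finset.mem_filter.1 hD).1) hp)

lemma coprime_of_mem_sieveIndex {q : ℕ} {L : ℝ} {D : Finset ℕ} (hD : D ∈ sieveIndex q L) :
    ∀ p ∈ D, p.Coprime q := fun p hp => by
  have h := (Finset.mem_powerset.1 (Finset.mem_filter.1 hD).1) hp
  exact (prime_of_mem_sievePrimes h).coprime_iff_not_dvd.2 (Finset.mem_filter.1 h).2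

lemma card_sieveIndex_le (q : ℕ) (L : ℝ) : ((sieveIndex q L).card : ℝ) ≤ Real.exp (2 * L) := by
  have h : (sieveIndex q L).card ≤ (Finset.Icc 1 ⌊Real.exp (2 * L)⌋₊).card := by
    refine Finset.card_le_card_of_injOn (fun D => ∏ p ∈ D, p) (fun D hD => ?_) ?_
    · have hD' : D ∈ sieveIndex q L := hD
      have h1 := (Finset.mem_filter.1 hD').2
      simp only [Finset.coe_Icc, Set.mem_Icc]
      refine ⟨Finset.prod_pos fun p hp => (prime_of_mem_sieveIndex hD' p hp).pos, ?_⟩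
      refine Nat.le_floor ?_
      push_cast
      exact h1.le
    · intro D hD E hE hDE
      have hD' : D ∈ sieveIndex q L := hD
      have hE' : E ∈ sieveIndex q L := hE
      have h1 := Nat.primeFactors_prod (prime_of_mem_sieveIndex hD')
      have h2 := Nat.primeFactors_prod (prime_of_mem_sieveIndex hE')
      rw [← h1, ← h2]
      exact congrArg _ hDE
  rw [Nat.card_Icc, Nat.add_sub_cancel] at h
  calc ((sieveIndex q L).card : ℝ) ≤ ⌊Real.exp (2 * L)⌋₊ := by exact_mod_cast h
    _ ≤ _ := Nat.floor_le (Real.exp_pos _).le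

lemma sieveB_primeFactors_eq {q : ℕ} {L : ℝ} (hL : 0 < L) {n : ℕ}
    (hnq : n.Coprime q) : sieveB L n.primeFactors =
      ∑ D ∈ sieveIndex q L, if D ⊆ n.primeFactors then sieveTheta L D else 0 := by
  rw [← Finset.sum_filter, sieveB]
  symm
  refine Finset.sum_subset (fun D hD => ?_) fun D hD hD' => ?_
  · exact Finset.mem_powerset.2 (Finset.mem_filter.1 hD).2
  · rw [Finset.mem_powerset] at hD
    have hpr : ∀ p ∈ D, p.Prime := fun p hp => Nat.prime_of_mem_primeFactors (hD hp)
    refine sieveTheta_eq_zero hL ?_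
    by_contra! hlt
    refine hD' (Finset.mem_filter.2 ⟨
      Finset.mem_filter.2 ⟨Finset.mem_powerset.2 fun p hp => ?_, hlt⟩, hD⟩)
    refine Finset.mem_filter.2 ⟨?_, ?_⟩
    · rw [Nat.mem_primesBelow]
      refine ⟨Nat.lt_succ_of_le (Nat.le_floor (le_trans ?_ hlt.le)), hpr p hp⟩
      rw [← Finset.prod_erase_mul _ _ hp]
      refine le_mul_of_one_le_left (Nat.cast_nonneg _) ?_
      refine one_le_prod_of_forall_one_le _ _ fun p' hp' => ?_
      exact_mod_cast (hpr p' (Finset.mem_of_mem_erase hp')).one_le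
    · intro hpq
      exact Nat.Prime.one_lt (hpr p hp) |>.ne' (Nat.eq_one_of_dvd_coprimes hnq
        (Nat.dvd_of_mem_primeFactors (hD hp)) hpq)

/-- Mean square of the sieve weights in short arithmetic progressions. -/
lemma exists_sum_sieveB_sq_modEq_le : ∃ C : ℝ, 0 < C ∧ ∀ (L : ℝ), 1 ≤ L → ∀ q a y H : ℕ, 0 < q →
    a.Coprime q → q * Real.exp (5 * L) ≤ H →
    ∑ n ∈ (Finset.Ioc y (y + H)).filter (fun n => n ≡ a [MOD q]), sieveB L n.primeFactors ^ 2 ≤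
      C * (H / (q.totient * L)) := by
  obtain ⟨C, hC, hform⟩ := exists_sieve_form_le
  refine ⟨C + 1, by positivity, fun L hL1 q a y H hq haq hH => ?_⟩
  have hL : 0 < L := by linarith
  have hq0 : (0 : ℝ) < q := by exact_mod_cast hq
  have htot : (0 : ℝ) < q.totient := by exact_mod_cast Nat.totient_pos.2 hq
  set U := sieveIndex q L with hU
  set F := (Finset.Ioc y (y + H)).filter (fun n => n ≡ a [MOD q]) with hF
  have hFn : ∀ n ∈ F, n ≠ 0 ∧ n.Coprime q := by
    intro n hn
    rw [hF, Finset.mem_filter, Finset.mem_Ioc] at hn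
    refine ⟨by omega, ?_⟩
    rw [Nat.Coprime, hn.2.gcd_eq]
    exact haq
  have hunion : ∀ D₁ ∈ U, ∀ D₂ ∈ U, ∀ p ∈ D₁ ∪ D₂, p.Prime ∧ p.Coprime q := by
    intro D₁ h1 D₂ h2 p hp
    rcases Finset.mem_union.1 hp with h | h
    · exact ⟨prime_of_mem_sieveIndex h1 p h, coprime_of_mem_sieveIndex h1 p h⟩
    · exact ⟨prime_of_mem_sieveIndex h2 p h, coprime_of_mem_sieveIndex h2 p h⟩
  have h1 : ∑ n ∈ F, sieveB L n.primeFactors ^ 2 = ∑ D₁ ∈ U, ∑ D₂ ∈ U,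
      sieveTheta L D₁ * sieveTheta L D₂ *
        (((Finset.Ioc y (y + H)).filter fun n => n ≡ a [MOD q] ∧ ∏ p ∈ D₁ ∪ D₂, p ∣ n).card : ℝ) := by
    have h2 : ∀ n ∈ F, sieveB L n.primeFactors ^ 2 = ∑ D₁ ∈ U, ∑ D₂ ∈ U,
        sieveTheta L D₁ * sieveTheta L D₂ * if ∏ p ∈ D₁ ∪ D₂, p ∣ n then 1 else 0 := by
      intro n hn
      rw [sieveB_primeFactors_eq hL (hFn n hn).2, sq, Finset.sum_mul_sum]
      refine Finset.sum_congr rfl fun D₁ hD₁ => Finset.sum_congr rfl fun D₂ hD₂ => ?_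
      simp only [prod_dvd_iff_subset_primeFactors (fun p hp => (hunion D₁ hD₁ D₂ hD₂ p hp).1)
        (hFn n hn).1]
      by_cases h6 : D₁ ⊆ n.primeFactors <;> by_cases h7 : D₂ ⊆ n.primeFactors <;>
        simp [h6, h7, Finset.union_subset_iff]
    rw [Finset.sum_congr rfl h2, Finset.sum_comm]
    refine Finset.sum_congr rfl fun D₁ _ => ?_
    rw [Finset.sum_comm]
    refine Finset.sum_congr rfl fun D₂ _ => ?_
    rw [← Finset.mul_sum, Finset.sum_ite, Finset.sum_const_zero, add_zero, Finset.sum_const,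
      nsmul_eq_mul, mul_one, hF, Finset.filter_filter]
  have h3 : ∑ n ∈ F, sieveB L n.primeFactors ^ 2 ≤ ∑ D₁ ∈ U, ∑ D₂ ∈ U,
      (sieveTheta L D₁ * sieveTheta L D₂ * (∏ p ∈ D₁ ∪ D₂, (1 / (p : ℝ))) * (H / q) + 1) := by
    rw [h1]
    refine Finset.sum_le_sum fun D₁ hD₁ => Finset.sum_le_sum fun D₂ hD₂ => ?_
    have h4 := abs_card_Ioc_modEq_dvd_sub_le y H q a (∏ p ∈ D₁ ∪ D₂, p) hq
      (Finset.prod_pos fun p hp => (hunion D₁ hD₁ D₂ hD₂ p hp).1.pos)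
      (Nat.Coprime.symm (Nat.Coprime.prod_left fun p hp => (hunion D₁ hD₁ D₂ hD₂ p hp).2))
    have h5 : (H : ℝ) / (q * ((∏ p ∈ D₁ ∪ D₂, p : ℕ) : ℝ)) =
        (∏ p ∈ D₁ ∪ D₂, (1 / (p : ℝ))) * (H / q) := by
      rw [Finset.prod_div_distrib, Finset.prod_const_one]
      push_cast
      field_simp
    rw [h5] at h4
    set N : ℝ := (((Finset.Ioc y (y + H)).filter fun n =>
      n ≡ a [MOD q] ∧ ∏ p ∈ D₁ ∪ D₂, p ∣ n).card : ℝ)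
    set E := (∏ p ∈ D₁ ∪ D₂, (1 / (p : ℝ))) * (H / q) with hE
    set θ := sieveTheta L D₁ * sieveTheta L D₂ with hθ
    have h6 : |θ| ≤ 1 := by
      rw [hθ, abs_mul]
      exact mul_le_one₀ (abs_sieveTheta_le_one _ _) (abs_nonneg _) (abs_sieveTheta_le_one _ _)
    have h7 : |θ * (N - E)| ≤ 1 := by
      rw [abs_mul]; exact mul_le_one₀ h6 (abs_nonneg _) h4
    have h8 := (abs_le.1 h7).2
    have h9 : θ * (∏ p ∈ D₁ ∪ D₂, (1 / (p : ℝ))) * (H / q) = θ * E := by rw [hE]; ring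
    change θ * N ≤ θ * (∏ p ∈ D₁ ∪ D₂, (1 / (p : ℝ))) * (H / q) + 1
    rw [h9]
    linarith
  have h4 : ∑ D₁ ∈ U, ∑ D₂ ∈ U,
      (sieveTheta L D₁ * sieveTheta L D₂ * (∏ p ∈ D₁ ∪ D₂, (1 / (p : ℝ))) * (H / q) + 1) =
      (∑ D₁ ∈ U, ∑ D₂ ∈ U, sieveTheta L D₁ * sieveTheta L D₂ * (∏ p ∈ D₁ ∪ D₂, (1 / (p : ℝ)))) *
        (H / q) + U.card * U.card := by
    simp only [Finset.sum_add_distrib, Finset.sum_mul, Finset.sum_const, nsmul_eq_mul, mul_one]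
  have hUS : U ⊆ (sievePrimes q L).powerset := Finset.filter_subset _ _
  have hz : ∀ D ∈ (sievePrimes q L).powerset, D ∉ U → sieveTheta L D = 0 := by
    intro D hD hDU
    refine sieveTheta_eq_zero hL ?_
    by_contra! h
    exact hDU (Finset.mem_filter.2 ⟨hD, h⟩)
  have h5 : ∑ D₁ ∈ U, ∑ D₂ ∈ U, sieveTheta L D₁ * sieveTheta L D₂ * (∏ p ∈ D₁ ∪ D₂, (1 / (p : ℝ))) ≤
      C * (q / (q.totient * (2 * L))) := by
    refine le_trans (le_of_eq ?_) ((hform L hL (sievePrimes q L)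
      (fun p hp => prime_of_mem_sievePrimes hp) fun p hp => ?_).trans
      (mul_le_mul_of_nonneg_left (prod_sievePrimes_le q hq L hL) hC.le))
    · rw [← Finset.sum_subset hUS]
      · refine Finset.sum_congr rfl fun D₁ _ => Finset.sum_subset hUS fun D₂ h h' => ?_
        rw [hz D₂ h h']; ring
      · intro D₁ h h'
        refine Finset.sum_eq_zero fun D₂ _ => ?_
        rw [hz D₁ h h']; ring
    · have h6 := Nat.lt_of_mem_primesBelow (Finset.mem_filter.1 hp).1
      have h7 : p ≤ ⌊Real.exp (2 * L)⌋₊ := by omega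
      rw [Real.log_le_iff_le_exp (by exact_mod_cast (prime_of_mem_sievePrimes hp).pos)]
      exact (Nat.le_floor_iff (Real.exp_pos _).le).1 h7
  have h6 : (U.card : ℝ) * U.card ≤ H / (q.totient * L) := by
    have h7 := card_sieveIndex_le q L
    have h8 : (U.card : ℝ) * U.card ≤ Real.exp (4 * L) := by
      calc (U.card : ℝ) * U.card ≤ Real.exp (2 * L) * Real.exp (2 * L) := by gcongr
        _ = _ := by rw [← Real.exp_add]; ring_nf
    refine h8.trans ?_
    rw [le_div_iff₀ (by positivity)]
    have h9 : (q.totient : ℝ) ≤ q := by exact_mod_cast Nat.totient_le q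
    calc Real.exp (4 * L) * (q.totient * L) ≤ Real.exp (4 * L) * (q * Real.exp L) := by
          gcongr
          linarith [Real.add_one_le_exp L]
      _ = q * Real.exp (5 * L) := by
          rw [show 5 * L = 4 * L + L by ring, Real.exp_add]; ring
      _ ≤ H := hH
  calc _ ≤ _ := h3
    _ = _ := h4
    _ ≤ C * (q / (q.totient * (2 * L))) * (H / q) + H / (q.totient * L) := by gcongr
    _ = (C / 2 + 1) * (H / (q.totient * L)) := by field_simp
    _ ≤ (C + 1) * (H / (q.totient * L)) := by gcongr; linarith

lemma ZMod.sum_range_natCast_add {N : ℕ} [NeZero N] (Φ : ZMod N → ℂ) (a : ℕ) :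
    ∑ k ∈ Finset.range N, Φ ((a + k : ℕ) : ZMod N) = ∑ j, Φ j := by
  rw [← Equiv.sum_comp (Equiv.addLeft (a : ZMod N))]
  refine Finset.sum_bij' (fun k _ => (k : ZMod N)) (fun j _ => j.val) ?_ ?_ ?_ ?_ ?_
  · simp
  · intro j _
    exact Finset.mem_range.2 (ZMod.val_lt j)
  · intro k hk
    exact ZMod.val_cast_of_lt (Finset.mem_range.1 hk)
  · intro j _
    exact ZMod.natCast_zmod_val j
  · intro k _
    simp

lemma ZMod.norm_sum_Icc_sub_le {N : ℕ} [NeZero N] (Φ : ZMod N → ℂ) {B : ℝ}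
    (hB : ∀ j, ‖Φ j‖ ≤ B) (n : ℕ) :
    ‖∑ k ∈ Finset.Icc 1 n, Φ (k : ZMod N) - (∑ j, Φ j) / N * n‖ ≤ 2 * B * N := by
  have hN : (0 : ℝ) < N := by exact_mod_cast NeZero.pos N
  have hN0 : (N : ℂ) ≠ 0 := by exact_mod_cast hN.ne'
  have hB0 : 0 ≤ B := (norm_nonneg _).trans (hB 0)
  have hm : ‖(∑ j, Φ j) / N‖ ≤ B := by
    rw [norm_div, Complex.norm_natCast, div_le_iff₀ hN]
    refine (norm_sum_le _ _).trans ((Finset.sum_le_sum fun j _ => hB j).trans ?_)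
    simp [ZMod.card, mul_comm]
  induction n using Nat.strong_induction_on with
  | _ n ih =>
    rcases lt_or_ge n N with h | h
    · have h1 : ‖∑ k ∈ Finset.Icc 1 n, Φ (k : ZMod N)‖ ≤ B * n := by
        refine (norm_sum_le _ _).trans ((Finset.sum_le_sum fun j _ => hB _).trans ?_)
        simp [mul_comm]
      have h2 : ‖(∑ j, Φ j) / N * n‖ ≤ B * n := by
        rw [norm_mul, Complex.norm_natCast]
        gcongr
      have h3 : (n : ℝ) ≤ N := by exact_mod_cast h.le
      calc _ ≤ B * n + B * n := (norm_sub_le _ _).trans (add_le_add h1 h2)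
        _ ≤ 2 * B * N := by nlinarith
    · obtain ⟨a, rfl⟩ := Nat.exists_eq_add_of_le' h
      have h1 : ∑ k ∈ Finset.Icc 1 (a + N), Φ (k : ZMod N)
          = ∑ k ∈ Finset.Icc 1 a, Φ (k : ZMod N) + ∑ j, Φ j := by
        rw [← ZMod.sum_range_natCast_add Φ (a + 1)]
        have e1 : Finset.Icc 1 (a + N) = Finset.Ico 1 (a + 1 + N) := by
          ext; simp only [Finset.mem_Icc, Finset.mem_Ico]; omega
        have e2 : Finset.Icc 1 a = Finset.Ico 1 (a + 1) := by
          ext; simp only [Finset.mem_Icc, Finset.mem_Ico]; omega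
        rw [e1, e2, ← Finset.sum_Ico_consecutive _ (Nat.le_add_left 1 a) (Nat.le_add_right _ N),
          Finset.sum_Ico_eq_sum_range _ (a + 1) (a + 1 + N)]
        simp
      have h2 := ih a (by have := NeZero.pos N; omega)
      convert h2 using 2
      rw [h1]
      push_cast
      field_simp
      ring

/-- The remainder in the summatory function of a periodic function. -/
noncomputable def zmodRemainder {N : ℕ} (Φ : ZMod N → ℂ) [NeZero N] (t : ℝ) : ℂ :=
  ∑ k ∈ Finset.Icc 1 ⌊t⌋₊, Φ (k : ZMod N) - (∑ j, Φ j) / N * t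

lemma norm_zmodRemainder_le {N : ℕ} [NeZero N] (Φ : ZMod N → ℂ) {B : ℝ}
    (hB : ∀ j, ‖Φ j‖ ≤ B) {t : ℝ} (ht : 0 ≤ t) : ‖zmodRemainder Φ t‖ ≤ 3 * B * N := by
  have hN : (1 : ℝ) ≤ N := by exact_mod_cast NeZero.pos N
  have hB0 : 0 ≤ B := (norm_nonneg _).trans (hB 0)
  have hm : ‖(∑ j, Φ j) / N‖ ≤ B := by
    rw [norm_div, Complex.norm_natCast, div_le_iff₀ (by linarith)]
    refine (norm_sum_le _ _).trans ((Finset.sum_le_sum fun j _ => hB j).trans ?_)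
    simp [ZMod.card, mul_comm]
  have h1 := ZMod.norm_sum_Icc_sub_le Φ hB ⌊t⌋₊
  have h2 : ‖(∑ j, Φ j) / N * ((⌊t⌋₊ : ℂ) - t)‖ ≤ B * 1 := by
    rw [norm_mul]
    gcongr
    have : ((⌊t⌋₊ : ℂ) - t) = (((⌊t⌋₊ : ℝ) - t : ℝ) : ℂ) := by push_cast; rfl
    rw [this, Complex.norm_real, Real.norm_eq_abs, abs_le]
    constructor <;> linarith [Nat.floor_le ht, Nat.lt_floor_add_one t]
  calc ‖zmodRemainder Φ t‖ = ‖(∑ k ∈ Finset.Icc 1 ⌊t⌋₊, Φ (k : ZMod N)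
        - (∑ j, Φ j) / N * (⌊t⌋₊ : ℕ)) + (∑ j, Φ j) / N * ((⌊t⌋₊ : ℂ) - t)‖ := by
        congr 1; rw [zmodRemainder]; ring
    _ ≤ 2 * B * N + B * 1 := (norm_add_le _ _).trans (add_le_add h1 h2)
    _ ≤ 3 * B * N := by nlinarith

lemma measurable_zmodRemainder {N : ℕ} [NeZero N] (Φ : ZMod N → ℂ) :
    Measurable (zmodRemainder Φ) := by
  unfold zmodRemainder
  refine Measurable.sub ?_ (by fun_prop)
  exact (measurable_from_nat (f := fun n : ℕ => ∑ k ∈ Finset.Icc 1 n, Φ (k : ZMod N))).comp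
    Nat.measurable_floor

lemma integrableOn_zmodRemainder_mul_cpow {N : ℕ} [NeZero N] (Φ : ZMod N → ℂ) {y : ℝ}
    (hy : 1 ≤ y) {s : ℂ} (hs : 0 < s.re) :
    MeasureTheory.IntegrableOn (fun t : ℝ => zmodRemainder Φ t * (t : ℂ) ^ (-(s + 1)))
      (Set.Ioi y) := by
  obtain ⟨B, hB⟩ : ∃ B, ∀ j, ‖Φ j‖ ≤ B :=
    ⟨∑ j, ‖Φ j‖, fun j => Finset.single_le_sum (f := fun j => ‖Φ j‖)
      (fun i _ => norm_nonneg _) (Finset.mem_univ j)⟩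
  refine MeasureTheory.Integrable.bdd_mul (c := 3 * B * N) ?_ ?_ ?_
  · exact integrableOn_Ioi_cpow_of_lt (by simp; linarith) (by linarith)
  · exact (measurable_zmodRemainder Φ).aestronglyMeasurable
  · filter_upwards [MeasureTheory.ae_restrict_mem measurableSet_Ioi] with t ht
    exact norm_zmodRemainder_le Φ hB (by linarith [Set.mem_Ioi.1 ht])

lemma norm_integral_zmodRemainder_le {N : ℕ} [NeZero N] (Φ : ZMod N → ℂ) {B : ℝ}
    (hB : ∀ j, ‖Φ j‖ ≤ B) {y : ℝ} (hy : 1 ≤ y) {s : ℂ} (hs : 0 < s.re) :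
    ‖∫ t in Set.Ioi y, zmodRemainder Φ t * (t : ℂ) ^ (-(s + 1))‖
      ≤ 3 * B * N * (y ^ (-s.re) / s.re) := by
  have h1 : ∫ t in Set.Ioi y, 3 * B * N * t ^ (-(s.re + 1)) = 3 * B * N * (y ^ (-s.re) / s.re) := by
    rw [MeasureTheory.integral_const_mul, integral_Ioi_rpow_of_lt (by linarith) (by linarith)]
    congr 1
    rw [show -(s.re + 1) + 1 = -s.re by ring, neg_div_neg_eq]
  rw [← h1]
  refine MeasureTheory.norm_integral_le_of_norm_le ?_ ?_
  · exact ((integrableOn_Ioi_rpow_of_lt (by linarith) (by linarith)).const_mul _)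
  · filter_upwards [MeasureTheory.ae_restrict_mem measurableSet_Ioi] with t ht
    have ht0 : 0 < t := by linarith [Set.mem_Ioi.1 ht]
    rw [norm_mul, Complex.norm_cpow_eq_rpow_re_of_pos ht0]
    simp only [Complex.neg_re, Complex.add_re, Complex.one_re]
    gcongr
    exact norm_zmodRemainder_le Φ hB ht0.le

lemma differentiableAt_integral_zmodRemainder {N : ℕ} [NeZero N] (Φ : ZMod N → ℂ) {y : ℝ}
    (hy : 1 ≤ y) {s : ℂ} (hs : 0 < s.re) :
    DifferentiableAt ℂ
      (fun s : ℂ => ∫ t in Set.Ioi y, zmodRemainder Φ t * (t : ℂ) ^ (-(s + 1))) s := by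
  obtain ⟨B, hB⟩ : ∃ B, ∀ j, ‖Φ j‖ ≤ B :=
    ⟨∑ j, ‖Φ j‖, fun j => Finset.single_le_sum (f := fun j => ‖Φ j‖)
      (fun i _ => norm_nonneg _) (Finset.mem_univ j)⟩
  set f : ℝ → ℂ := Set.indicator (Set.Ioi y) (zmodRemainder Φ) with hf
  have hfb : ∀ t, ‖f t‖ ≤ 3 * B * N := by
    intro t
    by_cases ht : t ∈ Set.Ioi y
    · rw [hf, Set.indicator_of_mem ht]
      exact norm_zmodRemainder_le Φ hB (by linarith [Set.mem_Ioi.1 ht])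
    · rw [hf, Set.indicator_of_notMem ht]
      have := norm_zmodRemainder_le Φ hB le_rfl
      simpa using (norm_nonneg _).trans this
  have hm : Measurable f := (measurable_zmodRemainder Φ).indicator measurableSet_Ioi
  have heq : (fun s : ℂ => ∫ t in Set.Ioi y, zmodRemainder Φ t * (t : ℂ) ^ (-(s + 1)))
      = fun s => mellin f (-s) := by
    funext s
    rw [mellin]
    have : ∀ t : ℝ, (t : ℂ) ^ (-s - 1) • f t = Set.indicator (Set.Ioi y)
        (fun t : ℝ => zmodRemainder Φ t * (t : ℂ) ^ (-(s + 1))) t := by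
      intro t
      by_cases ht : t ∈ Set.Ioi y
      · rw [hf, Set.indicator_of_mem ht, Set.indicator_of_mem ht, smul_eq_mul, mul_comm]
        congr 2; ring
      · rw [hf, Set.indicator_of_notMem ht, Set.indicator_of_notMem ht, smul_zero]
    simp_rw [this]
    rw [MeasureTheory.setIntegral_indicator measurableSet_Ioi,
      Set.inter_eq_self_of_subset_right (Set.Ioi_subset_Ioi (by linarith))]
  rw [heq]
  have key : DifferentiableAt ℂ (mellin f) (-s) := by
    refine mellin_differentiableAt_of_isBigO_rpow (a := 0) (b := -s.re - 1) ?_ ?_ ?_ ?_ ?_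
    · refine MeasureTheory.LocallyIntegrable.locallyIntegrableOn ?_ _
      refine (MeasureTheory.locallyIntegrable_const (3 * B * N)).mono
        hm.aestronglyMeasurable (Filter.Eventually.of_forall fun t => ?_)
      exact (hfb t).trans (le_abs_self _)
    · refine Asymptotics.IsBigO.of_bound (3 * B * N) (Filter.Eventually.of_forall fun t => ?_)
      simpa using hfb t
    · simpa using hs
    · refine Asymptotics.IsBigO.of_bound 1 ?_
      filter_upwards [Ioo_mem_nhdsGT (show (0 : ℝ) < 1 by norm_num)] with t ht
      rw [hf, Set.indicator_of_notMem]
      · simp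
      · simp only [Set.mem_Ioi, not_lt]; linarith [ht.2]
    · simp
  exact DifferentiableAt.comp (g := mellin f) s key differentiableAt_id.neg

/-- The entire function `(s - 1) L(Φ, s)`. -/
noncomputable def zmodEntire {N : ℕ} [NeZero N] (Φ : ZMod N → ℂ) : ℂ → ℂ :=
  Function.update (fun s => (s - 1) * ZMod.LFunction Φ s) 1 ((∑ j, Φ j) / N)

lemma zmodEntire_of_ne {N : ℕ} [NeZero N] (Φ : ZMod N → ℂ) {s : ℂ} (hs : s ≠ 1) :
    zmodEntire Φ s = (s - 1) * ZMod.LFunction Φ s := by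
  rw [zmodEntire, Function.update_of_ne hs]

lemma differentiable_zmodEntire {N : ℕ} [NeZero N] (Φ : ZMod N → ℂ) :
    Differentiable ℂ (zmodEntire Φ) := by
  rw [← differentiableOn_univ,
    ← Complex.differentiableOn_compl_singleton_and_continuousAt_iff (c := 1) Filter.univ_mem]
  constructor
  · intro s hs
    have hs1 : s ≠ 1 := by simpa using hs
    have h : DifferentiableAt ℂ (fun s => (s - 1) * ZMod.LFunction Φ s) s :=
      (by fun_prop : DifferentiableAt ℂ (fun s : ℂ => s - 1) s).mul
        (ZMod.differentiableAt_LFunction Φ s (Or.inl hs1))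
    refine (h.congr_of_eventuallyEq ?_).differentiableWithinAt
    filter_upwards [isOpen_ne.mem_nhds hs1] with z hz using zmodEntire_of_ne Φ hz
  · rw [zmodEntire, continuousAt_update_same, Finset.sum_div]
    exact ZMod.LFunction_residue_one Φ

lemma LSeries_zmod_eq {N : ℕ} [NeZero N] (Φ : ZMod N → ℂ) {y : ℝ} (hy : 1 ≤ y) {s : ℂ}
    (hs : 1 < s.re) :
    ZMod.LFunction Φ s = ∑ k ∈ Finset.Icc 1 ⌊y⌋₊, Φ (k : ZMod N) * (k : ℂ) ^ (-s)
      + s * (∫ t in Set.Ioi y, zmodRemainder Φ t * (t : ℂ) ^ (-(s + 1)))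
      - zmodRemainder Φ y * (y : ℂ) ^ (-s)
      + (∑ j, Φ j) / N * (y : ℂ) ^ (1 - s) / (s - 1) := by
  have hs0 : s ≠ 0 := by rintro rfl; simp at hs; linarith
  have hs1 : s - 1 ≠ 0 := by
    intro h; rw [sub_eq_zero.1 h] at hs; simp at hs
  have hy0 : (y : ℂ) ≠ 0 := by exact_mod_cast (by linarith : y ≠ 0)
  obtain ⟨B, hB⟩ : ∃ B, ∀ j, ‖Φ j‖ ≤ B :=
    ⟨∑ j, ‖Φ j‖, fun j => Finset.single_le_sum (f := fun j => ‖Φ j‖)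
      (fun i _ => norm_nonneg _) (Finset.mem_univ j)⟩
  have hB0 : 0 ≤ B := (norm_nonneg _).trans (hB 0)
  set m : ℂ := (∑ j, Φ j) / N with hm
  set f : ℕ → ℂ := fun k => Φ (k : ZMod N) with hf
  set h : ℕ → ℂ := fun k => if k ≤ ⌊y⌋₊ then f k else 0 with hh
  set g : ℕ → ℂ := fun k => if k ≤ ⌊y⌋₊ then 0 else f k with hg
  have hfs : LSeriesSummable f s := ZMod.LSeriesSummable_of_one_lt_re Φ hs
  have hterm : ∀ k ∉ Finset.Icc 1 ⌊y⌋₊, LSeries.term h s k = 0 := by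
    intro k hk
    rcases Nat.eq_zero_or_pos k with rfl | h0
    · simp
    · rw [LSeries.term_of_ne_zero h0.ne', hh]
      have : ¬ k ≤ ⌊y⌋₊ := fun h1 => hk (Finset.mem_Icc.2 ⟨h0, h1⟩)
      simp [this]
  have hhs : LSeriesSummable h s := summable_of_ne_finset_zero hterm
  have hhv : LSeries h s = ∑ k ∈ Finset.Icc 1 ⌊y⌋₊, Φ (k : ZMod N) * (k : ℂ) ^ (-s) := by
    rw [LSeries, tsum_eq_sum hterm]
    refine Finset.sum_congr rfl fun k hk => ?_
    have hk' := Finset.mem_Icc.1 hk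
    rw [LSeries.term_of_ne_zero (by omega), hh, Complex.cpow_neg, div_eq_mul_inv]
    simp [hk'.2, hf]
  have hgf : g = f - h := by
    funext k
    simp only [hg, hh, Pi.sub_apply]
    split_ifs <;> simp
  have hgv : LSeries g s = ZMod.LFunction Φ s - LSeries h s := by
    rw [ZMod.LFunction_eq_LSeries Φ hs, hgf, LSeries_sub hfs hhs]
  have hO : (fun n : ℕ ↦ ∑ k ∈ Finset.Icc 1 n, ‖g k‖) =O[Filter.atTop]
      fun n ↦ (n : ℝ) ^ (1 : ℝ) := by
    refine Asymptotics.IsBigO.of_bound B (Filter.Eventually.of_forall fun n => ?_)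
    rw [Real.norm_of_nonneg (Finset.sum_nonneg fun i _ => norm_nonneg _), Real.rpow_one,
      Real.norm_of_nonneg (Nat.cast_nonneg n)]
    have : ∀ k ∈ Finset.Icc 1 n, ‖g k‖ ≤ B := by
      intro k _
      simp only [hg]
      split_ifs
      · simpa using hB0
      · exact hB _
    refine (Finset.sum_le_sum this).trans ?_
    simp [mul_comm]
  have hInt := LSeries_eq_mul_integral' g zero_le_one hs hO
  have hA : ∀ t : ℝ, ∑ k ∈ Finset.Icc 1 ⌊t⌋₊, g k = Set.indicator (Set.Ioi y)
      (fun t : ℝ => zmodRemainder Φ t + m * t - (zmodRemainder Φ y + m * y)) t := by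
    intro t
    by_cases ht : t ∈ Set.Ioi y
    · rw [Set.indicator_of_mem ht]
      have hle : ⌊y⌋₊ ≤ ⌊t⌋₊ := Nat.floor_le_floor (le_of_lt ht)
      have e1 : ∑ k ∈ Finset.Icc 1 ⌊t⌋₊, h k = ∑ k ∈ Finset.Icc 1 ⌊y⌋₊, f k := by
        rw [hh, ← Finset.sum_filter]
        refine Finset.sum_congr ?_ fun _ _ => rfl
        ext k; simp; omega
      rw [hgf]
      simp only [Pi.sub_apply, Finset.sum_sub_distrib, e1, zmodRemainder, hf, hm]
      ring
    · rw [Set.indicator_of_notMem ht]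
      refine Finset.sum_eq_zero fun k hk => ?_
      have : k ≤ ⌊y⌋₊ := (Finset.mem_Icc.1 hk).2.trans (Nat.floor_le_floor (not_lt.1 ht))
      simp [hg, this]
  have hI : ∫ t in Set.Ioi (1 : ℝ), (∑ k ∈ Finset.Icc 1 ⌊t⌋₊, g k) * (t : ℂ) ^ (-(s + 1))
      = (∫ t in Set.Ioi y, zmodRemainder Φ t * (t : ℂ) ^ (-(s + 1)))
        + m * ((y : ℂ) ^ (1 - s) / (s - 1))
        - (zmodRemainder Φ y + m * y) * ((y : ℂ) ^ (-s) / s) := by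
    have e0 : ∀ t : ℝ, (∑ k ∈ Finset.Icc 1 ⌊t⌋₊, g k) * (t : ℂ) ^ (-(s + 1))
        = Set.indicator (Set.Ioi y) (fun t : ℝ =>
          (zmodRemainder Φ t + m * t - (zmodRemainder Φ y + m * y)) * (t : ℂ) ^ (-(s + 1))) t := by
      intro t
      rw [hA, Set.indicator_mul_left]
    simp_rw [e0]
    rw [MeasureTheory.setIntegral_indicator measurableSet_Ioi,
      Set.inter_eq_self_of_subset_right (Set.Ioi_subset_Ioi hy)]
    have e1 : ∀ t ∈ Set.Ioi y,
        (zmodRemainder Φ t + m * t - (zmodRemainder Φ y + m * y)) * (t : ℂ) ^ (-(s + 1))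
        = zmodRemainder Φ t * (t : ℂ) ^ (-(s + 1)) + m * (t : ℂ) ^ (-s)
          - (zmodRemainder Φ y + m * y) * (t : ℂ) ^ (-(s + 1)) := by
      intro t ht
      have ht0 : (t : ℂ) ≠ 0 := by
        exact_mod_cast (by linarith [Set.mem_Ioi.1 ht] : t ≠ 0)
      have : (t : ℂ) ^ (-s) = t * (t : ℂ) ^ (-(s + 1)) := by
        rw [show -s = 1 + -(s + 1) by ring, Complex.cpow_add _ _ ht0, Complex.cpow_one]
      rw [this]; ring
    rw [MeasureTheory.setIntegral_congr_fun measurableSet_Ioi e1]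
    have i1 := integrableOn_zmodRemainder_mul_cpow Φ hy (s := s) (by linarith)
    have i2 : MeasureTheory.IntegrableOn (fun t : ℝ => (t : ℂ) ^ (-s)) (Set.Ioi y) :=
      integrableOn_Ioi_cpow_of_lt (by simpa using hs) (by linarith)
    have i3 : MeasureTheory.IntegrableOn (fun t : ℝ => (t : ℂ) ^ (-(s + 1))) (Set.Ioi y) :=
      integrableOn_Ioi_cpow_of_lt (by simp; linarith) (by linarith)
    have i12 : MeasureTheory.IntegrableOn (fun t : ℝ => zmodRemainder Φ t * (t : ℂ) ^ (-(s + 1))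
        + m * (t : ℂ) ^ (-s)) (Set.Ioi y) := i1.add (i2.const_mul _)
    rw [MeasureTheory.integral_sub i12 (i3.const_mul _),
      MeasureTheory.integral_add i1 (i2.const_mul _), MeasureTheory.integral_const_mul,
      MeasureTheory.integral_const_mul, integral_Ioi_cpow_of_lt (by simpa using hs) (by linarith),
      integral_Ioi_cpow_of_lt (by simp; linarith) (by linarith)]
    rw [show -s + 1 = 1 - s by ring, show -(s + 1) + 1 = -s by ring, neg_div_neg_eq]
    congr 3
    rw [← neg_sub s 1, neg_div_neg_eq]
  have hcp : (y : ℂ) ^ (1 - s) = y * (y : ℂ) ^ (-s) := by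
    rw [sub_eq_add_neg, Complex.cpow_add _ _ hy0, Complex.cpow_one]
  have hfin : ZMod.LFunction Φ s = LSeries h s + LSeries g s := by rw [hgv]; ring
  rw [hfin, hhv, hInt, hI, hcp]
  field_simp
  ring

lemma zmodEntire_eq {N : ℕ} [NeZero N] (Φ : ZMod N → ℂ) {y : ℝ} (hy : 1 ≤ y) {s : ℂ}
    (hs : 0 < s.re) :
    zmodEntire Φ s = (s - 1) * (∑ k ∈ Finset.Icc 1 ⌊y⌋₊, Φ (k : ZMod N) * (k : ℂ) ^ (-s)
      + s * (∫ t in Set.Ioi y, zmodRemainder Φ t * (t : ℂ) ^ (-(s + 1)))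
      - zmodRemainder Φ y * (y : ℂ) ^ (-s))
      + (∑ j, Φ j) / N * (y : ℂ) ^ (1 - s) := by
  have hy0 : (y : ℂ) ≠ 0 := by exact_mod_cast (by linarith : y ≠ 0)
  have hopen : IsOpen {s : ℂ | 0 < s.re} := isOpen_lt continuous_const Complex.continuous_re
  have h1 : AnalyticOnNhd ℂ (zmodEntire Φ) {s : ℂ | 0 < s.re} :=
    (differentiable_zmodEntire Φ).differentiableOn.analyticOnNhd hopen
  have h2 : AnalyticOnNhd ℂ (fun s : ℂ => (s - 1) * (∑ k ∈ Finset.Icc 1 ⌊y⌋₊,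
      Φ (k : ZMod N) * (k : ℂ) ^ (-s)
      + s * (∫ t in Set.Ioi y, zmodRemainder Φ t * (t : ℂ) ^ (-(s + 1)))
      - zmodRemainder Φ y * (y : ℂ) ^ (-s))
      + (∑ j, Φ j) / N * (y : ℂ) ^ (1 - s)) {s : ℂ | 0 < s.re} := by
    refine DifferentiableOn.analyticOnNhd (fun z hz => ?_) hopen
    refine DifferentiableAt.differentiableWithinAt ?_
    have i0 := differentiableAt_integral_zmodRemainder Φ hy (s := z) hz
    have i1 : ∀ (w : ℂ), w ≠ 0 → DifferentiableAt ℂ (fun s : ℂ => w ^ (-s)) z := fun w hw =>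
      DifferentiableAt.const_cpow (by fun_prop) (Or.inl hw)
    have i2 : DifferentiableAt ℂ (fun s : ℂ => (y : ℂ) ^ (1 - s)) z :=
      DifferentiableAt.const_cpow (by fun_prop) (Or.inl hy0)
    have i3 : DifferentiableAt ℂ (fun s : ℂ => ∑ k ∈ Finset.Icc 1 ⌊y⌋₊,
        Φ (k : ZMod N) * (k : ℂ) ^ (-s)) z := by
      refine DifferentiableAt.fun_sum fun k hk => ?_
      have : k ≠ 0 := by have := (Finset.mem_Icc.1 hk).1; omega
      exact (i1 k (by exact_mod_cast this)).const_mul _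
    have i4 := i1 y hy0
    fun_prop
  refine h1.eqOn_of_preconnected_of_eventuallyEq h2
    (convex_halfSpace_re_gt 0).isPreconnected (z₀ := 2) (by simp) ?_ hs
  have : {s : ℂ | 1 < s.re} ∈ nhds (2 : ℂ) :=
    (isOpen_lt continuous_const Complex.continuous_re).mem_nhds (by simp)
  filter_upwards [this] with z hz
  have hz1 : z ≠ 1 := by rintro rfl; simp at hz
  rw [zmodEntire_of_ne Φ hz1, LSeries_zmod_eq Φ hy hz]
  field_simp [sub_ne_zero.2 hz1]

/-- Partial sums of `L(Φ, s)`. -/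
lemma norm_partialSum_sub_LFunction_le {N : ℕ} [NeZero N] (Φ : ZMod N → ℂ) {B : ℝ}
    (hB : ∀ j, ‖Φ j‖ ≤ B) {y : ℝ} (hy : 1 ≤ y) {s : ℂ} (hs : 0 < s.re) (hs1 : s ≠ 1) :
    ‖∑ k ∈ Finset.Icc 1 ⌊y⌋₊, Φ (k : ZMod N) * (k : ℂ) ^ (-s)
      - (∑ j, Φ j) / N * (y : ℂ) ^ (1 - s) / (1 - s) - ZMod.LFunction Φ s‖
      ≤ 3 * B * N * (1 + ‖s‖ / s.re) * y ^ (-s.re) := by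
  have hs1' : s - 1 ≠ 0 := sub_ne_zero.2 hs1
  have h := zmodEntire_eq Φ hy hs
  rw [zmodEntire_of_ne Φ hs1] at h
  have h2 : ZMod.LFunction Φ s = ∑ k ∈ Finset.Icc 1 ⌊y⌋₊, Φ (k : ZMod N) * (k : ℂ) ^ (-s)
      + s * (∫ t in Set.Ioi y, zmodRemainder Φ t * (t : ℂ) ^ (-(s + 1)))
      - zmodRemainder Φ y * (y : ℂ) ^ (-s)
      + (∑ j, Φ j) / N * (y : ℂ) ^ (1 - s) / (s - 1) := by
    have := congrArg (fun w => w / (s - 1)) h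
    simp only [mul_div_cancel_left₀ _ hs1', add_div] at this
    exact this
  have h3 : (∑ j, Φ j) / N * (y : ℂ) ^ (1 - s) / (1 - s)
      = - ((∑ j, Φ j) / N * (y : ℂ) ^ (1 - s) / (s - 1)) := by
    rw [← neg_sub s 1, div_neg]
  have h4 : ∑ k ∈ Finset.Icc 1 ⌊y⌋₊, Φ (k : ZMod N) * (k : ℂ) ^ (-s)
      - (∑ j, Φ j) / N * (y : ℂ) ^ (1 - s) / (1 - s) - ZMod.LFunction Φ s
      = zmodRemainder Φ y * (y : ℂ) ^ (-s)
        - s * (∫ t in Set.Ioi y, zmodRemainder Φ t * (t : ℂ) ^ (-(s + 1))) := by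
    rw [h2, h3]; ring
  rw [h4]
  have h5 : ‖zmodRemainder Φ y * (y : ℂ) ^ (-s)‖ ≤ 3 * B * N * y ^ (-s.re) := by
    rw [norm_mul, Complex.norm_cpow_eq_rpow_re_of_pos (by linarith), Complex.neg_re]
    gcongr
    exact norm_zmodRemainder_le Φ hB (by linarith)
  have h6 := norm_integral_zmodRemainder_le Φ hB hy hs
  refine (norm_sub_le _ _).trans ?_
  rw [norm_mul s]
  calc _ ≤ 3 * B * N * y ^ (-s.re) + ‖s‖ * (3 * B * N * (y ^ (-s.re) / s.re)) := by gcongr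
    _ = _ := by ring

/-- Polynomial bound for `(s - 1) L(Φ, s)` in the right half plane. -/
lemma norm_zmodEntire_le {N : ℕ} [NeZero N] (Φ : ZMod N → ℂ) {B : ℝ}
    (hB : ∀ j, ‖Φ j‖ ≤ B) {s : ℂ} (hs : 1 / 2 ≤ s.re) :
    ‖zmodEntire Φ s‖ ≤ 12 * B * N * (‖s‖ + 1) ^ 2 := by
  have hs0 : 0 < s.re := by linarith
  have hB0 : 0 ≤ B := (norm_nonneg _).trans (hB 0)
  have hN : (1 : ℝ) ≤ N := by exact_mod_cast NeZero.pos N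
  rw [zmodEntire_eq Φ le_rfl hs0]
  have h6 := norm_integral_zmodRemainder_le Φ hB le_rfl hs0
  have h5 := norm_zmodRemainder_le Φ hB zero_le_one
  have hm : ‖(∑ j, Φ j) / N‖ ≤ B := by
    rw [norm_div, Complex.norm_natCast, div_le_iff₀ (by linarith)]
    refine (norm_sum_le _ _).trans ((Finset.sum_le_sum fun j _ => hB j).trans ?_)
    simp [ZMod.card, mul_comm]
  have h7 : ‖∑ k ∈ Finset.Icc 1 ⌊(1 : ℝ)⌋₊, Φ (k : ZMod N) * (k : ℂ) ^ (-s)‖ ≤ B := by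
    simpa using hB 1
  have h8 : ‖s‖ * (3 * B * N * ((1 : ℝ) ^ (-s.re) / s.re)) ≤ ‖s‖ * (3 * B * N * 2) := by
    rw [Real.one_rpow]
    gcongr
    rw [div_le_iff₀ hs0]; linarith
  have h9 : ‖s - 1‖ ≤ ‖s‖ + 1 := (norm_sub_le _ _).trans (by simp)
  calc _ ≤ ‖s - 1‖ * (B + ‖s‖ * (3 * B * N * ((1 : ℝ) ^ (-s.re) / s.re)) + 3 * B * N) + B := by
        refine (norm_add_le _ _).trans (add_le_add ?_ (by simpa using hm))
        rw [norm_mul]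
        gcongr
        refine (norm_sub_le _ _).trans (add_le_add ((norm_add_le _ _).trans (add_le_add h7 ?_)) ?_)
        · rw [norm_mul]; gcongr
        · simpa using h5
    _ ≤ (‖s‖ + 1) * (B + ‖s‖ * (3 * B * N * 2) + 3 * B * N) + B := by gcongr
    _ ≤ 12 * B * N * (‖s‖ + 1) ^ 2 := by
        have h0 := norm_nonneg s
        have hBN : B ≤ B * N := le_mul_of_one_le_right hB0 hN
        nlinarith [mul_nonneg hB0 h0, mul_nonneg (mul_nonneg hB0 (by linarith : (0:ℝ) ≤ N)) h0, mul_nonneg (mul_nonneg (mul_nonneg hB0 (by linarith : (0:ℝ) ≤ N)) h0) h0,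
          mul_le_mul_of_nonneg_right hBN h0]

lemma exists_differentiable_eq_prod_mul (M : Multiset ℂ) : ∀ f : ℂ → ℂ, Differentiable ℂ f →
    (∀ ρ, (M.count ρ : ℕ∞) ≤ analyticOrderAt f ρ) →
    ∃ g : ℂ → ℂ, Differentiable ℂ g ∧ ∀ z, f z = (M.map fun ρ => z - ρ).prod * g z := by
  induction M using Multiset.induction_on with
  | empty => exact fun f hf _ => ⟨f, hf, fun z => by simp⟩
  | cons a M ih =>
    intro f hf hM
    have h0 : f a = 0 := by
      refine apply_eq_zero_of_analyticOrderAt_ne_zero (𝕜 := ℂ) fun h => ?_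
      have := hM a
      rw [h] at this
      simp at this
    set g := dslope f a with hg
    have hgd : Differentiable ℂ g := by
      rw [← differentiableOn_univ, hg, Complex.differentiableOn_dslope Filter.univ_mem]
      exact hf.differentiableOn
    have hfg : f = (fun z => z - a) * g := by
      funext z
      have := sub_smul_dslope f a z
      rw [smul_eq_mul, h0, sub_zero] at this
      exact this.symm
    have hcount : ∀ ρ, (M.count ρ : ℕ∞) ≤ analyticOrderAt g ρ := by
      intro ρ
      have h1 := hM ρ
      have han : AnalyticAt ℂ (fun z => z - a) ρ := by fun_prop
      rw [hfg, analyticOrderAt_mul han (hgd.analyticAt ρ)] at h1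
      by_cases hρ : ρ = a
      · subst hρ
        rw [analyticOrderAt_id_sub_const_self, Multiset.count_cons_self] at h1
        push_cast at h1
        rw [add_comm] at h1
        exact (ENat.add_le_add_iff_left (by simp)).1 h1
      · rw [analyticOrderAt_id_sub_const_of_ne hρ, Multiset.count_cons_of_ne hρ, zero_add] at h1
        exact h1
    obtain ⟨k, hk, hkz⟩ := ih g hgd hcount
    refine ⟨k, hk, fun z => ?_⟩
    rw [hfg, Pi.mul_apply, hkz z, Multiset.map_cons, Multiset.prod_cons, mul_assoc]

lemma norm_multiset_prod_sub_le (M : Multiset ℂ) {c : ℂ} {R : ℝ} (hR : ∀ ρ ∈ M, ‖c - ρ‖ ≤ R) :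
    ‖(M.map fun ρ => c - ρ).prod‖ ≤ R ^ M.card := by
  induction M using Multiset.induction_on with
  | empty => simp
  | cons a M ih =>
    rw [Multiset.map_cons, Multiset.prod_cons, norm_mul, Multiset.card_cons, pow_succ, mul_comm]
    have h1 := hR a (Multiset.mem_cons_self a M)
    have h2 := ih fun ρ hρ => hR ρ (Multiset.mem_cons_of_mem hρ)
    have := norm_nonneg (c - a)
    exact mul_le_mul h2 h1 (norm_nonneg _) ((norm_nonneg _).trans h2)

lemma le_norm_multiset_prod_sub (M : Multiset ℂ) {c : ℂ} {R : ℝ} (h0 : 0 ≤ R)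
    (hR : ∀ ρ ∈ M, R ≤ ‖c - ρ‖) :
    R ^ M.card ≤ ‖(M.map fun ρ => c - ρ).prod‖ := by
  induction M using Multiset.induction_on with
  | empty => simp
  | cons a M ih =>
    rw [Multiset.map_cons, Multiset.prod_cons, norm_mul, Multiset.card_cons, pow_succ,
      mul_comm ‖c - a‖]
    have h1 := hR a (Multiset.mem_cons_self a M)
    have h2 := ih fun ρ hρ => hR ρ (Multiset.mem_cons_of_mem hρ)
    exact mul_le_mul h2 h1 h0 (norm_nonneg _)

/-- A crude form of Jensen's inequality. -/
lemma two_pow_card_mul_norm_le {f : ℂ → ℂ} (hf : Differentiable ℂ f) {M : Multiset ℂ}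
    (hM : ∀ ρ, (M.count ρ : ℕ∞) ≤ analyticOrderAt f ρ) {c : ℂ} {R K : ℝ} (hR : 0 < R)
    (hMR : ∀ ρ ∈ M, ‖c - ρ‖ ≤ R) (hK : ∀ z, ‖z - c‖ = 3 * R → ‖f z‖ ≤ K) :
    2 ^ M.card * ‖f c‖ ≤ K := by
  obtain ⟨g, hg, hfg⟩ := exists_differentiable_eq_prod_mul M f hf hM
  have hgc : ‖g c‖ ≤ K / (2 * R) ^ M.card := by
    refine Complex.norm_le_of_forall_mem_frontier_norm_le (U := Metric.ball c (3 * R))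
      Metric.isBounded_ball hg.diffContOnCl ?_ (subset_closure (Metric.mem_ball_self (by linarith)))
    intro z hz
    rw [frontier_ball _ (by linarith), mem_sphere_iff_norm] at hz
    rw [le_div_iff₀ (by positivity)]
    refine le_trans ?_ (hK z hz)
    rw [hfg z, norm_mul, mul_comm]
    gcongr
    refine le_norm_multiset_prod_sub M (by linarith) fun ρ hρ => ?_
    have h1 := norm_sub_norm_le (z - c) (ρ - c)
    rw [sub_sub_sub_cancel_right, hz, norm_sub_rev ρ c] at h1
    linarith [hMR ρ hρ]
  have h1 := norm_multiset_prod_sub_le M hMR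
  calc 2 ^ M.card * ‖f c‖ ≤ 2 ^ M.card * (R ^ M.card * (K / (2 * R) ^ M.card)) := by
        rw [hfg c, norm_mul]; gcongr
    _ = K := by rw [mul_pow]; field_simp

lemma norm_log_one_sub_sub_le {z w : ℂ} (hz : ‖z‖ ≤ 1 / 2) (hw : ‖w‖ ≤ 1 / 2) :
    ‖Complex.log (1 - z) - Complex.log (1 - w)‖ ≤ 2 * ‖z - w‖ := by
  have hslit : ∀ x ∈ Metric.closedBall (0 : ℂ) (1 / 2), 1 - x ∈ Complex.slitPlane := by
    intro x hx
    have hx' : ‖x‖ ≤ 1 / 2 := by simpa using hx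
    refine Or.inl ?_
    have := Complex.re_le_norm x
    simp; linarith
  refine (convex_closedBall (0 : ℂ) (1 / 2)).norm_image_sub_le_of_norm_hasDerivWithin_le
    (f := fun x => Complex.log (1 - x)) (f' := fun x => -1 / (1 - x)) (C := 2)
    (fun x hx => ?_) (fun x hx => ?_) (by simpa using hw) (by simpa using hz)
  · exact (((hasDerivAt_id x).const_sub 1).clog (hslit x hx)).hasDerivWithinAt
  · have hx' : ‖x‖ ≤ 1 / 2 := by simpa using hx
    have h1 : 1 / 2 ≤ ‖1 - x‖ := by
      have := norm_sub_norm_le (1 : ℂ) x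
      rw [norm_one] at this; linarith
    rw [norm_div, norm_neg, norm_one, div_le_iff₀ (by linarith)]
    linarith

lemma norm_natCast_cpow_sub_le {p : ℕ} (hp : 1 ≤ p) {r : ℝ} {s w : ℂ} (hs : 1 + r ≤ s.re)
    (hw : 1 + r ≤ w.re) :
    ‖(p : ℂ) ^ (-s) - (p : ℂ) ^ (-w)‖
      ≤ 2 * √(‖s - w‖) * (√(Real.log p) * (p : ℝ) ^ (-r) / p) := by
  wlog h : w.re ≤ s.re generalizing s w
  · rw [norm_sub_rev, norm_sub_rev s]
    exact this hw hs (le_of_not_ge h)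
  have hp0 : (0 : ℝ) < p := by exact_mod_cast hp
  have hpc : (p : ℂ) ≠ 0 := by exact_mod_cast hp0.ne'
  have hl : 0 ≤ Real.log p := Real.log_natCast_nonneg p
  have e1 : (p : ℂ) ^ (-s) = (p : ℂ) ^ (-w) * Complex.exp (-(Real.log p * (s - w))) := by
    rw [Complex.natCast_log, Complex.cpow_def_of_ne_zero hpc, Complex.cpow_def_of_ne_zero hpc,
      ← Complex.exp_add]
    congr 1; ring
  have e2 : (p : ℂ) ^ (-s) - (p : ℂ) ^ (-w)
      = -((p : ℂ) ^ (-w) * (1 - Complex.exp (-(Real.log p * (s - w))))) := by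
    rw [e1]; ring
  have h3 := norm_one_sub_exp_neg_le (w := Real.log p * (s - w)) (by
    rw [Complex.re_ofReal_mul]; exact mul_nonneg hl (by simpa using h))
  have h4 : ‖(1 : ℂ) - Complex.exp (-(Real.log p * (s - w)))‖
      ≤ 2 * √(‖s - w‖) * √(Real.log p) := by
    refine h3.trans ?_
    rw [norm_mul, Complex.norm_real, Real.norm_of_nonneg hl, mul_assoc,
      ← Real.sqrt_mul (norm_nonneg _), mul_comm ‖s - w‖]
    set x := Real.log p * ‖s - w‖ with hx
    have hx0 : 0 ≤ x := mul_nonneg hl (norm_nonneg _)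
    have hsq := Real.sq_sqrt hx0
    have hs0 := Real.sqrt_nonneg x
    rcases le_total (√x) 1 with h | h
    · exact (min_le_right _ _).trans (by nlinarith)
    · exact (min_le_left _ _).trans (by linarith)
  rw [e2, norm_neg, norm_mul, Complex.norm_natCast_cpow_of_pos hp, Complex.neg_re]
  have h5 : (p : ℝ) ^ (-w.re) ≤ (p : ℝ) ^ (-r) / p := by
    rw [← Real.rpow_sub_one hp0.ne']
    exact Real.rpow_le_rpow_of_exponent_le (by exact_mod_cast hp) (by linarith)
  calc _ ≤ (p : ℝ) ^ (-r) / p * (2 * √(‖s - w‖) * √(Real.log p)) := by gcongr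
    _ = _ := by ring

/-- Comparison of the values of `L(s, χ)` at two points to the right of the line `Re s = 1`. -/
lemma norm_LFunction_le_exp_mul {q : ℕ} [NeZero q] (χ : DirichletCharacter ℂ q) {r : ℝ}
    (hr : 0 < r) {s w : ℂ} (hs : 1 + r ≤ s.re) (hw : 1 + r ≤ w.re) :
    ‖χ.LFunction s‖ ≤ Real.exp (256 * √(‖s - w‖ / r)) * ‖χ.LFunction w‖ := by
  have hs1 : 1 < s.re := by linarith
  have hw1 : 1 < w.re := by linarith
  have Hs := DirichletCharacter.summable_neg_log_one_sub_mul_prime_cpow χ hs1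
  have Hw := DirichletCharacter.summable_neg_log_one_sub_mul_prime_cpow χ hw1
  have hsm : ∀ (p : Nat.Primes) (z : ℂ), 1 < z.re → ‖χ p * (p : ℂ) ^ (-z)‖ ≤ 1 / 2 := by
    intro p z hz
    have hp2 : (2 : ℝ) ≤ (p : ℕ) := by exact_mod_cast p.2.two_le
    rw [norm_mul, Complex.norm_natCast_cpow_of_pos p.2.pos, Complex.neg_re]
    have h1 : ((p : ℕ) : ℝ) ^ (-z.re) ≤ ((p : ℕ) : ℝ) ^ (-1 : ℝ) :=
      Real.rpow_le_rpow_of_exponent_le (by linarith) (by linarith)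
    rw [Real.rpow_neg_one] at h1
    have h2 : (((p : ℕ) : ℝ))⁻¹ ≤ 1 / 2 := by
      rw [one_div]; exact inv_anti₀ (by norm_num) hp2
    have h3 := χ.norm_le_one ((p : ℕ) : ZMod q)
    have h4 : 0 ≤ ((p : ℕ) : ℝ) ^ (-z.re) := by positivity
    nlinarith [norm_nonneg (χ ((p : ℕ) : ZMod q))]
  have hterm : ∀ p : Nat.Primes, ‖-Complex.log (1 - χ p * (p : ℂ) ^ (-s))
      - -Complex.log (1 - χ p * (p : ℂ) ^ (-w))‖
      ≤ 4 * √(‖s - w‖) * (√(Real.log (p : ℕ)) * ((p : ℕ) : ℝ) ^ (-r) / (p : ℕ)) := by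
    intro p
    have h1 := norm_log_one_sub_sub_le (hsm p s hs1) (hsm p w hw1)
    have h2 := norm_natCast_cpow_sub_le p.2.one_lt.le hs hw
    rw [← mul_sub, norm_mul] at h1
    have h3 := χ.norm_le_one ((p : ℕ) : ZMod q)
    rw [← neg_add', norm_neg, ← sub_eq_add_neg]
    refine h1.trans ?_
    have h5 := norm_nonneg (((p : ℕ) : ℂ) ^ (-s) - ((p : ℕ) : ℂ) ^ (-w))
    nlinarith [norm_nonneg (χ ((p : ℕ) : ZMod q))]
  have hfin : ∀ u : Finset Nat.Primes, ∑ p ∈ u, ‖-Complex.log (1 - χ p * (p : ℂ) ^ (-s))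
      - -Complex.log (1 - χ p * (p : ℂ) ^ (-w))‖ ≤ 256 * √(‖s - w‖ / r) := by
    intro u
    refine (Finset.sum_le_sum fun p _ => hterm p).trans ?_
    rw [← Finset.mul_sum]
    have h6 := sum_prime_sqrt_log_rpow_le (u.image fun p : Nat.Primes => (p : ℕ))
      (by intro p hp; obtain ⟨x, _, rfl⟩ := Finset.mem_image.1 hp; exact x.2) r hr
    rw [Finset.sum_image (g := fun p : Nat.Primes => (p : ℕ))
      fun _ _ _ _ h => Nat.Primes.coe_nat_injective h] at h6
    calc _ ≤ 4 * √(‖s - w‖) * (64 / √r) := by gcongr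
      _ = 256 * √(‖s - w‖ / r) := by rw [Real.sqrt_div (norm_nonneg _)]; ring
  have hdiff : ‖(∑' p : Nat.Primes, -Complex.log (1 - χ p * (p : ℂ) ^ (-s)))
      - ∑' p : Nat.Primes, -Complex.log (1 - χ p * (p : ℂ) ^ (-w))‖ ≤ 256 * √(‖s - w‖ / r) := by
    rw [← Hs.tsum_sub Hw]
    have hsum := summable_of_sum_le (fun _ => norm_nonneg _) hfin
    exact (norm_tsum_le_tsum_norm hsum).trans (hsum.tsum_le_of_sum_le hfin)
  rw [χ.LFunction_eq_LSeries hs1, χ.LFunction_eq_LSeries hw1,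
    ← DirichletCharacter.LSeries_eulerProduct_exp_log χ hs1,
    ← DirichletCharacter.LSeries_eulerProduct_exp_log χ hw1, Complex.norm_exp, Complex.norm_exp,
    ← Real.exp_add, Real.exp_le_exp]
  have := (Complex.re_le_norm _).trans hdiff
  rw [Complex.sub_re] at this
  linarith

/-- `L(s, χ)`, multiplied by `s - 1` if `χ` is principal. -/
noncomputable def charEntire {q : ℕ} [NeZero q] (χ : DirichletCharacter ℂ q) : ℂ → ℂ :=
  if χ = 1 then zmodEntire χ else χ.LFunction

lemma differentiable_charEntire {q : ℕ} [NeZero q] (χ : DirichletCharacter ℂ q) :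
    Differentiable ℂ (charEntire χ) := by
  rw [charEntire]
  split_ifs with h
  · exact differentiable_zmodEntire _
  · exact DirichletCharacter.differentiable_LFunction h

lemma sum_principal_char_div {q : ℕ} [NeZero q] :
    (∑ j, (1 : DirichletCharacter ℂ q) j) / q = (q.totient : ℂ) / q := by
  rw [MulChar.sum_one_eq_card_units, ZMod.card_units_eq_totient]

lemma zeroMult_le_analyticOrderAt {q : ℕ} [NeZero q] (χ : DirichletCharacter ℂ q) (ρ : ℂ) :
    (zeroMult χ.LFunction ρ : ℕ∞) ≤ analyticOrderAt (charEntire χ) ρ := by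
  rw [zeroMult, charEntire]
  split_ifs with h1 h2 h2
  · subst h2
    refine (ENat.natCast_toNat_le_self _).trans ?_
    by_cases hρ : ρ = 1
    · subst hρ
      exfalso
      have ht := ZMod.LFunction_residue_one (N := q) (1 : DirichletCharacter ℂ q)
      rw [← Finset.sum_div, sum_principal_char_div] at ht
      have hc : Filter.Tendsto (fun s => (s - 1) * ZMod.LFunction (1 : DirichletCharacter ℂ q) s)
          (nhdsWithin 1 {1}ᶜ) (nhds ((1 - 1) * ZMod.LFunction (1 : DirichletCharacter ℂ q) 1)) := by
        have h3 : ContinuousAt (fun s : ℂ => s - 1) 1 := by fun_prop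
        exact (h3.mul h1.continuousAt).tendsto.mono_left nhdsWithin_le_nhds
      have := tendsto_nhds_unique ht hc
      rw [sub_self, zero_mul, div_eq_zero_iff] at this
      have hq := NeZero.pos q
      have ht := Nat.totient_pos.2 hq
      rcases this with h | h
      · exact ht.ne' (by exact_mod_cast h)
      · exact hq.ne' (by exact_mod_cast h)
    · have heq : zmodEntire (1 : DirichletCharacter ℂ q) =ᶠ[nhds ρ]
          (fun s => s - 1) * (1 : DirichletCharacter ℂ q).LFunction := by
        filter_upwards [isOpen_ne.mem_nhds hρ] with z hz using zmodEntire_of_ne _ hz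
      rw [analyticOrderAt_congr heq, analyticOrderAt_mul (by fun_prop) h1]
      exact le_add_self
  · exact ENat.natCast_toNat_le_self _
  · simp
  · simp

/-- Zeros with multiplicity are controlled by divisor multisets. -/
lemma count_sum_replicate_le {q : ℕ} [NeZero q] (χ : DirichletCharacter ℂ q) (S : Finset ℂ)
    (ρ : ℂ) : ((∑ z ∈ S, Multiset.replicate (zeroMult χ.LFunction z) z).count ρ : ℕ∞)
      ≤ analyticOrderAt (charEntire χ) ρ := by
  refine le_trans ?_ (zeroMult_le_analyticOrderAt χ ρ)
  rw [Multiset.count_sum']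
  simp only [Multiset.count_replicate, Finset.sum_ite_eq']
  split_ifs <;> simp

/-- A crude form of Jensen's inequality for Dirichlet `L`-functions. -/
lemma two_pow_sum_zeroMult_le {q : ℕ} [NeZero q] (χ : DirichletCharacter ℂ q) (S : Finset ℂ)
    {c : ℂ} {R K : ℝ} (hR : 0 < R) (hS : ∀ ρ ∈ S, ‖c - ρ‖ ≤ R)
    (hK : ∀ z, ‖z - c‖ = 3 * R → ‖charEntire χ z‖ ≤ K) :
    2 ^ (∑ ρ ∈ S, zeroMult χ.LFunction ρ) * ‖charEntire χ c‖ ≤ K := by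
  have h := two_pow_card_mul_norm_le (differentiable_charEntire χ) (count_sum_replicate_le χ S) hR
    (c := c) (K := K) ?_ hK
  · simpa using h
  · intro ρ hρ
    obtain ⟨z, hz, hz2⟩ := Multiset.mem_sum.1 hρ
    rw [Multiset.eq_of_mem_replicate hz2]
    exact hS z hz

lemma sq_re_cpow_half_ge {u : ℂ} (hu : 0 ≤ u.re) :
    0 ≤ (u ^ (1 / 2 : ℂ)).re ∧ ‖u‖ ≤ 2 * (u ^ (1 / 2 : ℂ)).re ^ 2 := by
  have hsq : (u ^ (1 / 2 : ℂ)) ^ 2 = u := by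
    rw [← Complex.cpow_nat_mul]; simp
  have h0 : 0 ≤ (u ^ (1 / 2 : ℂ)).re := by
    rcases eq_or_ne u 0 with rfl | h
    · simp
    rw [Complex.cpow_def_of_ne_zero h, Complex.exp_re]
    refine mul_nonneg (Real.exp_pos _).le (Real.cos_nonneg_of_mem_Icc ?_)
    have h1 : (Complex.log u * (1 / 2)).im = Complex.arg u / 2 := by
      simp [Complex.mul_im, Complex.log_im]; ring
    rw [h1]
    have h2 := Complex.abs_arg_le_pi_div_two_iff.2 hu
    rw [abs_le] at h2
    constructor <;> linarith [h2.1, h2.2, Real.pi_pos]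
  refine ⟨h0, ?_⟩
  set w := u ^ (1 / 2 : ℂ)
  have h1 : ‖u‖ = w.re ^ 2 + w.im ^ 2 := by
    rw [← hsq, norm_pow, Complex.sq_norm, Complex.normSq_apply]; ring
  have h2 : u.re = w.re ^ 2 - w.im ^ 2 := by
    rw [← hsq, sq, Complex.mul_re]; ring
  linarith

/-- Maximum modulus principle on a half disc, interpolating between a good bound on the diameter
and a poor bound on the arc. -/
lemma norm_le_of_halfDisc {f : ℂ → ℂ} (hf : Differentiable ℂ f) {s₀ : ℂ} {r R C c E K : ℝ}
    (hr : 0 < r) (hR : 12 * r ≤ R) (hC : 1 ≤ C) (hc : 0 ≤ c) (hE : 0 ≤ E) (hK : 0 ≤ K)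
    (ha : ∀ s, s₀.re ≤ s.re → ‖s - s₀‖ ≤ R → ‖f s‖ ≤ C * Real.exp (c * √(‖s - s₀‖ / r)) * K)
    (hb : ∀ s, ‖s - s₀‖ ≤ R → ‖f s‖ ≤ Real.exp E * K) {s : ℂ} (hs : ‖s - s₀‖ ≤ 12 * r) :
    ‖f s‖ ≤ C * Real.exp (8 * c + 36 * E * (r / R)) * K := by
  have hR0 : 0 < R := by linarith
  rcases le_or_gt s₀.re s.re with hre | hre
  · refine (ha s hre (hs.trans hR)).trans ?_
    have h1 : √(‖s - s₀‖ / r) ≤ 8 := by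
      rw [Real.sqrt_le_left (by norm_num), div_le_iff₀ hr]; linarith
    have h2 : c * √(‖s - s₀‖ / r) ≤ 8 * c + 36 * E * (r / R) := by
      have : 0 ≤ 36 * E * (r / R) := by positivity
      nlinarith
    gcongr
  set G : ℂ → ℂ := fun s => f s * Complex.exp (-(2 * c * (1 + (s₀ - s) / r) ^ (1 / 2 : ℂ)))
    * Complex.exp (-(E * (2 * ((s₀ - s) / R) - ((s₀ - s) / R) ^ 2))) with hG
  set U : Set ℂ := Metric.ball s₀ R ∩ {s | s.re < s₀.re} with hU
  have hrc : (r : ℂ) ≠ 0 := by exact_mod_cast hr.ne'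
  have hclos : closure U ⊆ Metric.closedBall s₀ R ∩ {s | s.re ≤ s₀.re} := by
    refine closure_minimal ?_ ?_
    · rintro z ⟨h1, h2⟩
      have h2' : z.re < s₀.re := h2
      exact ⟨Metric.ball_subset_closedBall h1, h2'.le⟩
    · exact Metric.isClosed_closedBall.inter (isClosed_le Complex.continuous_re continuous_const)
  have hre' : ∀ z : ℂ, z.re ≤ s₀.re → 1 ≤ (1 + (s₀ - z) / r).re := by
    intro z hz
    rw [Complex.add_re, Complex.div_ofReal_re, Complex.one_re, Complex.sub_re]
    have : 0 ≤ (s₀.re - z.re) / r := div_nonneg (by linarith) hr.le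
    linarith
  have hGd : DiffContOnCl ℂ G U := by
    refine DifferentiableOn.diffContOnCl fun z hz => ?_
    have hz2 := (hclos hz).2
    have hslit : 1 + (s₀ - z) / r ∈ Complex.slitPlane :=
      Or.inl (by linarith [hre' z hz2])
    have h1 : DifferentiableAt ℂ (fun s : ℂ => (1 + (s₀ - s) / r) ^ (1 / 2 : ℂ)) z :=
      DifferentiableAt.cpow (by fun_prop) (by fun_prop) hslit
    have h2 : DifferentiableAt ℂ G z := by
      rw [hG]
      have := hf z
      fun_prop
    exact h2.differentiableWithinAt
  have hn1 : ∀ z : ℂ, ‖Complex.exp (-(2 * c * (1 + (s₀ - z) / r) ^ (1 / 2 : ℂ)))‖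
      = Real.exp (-(2 * c * ((1 + (s₀ - z) / r) ^ (1 / 2 : ℂ)).re)) := by
    intro z
    rw [Complex.norm_exp]
    congr 1
    have : (2 * (c : ℂ)) = ((2 * c : ℝ) : ℂ) := by push_cast; rfl
    rw [Complex.neg_re, this, Complex.re_ofReal_mul]
  have hn2 : ∀ z : ℂ, ‖Complex.exp (-(E * (2 * ((s₀ - z) / R) - ((s₀ - z) / R) ^ 2)))‖
      = Real.exp (-(E * (2 * ((s₀ - z).re / R) - ((s₀ - z).re / R) ^ 2
        + ((s₀ - z).im / R) ^ 2))) := by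
    intro z
    rw [Complex.norm_exp]
    congr 1
    rw [Complex.neg_re, Complex.re_ofReal_mul]
    have h2 : (2 * ((s₀ - z) / R) - ((s₀ - z) / R) ^ 2).re = 2 * ((s₀ - z).re / R)
        - ((s₀ - z).re / R) ^ 2 + ((s₀ - z).im / R) ^ 2 := by
      rw [← Complex.div_ofReal_re, ← Complex.div_ofReal_im, sq ((s₀ - z) / (R : ℂ)),
        Complex.sub_re, Complex.mul_re ((s₀ - z) / (R : ℂ))]
      simp only [Complex.mul_re, Complex.re_ofNat, Complex.im_ofNat]
      ring
    rw [h2]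
  have hfr : ∀ z ∈ frontier U, ‖G z‖ ≤ C * K := by
    intro z hz
    have hopen : IsOpen U := Metric.isOpen_ball.inter
      (isOpen_lt Complex.continuous_re continuous_const)
    rw [hopen.frontier_eq] at hz
    obtain ⟨hz1, hz2⟩ := hclos hz.1
    have hzb : ‖z - s₀‖ ≤ R := by simpa [dist_eq_norm] using hz1
    have hz2' : z.re ≤ s₀.re := hz2
    have hcase : ‖z - s₀‖ = R ∨ z.re = s₀.re := by
      by_contra hcon
      push Not at hcon
      exact hz.2 ⟨by rw [Metric.mem_ball, dist_eq_norm]; exact lt_of_le_of_ne hzb hcon.1,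
        lt_of_le_of_ne hz2' hcon.2⟩
    rw [hG, norm_mul, norm_mul, hn1, hn2]
    obtain ⟨hp0, hp1⟩ := sq_re_cpow_half_ge (u := 1 + (s₀ - z) / r) (by linarith [hre' z hz2'])
    set P := ((1 + (s₀ - z) / r) ^ (1 / 2 : ℂ)).re
    rcases hcase with h | h
    · have h1 : Real.exp (-(2 * c * P)) ≤ 1 := Real.exp_le_one_iff.2 (by
        have := mul_nonneg hc hp0; linarith)
      have h2 : 1 ≤ 2 * ((s₀ - z).re / R) - ((s₀ - z).re / R) ^ 2 + ((s₀ - z).im / R) ^ 2 := by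
        have h3 : ((s₀ - z).re / R) ^ 2 + ((s₀ - z).im / R) ^ 2 = 1 := by
          have : (s₀ - z).re ^ 2 + (s₀ - z).im ^ 2 = R ^ 2 := by
            rw [← h, norm_sub_rev, Complex.sq_norm, Complex.normSq_apply]; ring
          rw [div_pow, div_pow, ← add_div, this, div_self (by positivity)]
        have h4 : 0 ≤ (s₀ - z).re / R := div_nonneg (by simpa using hz2') hR0.le
        have h5 : (s₀ - z).re / R ≤ 1 := by
          nlinarith [sq_nonneg ((s₀ - z).im / R)]
        nlinarith
      have h6 : Real.exp (-(E * (2 * ((s₀ - z).re / R) - ((s₀ - z).re / R) ^ 2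
        + ((s₀ - z).im / R) ^ 2))) ≤ Real.exp (-E) := by
        refine Real.exp_le_exp.2 ?_
        nlinarith
      calc _ ≤ (Real.exp E * K) * 1 * Real.exp (-E) := by
            have := hb z hzb
            gcongr
        _ = K := by rw [mul_one, mul_right_comm, ← Real.exp_add]; simp
        _ ≤ C * K := le_mul_of_one_le_left hK hC
    · have h0 : (s₀ - z).re = 0 := by simp [h]
      have h6 : Real.exp (-(E * (2 * ((s₀ - z).re / R) - ((s₀ - z).re / R) ^ 2
        + ((s₀ - z).im / R) ^ 2))) ≤ 1 := by
        refine Real.exp_le_one_iff.2 ?_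
        rw [h0]
        have : 0 ≤ E * ((s₀ - z).im / R) ^ 2 := by positivity
        simpa using this
      have h7 : √(‖z - s₀‖ / r) ≤ 2 * P := by
        rw [Real.sqrt_le_left (by positivity)]
        have h8 : ‖z - s₀‖ / r ≤ ‖1 + (s₀ - z) / r‖ := by
          have e1 : ‖z - s₀‖ = |(s₀ - z).im| := by
            rw [norm_sub_rev, Complex.norm_eq_sqrt_sq_add_sq, h0]
            simp [Real.sqrt_sq_eq_abs]
          have e2 : |(1 + (s₀ - z) / r).im| = |(s₀ - z).im| / r := by
            rw [Complex.add_im, Complex.div_ofReal_im, Complex.one_im, zero_add, abs_div,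
              abs_of_pos hr]
          rw [e1, ← e2]
          exact Complex.abs_im_le_norm _
        nlinarith [sq_nonneg P]
      calc _ ≤ (C * Real.exp (c * √(‖z - s₀‖ / r)) * K) * Real.exp (-(2 * c * P)) * 1 := by
            have := ha z h.ge hzb
            gcongr
        _ = C * K * Real.exp (c * √(‖z - s₀‖ / r) + -(2 * c * P)) := by
            rw [Real.exp_add]; ring
        _ ≤ C * K * 1 := by
            gcongr
            refine Real.exp_le_one_iff.2 ?_
            nlinarith
        _ = C * K := mul_one _
  have hbd : Bornology.IsBounded U := Metric.isBounded_ball.subset Set.inter_subset_left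
  have hmain : ‖G s‖ ≤ C * K := by
    rcases lt_or_ge ‖s - s₀‖ R with h | h
    · exact Complex.norm_le_of_forall_mem_frontier_norm_le hbd hGd hfr
        (subset_closure ⟨by rwa [Metric.mem_ball, dist_eq_norm], hre⟩)
    · refine Complex.norm_le_of_forall_mem_frontier_norm_le hbd hGd hfr ?_
      have hsR : ‖s - s₀‖ = R := le_antisymm (hs.trans hR) h
      refine Metric.mem_closure_iff.2 fun ε hε => ?_
      set t : ℝ := min (1 / 2) (ε / (2 * R)) with ht
      have ht0 : 0 < t := by positivity
      have ht1 : t ≤ 1 / 2 := min_le_left _ _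
      have ht2 : t * R ≤ ε / 2 := by
        calc t * R ≤ ε / (2 * R) * R := by gcongr; exact min_le_right _ _
          _ = ε / 2 := by field_simp
      refine ⟨s + t * (s₀ - s), ⟨?_, ?_⟩, ?_⟩
      · rw [Metric.mem_ball, dist_eq_norm]
        have : s + t * (s₀ - s) - s₀ = ((1 - t : ℝ) : ℂ) * (s - s₀) := by push_cast; ring
        rw [this, norm_mul, Complex.norm_real, Real.norm_of_nonneg (by linarith), hsR]
        nlinarith
      · simp only [Set.mem_ofPred_eq, Complex.add_re, Complex.re_ofReal_mul, Complex.sub_re]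
        nlinarith
      · rw [dist_eq_norm]
        have : s - (s + t * (s₀ - s)) = (t : ℂ) * (s - s₀) := by ring
        rw [this, norm_mul, Complex.norm_real, Real.norm_of_nonneg ht0.le, hsR]
        linarith
  have e1 : ‖f s‖ = ‖G s‖ * (Real.exp (2 * c * ((1 + (s₀ - s) / r) ^ (1 / 2 : ℂ)).re)
      * Real.exp (E * (2 * ((s₀ - s).re / R) - ((s₀ - s).re / R) ^ 2
        + ((s₀ - s).im / R) ^ 2))) := by
    rw [hG, norm_mul, norm_mul, hn1, hn2, Real.exp_neg, Real.exp_neg]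
    have := Real.exp_pos (2 * c * ((1 + (s₀ - s) / r) ^ (1 / 2 : ℂ)).re)
    have := Real.exp_pos (E * (2 * ((s₀ - s).re / R) - ((s₀ - s).re / R) ^ 2
        + ((s₀ - s).im / R) ^ 2))
    field_simp
  have hsn : ‖s₀ - s‖ ≤ 12 * r := by rw [norm_sub_rev]; exact hs
  have e2 : 2 * c * ((1 + (s₀ - s) / r) ^ (1 / 2 : ℂ)).re ≤ 8 * c := by
    have h1 : ((1 + (s₀ - s) / r) ^ (1 / 2 : ℂ)).re ≤ 4 := by
      refine (Complex.re_le_norm _).trans ?_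
      have h2 : ‖(1 + (s₀ - s) / r) ^ (1 / 2 : ℂ)‖ ^ 2 ≤ 13 := by
        rw [← norm_pow, ← Complex.cpow_nat_mul]
        simp only [Nat.cast_ofNat, one_div, ne_eq, OfNat.ofNat_ne_zero, not_false_eq_true,
          mul_inv_cancel₀, Complex.cpow_one]
        refine (norm_add_le _ _).trans ?_
        rw [norm_one, norm_div, Complex.norm_real, Real.norm_of_nonneg hr.le]
        have : ‖s₀ - s‖ / r ≤ 12 := (div_le_iff₀ hr).2 hsn
        linarith
      nlinarith [norm_nonneg ((1 + (s₀ - s) / r) ^ (1 / 2 : ℂ))]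
    nlinarith
  have e3 : 2 * ((s₀ - s).re / R) - ((s₀ - s).re / R) ^ 2 + ((s₀ - s).im / R) ^ 2
      ≤ 36 * (r / R) := by
    have h1 : (s₀ - s).re / R ≤ 12 * (r / R) := by
      rw [← mul_div_assoc]
      gcongr
      exact (Complex.re_le_norm _).trans hsn
    have h2 : ((s₀ - s).im / R) ^ 2 ≤ 12 * (r / R) := by
      have h3 : |(s₀ - s).im / R| ≤ 12 * (r / R) := by
        rw [abs_div, abs_of_pos hR0, ← mul_div_assoc]
        gcongr
        exact (Complex.abs_im_le_norm _).trans hsn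
      have h4 : 12 * (r / R) ≤ 1 := by rw [← mul_div_assoc, div_le_one hR0]; exact hR
      rw [← sq_abs]
      nlinarith [abs_nonneg ((s₀ - s).im / R)]
    nlinarith [sq_nonneg ((s₀ - s).re / R)]
  have e4 : E * (2 * ((s₀ - s).re / R) - ((s₀ - s).re / R) ^ 2 + ((s₀ - s).im / R) ^ 2)
      ≤ 36 * E * (r / R) := (mul_le_mul_of_nonneg_left e3 hE).trans_eq (by ring)
  rw [e1, Real.exp_add]
  calc _ ≤ C * K * (Real.exp (8 * c) * Real.exp (36 * E * (r / R))) :=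
        mul_le_mul hmain (mul_le_mul (Real.exp_le_exp.2 e2) (Real.exp_le_exp.2 e4)
          (Real.exp_pos _).le (Real.exp_pos _).le) (by positivity) (by positivity)
    _ = _ := by ring

lemma norm_charEntire_le {q : ℕ} [NeZero q] (χ : DirichletCharacter ℂ q) {s : ℂ}
    (hs : 1 / 2 ≤ s.re) : ‖charEntire χ s‖ ≤ 12 * q * (‖s‖ + 1) ^ 2 := by
  have hq : (1 : ℝ) ≤ q := by exact_mod_cast NeZero.pos q
  rw [charEntire]
  split_ifs with h
  · simpa using norm_zmodEntire_le χ χ.norm_le_one hs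
  have key : ∀ z : ℂ, 1 / 2 ≤ z.re → z ≠ 1 →
      ‖χ.LFunction z‖ ≤ 12 * q * (‖z‖ + 1) ^ 2 := by
    intro z hz hz1
    have h1 := norm_partialSum_sub_LFunction_le χ χ.norm_le_one le_rfl
      (by linarith : 0 < z.re) hz1
    rw [χ.sum_eq_zero_of_ne_one h] at h1
    simp only [Nat.floor_one, Finset.Icc_self, Finset.sum_singleton, Nat.cast_one, map_one,
      Complex.one_cpow, mul_one, zero_div, zero_mul, sub_zero, Real.one_rpow] at h1
    have h2 : ‖z‖ / z.re ≤ 2 * ‖z‖ := by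
      rw [div_le_iff₀ (by linarith)]
      nlinarith [norm_nonneg z]
    have h3 : ‖χ.LFunction z‖ ≤ 1 + 3 * q * (1 + ‖z‖ / z.re) := by
      have h4 := norm_sub_norm_le (ZMod.LFunction χ z) 1
      rw [norm_sub_rev, norm_one] at h4
      change ‖ZMod.LFunction χ z‖ ≤ _
      linarith
    have h4 : 3 * q * (1 + ‖z‖ / z.re) ≤ 3 * q * (1 + 2 * ‖z‖) := by gcongr
    have h5 : (q : ℝ) * (‖z‖ + 1) ^ 2 = q * ‖z‖ ^ 2 + 2 * (q * ‖z‖) + q := by ring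
    have h6 : 0 ≤ (q : ℝ) * ‖z‖ := by positivity
    have h7 : 0 ≤ (q : ℝ) * ‖z‖ ^ 2 := by positivity
    linarith
  rcases eq_or_ne s 1 with rfl | hs1
  · have hc : Continuous χ.LFunction := (DirichletCharacter.differentiable_LFunction h).continuous
    refine le_of_tendsto_of_tendsto (b := nhdsWithin (1 : ℂ) {1}ᶜ)
      (hc.norm.continuousAt.tendsto.mono_left nhdsWithin_le_nhds)
      ((by fun_prop : Continuous fun z : ℂ => 12 * (q : ℝ) * (‖z‖ + 1) ^ 2).continuousAt.tendsto.mono_left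
        nhdsWithin_le_nhds) ?_
    have h1 : ∀ᶠ z : ℂ in nhds 1, 1 / 2 < z.re :=
      (isOpen_lt continuous_const Complex.continuous_re).mem_nhds (by norm_num [Set.mem_ofPred_eq])
    filter_upwards [self_mem_nhdsWithin, nhdsWithin_le_nhds h1] with z hz hz2 using key z hz2.le hz
  · exact key s hs hs1

lemma norm_LFunction_two_ge {q : ℕ} [NeZero q] (χ : DirichletCharacter ℂ q) {s : ℂ}
    (hs : 2 ≤ s.re) : 1 / 3 ≤ ‖χ.LFunction s‖ := by
  have hs1 : 1 < s.re := by linarith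
  have h1 : HasSum (LSeries.term (fun n => χ n) s) (χ.LFunction s) := by
    rw [χ.LFunction_eq_LSeries hs1]
    exact (DirichletCharacter.LSeriesSummable_of_one_lt_re χ hs1).hasSum
  have h2 : HasSum (fun n : ℕ => if n = 1 then (1 : ℂ) else 0) 1 := hasSum_ite_eq 1 1
  have h2' : HasSum (fun n : ℕ => if n = 1 then (1 : ℝ) else 0) 1 := hasSum_ite_eq 1 1
  have h3 := h1.sub h2
  have h4 := hasSum_zeta_two.sub h2'
  have h5 : ‖χ.LFunction s - 1‖ ≤ Real.pi ^ 2 / 6 - 1 := by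
    rw [← h3.tsum_eq]
    refine tsum_of_norm_bounded h4 fun n => ?_
    rcases eq_or_ne n 0 with rfl | hn
    · simp
    rcases eq_or_ne n 1 with rfl | hn1
    · simp
    rw [if_neg hn1, if_neg hn1, sub_zero, sub_zero, LSeries.term_of_ne_zero hn, norm_div,
      Complex.norm_natCast_cpow_of_pos (Nat.pos_of_ne_zero hn)]
    have hn2 : (1 : ℝ) ≤ n := by exact_mod_cast Nat.pos_of_ne_zero hn
    have h6 : (n : ℝ) ^ 2 ≤ (n : ℝ) ^ s.re := by
      rw [← Real.rpow_natCast]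
      exact Real.rpow_le_rpow_of_exponent_le hn2 (by simpa using hs)
    have := χ.norm_le_one (n : ZMod q)
    gcongr
  have h6 := norm_sub_norm_le 1 (χ.LFunction s)
  rw [norm_sub_rev, norm_one] at h6
  have : Real.pi ^ 2 ≤ 9.93 := by nlinarith [Real.pi_lt_d2, Real.pi_pos]
  linarith

lemma charEntire_two_ge {q : ℕ} [NeZero q] (χ : DirichletCharacter ℂ q) :
    1 / 3 ≤ ‖charEntire χ 2‖ := by
  have h := norm_LFunction_two_ge χ (s := 2) (by simp)
  rw [charEntire]
  split_ifs with hc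
  · rw [zmodEntire_of_ne _ (by norm_num)]
    have h2 : ‖(2 : ℂ) - 1‖ = 1 := by norm_num
    rw [norm_mul, h2, one_mul]
    exact h
  · exact h

lemma exists_sum_zeroMult_local_le {g : ℝ} (hg : 0 < g) (hg1 : g ≤ 1) :
    ∃ C : ℝ, 0 < C ∧ ∀ (q : ℕ) [NeZero q], 3 ≤ q → ∀ (χ : DirichletCharacter ℂ q) (r T v : ℝ),
      0 < r → r ≤ 1 / 100 → 1 ≤ T → |v| ≤ T + 1 → (χ = 1 → g ≤ |v|) →
      1 ≤ r * Real.log (q * T) → ∀ S : Finset ℂ, (∀ ρ ∈ S, ‖(1 + r + v * Complex.I) - ρ‖ ≤ 4 * r) →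
        ((∑ ρ ∈ S, zeroMult χ.LFunction ρ : ℕ) : ℝ) ≤ C * (r * Real.log (q * T)) := by
  set C₀ : ℝ := 1 + 1 / 4 / g with hC₀
  have hC₀1 : 1 ≤ C₀ := by rw [hC₀]; have : 0 ≤ 1 / 4 / g := by positivity
                           linarith
  set e₀ : ℝ := 265 + Real.log (1 / g) with he₀
  have hlg : 0 ≤ Real.log (1 / g) := Real.log_nonneg (by rw [le_div_iff₀ hg]; linarith)
  have hlC : 0 ≤ Real.log C₀ := Real.log_nonneg hC₀1
  have hl2 : 0 < Real.log 2 := Real.log_pos one_lt_two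
  refine ⟨(Real.log C₀ + 2048 + 144 * e₀) / Real.log 2, by positivity, ?_⟩
  intro q _ hq χ r T v hr hr1 hT hv hvg hrl S hS
  set ℒ := Real.log (q * T) with hℒ
  have hq3 : (3 : ℝ) ≤ q := by exact_mod_cast hq
  have hqT : 3 ≤ q * T := by nlinarith
  have hexp : Real.exp ℒ = q * T := Real.exp_log (by linarith)
  have hℒ1 : 1 ≤ ℒ := by
    rw [hℒ, Real.le_log_iff_exp_le (by linarith)]
    linarith [Real.exp_one_lt_d9]
  set s₀ : ℂ := 1 + r + v * Complex.I with hs₀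
  have hre : s₀.re = 1 + r := by simp [hs₀]
  have him : s₀.im = v := by simp [hs₀]
  have hv0 : |v| ≤ ‖s₀ - 1‖ := by
    have := Complex.abs_im_le_norm (s₀ - 1)
    simpa [him] using this
  have hs01 : s₀ ≠ 1 := by
    intro h
    rw [h, Complex.one_re] at hre
    linarith
  set K := ‖charEntire χ s₀‖ with hK
  have hLlow : Real.exp (-(257 * ℒ)) ≤ ‖χ.LFunction s₀‖ := by
    have h1 := norm_LFunction_two_ge χ (s := 2 + v * Complex.I) (by simp)
    have h2 := norm_LFunction_le_exp_mul χ hr (s := 2 + v * Complex.I) (w := s₀)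
      (by simp; linarith) hre.ge
    have h3 : ‖2 + v * Complex.I - s₀‖ ≤ 1 := by
      have : 2 + v * Complex.I - s₀ = ((1 - r : ℝ) : ℂ) := by rw [hs₀]; push_cast; ring
      rw [this, Complex.norm_real, Real.norm_of_nonneg (by linarith)]
      linarith
    have h4 : √(‖2 + v * Complex.I - s₀‖ / r) ≤ ℒ := by
      rw [Real.sqrt_le_left (by linarith), div_le_iff₀ hr]
      nlinarith
    have h5 : Real.exp (256 * √(‖2 + v * Complex.I - s₀‖ / r)) ≤ Real.exp (256 * ℒ) := by
      gcongr
    have h6 : 3 ≤ Real.exp ℒ := by rw [hexp]; exact hqT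
    have h7 : 1 / 3 ≤ Real.exp (256 * ℒ) * ‖χ.LFunction s₀‖ := by
      refine h1.trans (h2.trans ?_)
      gcongr
    have h8 : 1 ≤ Real.exp (257 * ℒ) * ‖χ.LFunction s₀‖ := by
      rw [show 257 * ℒ = ℒ + 256 * ℒ by ring, Real.exp_add, mul_assoc]
      nlinarith
    rw [Real.exp_neg, inv_le_iff_one_le_mul₀ (Real.exp_pos _), mul_comm]
    exact h8
  have hKlow : g * Real.exp (-(257 * ℒ)) ≤ K := by
    rw [hK, charEntire]
    split_ifs with h
    · rw [zmodEntire_of_ne _ hs01, norm_mul]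
      exact mul_le_mul ((hvg h).trans hv0) hLlow (Real.exp_pos _).le (norm_nonneg _)
    · have := Real.exp_pos (-(257 * ℒ))
      nlinarith
  have hK0 : 0 < K := lt_of_lt_of_le (by positivity) hKlow
  have ha : ∀ s, s₀.re ≤ s.re → ‖s - s₀‖ ≤ 1 / 4 →
      ‖charEntire χ s‖ ≤ C₀ * Real.exp (256 * √(‖s - s₀‖ / r)) * K := by
    intro s hs hsR
    have h1 := norm_LFunction_le_exp_mul χ hr (s := s) (w := s₀) (hre ▸ hs) hre.ge
    rw [hK, charEntire]
    split_ifs with h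
    · have hs1 : s ≠ 1 := by
        rintro rfl
        rw [Complex.one_re] at hs
        linarith
      rw [zmodEntire_of_ne _ hs1, zmodEntire_of_ne _ hs01, norm_mul, norm_mul]
      have h2 : ‖s - 1‖ ≤ C₀ * ‖s₀ - 1‖ := by
        have h3 : ‖s - 1‖ ≤ ‖s - s₀‖ + ‖s₀ - 1‖ := by
          simpa using norm_add_le (s - s₀) (s₀ - 1)
        have h4 : 1 / 4 ≤ 1 / 4 / g * ‖s₀ - 1‖ := by
          rw [div_mul_eq_mul_div, le_div_iff₀ hg]
          have := (hvg h).trans hv0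
          linarith
        rw [hC₀]
        linarith
      calc _ ≤ (C₀ * ‖s₀ - 1‖) * (Real.exp (256 * √(‖s - s₀‖ / r)) * ‖χ.LFunction s₀‖) :=
            mul_le_mul h2 h1 (norm_nonneg _) (by positivity)
        _ = _ := by
            change _ = C₀ * _ * (‖s₀ - 1‖ * ‖χ.LFunction s₀‖)
            ring
    · refine h1.trans ?_
      gcongr
      exact le_mul_of_one_le_left (Real.exp_pos _).le hC₀1
  have hb : ∀ s, ‖s - s₀‖ ≤ 1 / 4 → ‖charEntire χ s‖ ≤ Real.exp (e₀ * ℒ) * K := by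
    intro s hs
    have h1 : 1 / 2 ≤ s.re := by
      have := (Complex.abs_re_le_norm (s - s₀)).trans hs
      rw [Complex.sub_re, abs_le] at this
      linarith
    have h2 : ‖s‖ ≤ T + 3 := by
      have h3 : ‖s₀‖ ≤ 1 + r + |v| := by
        rw [hs₀]
        refine (norm_add_le _ _).trans ?_
        rw [norm_mul, Complex.norm_I, mul_one, Complex.norm_real, Real.norm_eq_abs]
        gcongr
        refine (norm_add_le _ _).trans ?_
        rw [norm_one, Complex.norm_real, Real.norm_of_nonneg hr.le]
      have h4 : ‖s‖ ≤ ‖s - s₀‖ + ‖s₀‖ := by simpa using norm_add_le (s - s₀) s₀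
      linarith
    have h3 : ‖charEntire χ s‖ ≤ Real.exp (8 * ℒ) := by
      refine (norm_charEntire_le χ h1).trans ?_
      have h4 : (‖s‖ + 1) ^ 2 ≤ (5 * T) ^ 2 := by gcongr; linarith
      have h5 : Real.exp (8 * ℒ) = (q * T) ^ 8 := by
        rw [← hexp, ← Real.exp_nat_mul]; norm_num
      have h6 : (3 : ℝ) ^ 6 ≤ (q * T) ^ 6 := by gcongr
      rw [h5]
      calc 12 * q * (‖s‖ + 1) ^ 2 ≤ 12 * q * (5 * T) ^ 2 := by gcongr
        _ = 300 * (q * T ^ 2) := by ring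
        _ ≤ (q * T) ^ 6 * (q ^ 2 * T ^ 2) := by
            refine mul_le_mul (by linarith) ?_ (by positivity) (by positivity)
            gcongr
            nlinarith
        _ = _ := by ring
    refine h3.trans ?_
    have h4 : Real.exp (8 * ℒ) ≤ Real.exp (e₀ * ℒ) * (g * Real.exp (-(257 * ℒ))) := by
      have h5 : g = Real.exp (-Real.log (1 / g)) := by
        rw [← Real.log_inv, one_div, inv_inv, Real.exp_log hg]
      nth_rewrite 1 [h5]
      rw [← Real.exp_add, ← Real.exp_add, Real.exp_le_exp, he₀]
      nlinarith
    exact h4.trans (by gcongr)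
  have hmain : ∀ z, ‖z - s₀‖ = 3 * (4 * r) →
      ‖charEntire χ z‖ ≤ C₀ * Real.exp (8 * 256 + 36 * (e₀ * ℒ) * (r / (1 / 4))) * K :=
    fun z hz => norm_le_of_halfDisc (differentiable_charEntire χ) hr (by linarith) hC₀1
      (by norm_num) (by positivity) hK0.le ha hb (by linarith)
  have hfin := two_pow_sum_zeroMult_le χ S (by linarith) hS hmain
  have hfin2 := le_of_mul_le_mul_right hfin hK0
  have hlog := Real.log_le_log (by positivity) hfin2
  rw [Real.log_pow, Real.log_mul (by linarith) (Real.exp_pos _).ne', Real.log_exp] at hlog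
  rw [div_mul_eq_mul_div, le_div_iff₀ hl2]
  nlinarith

lemma norm_Gamma_le_Gamma_re {s : ℂ} (hs : 0 < s.re) : ‖Complex.Gamma s‖ ≤ Real.Gamma s.re := by
  rw [Complex.Gamma_eq_integral hs, Real.Gamma_eq_integral hs, Complex.GammaIntegral]
  refine (MeasureTheory.norm_integral_le_integral_norm _).trans_eq ?_
  refine MeasureTheory.setIntegral_congr_fun measurableSet_Ioi fun x hx => ?_
  have hx0 : (0 : ℝ) < x := hx
  simp only [norm_mul]
  rw [Complex.norm_cpow_eq_rpow_re_of_pos hx0, Complex.norm_real,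
    Real.norm_of_nonneg (Real.exp_pos _).le]
  simp

lemma Real.Gamma_le_two_mul_pow {x : ℝ} {n : ℕ} (hx : 1 / 2 ≤ x) (hn : x + 1 ≤ n) :
    Real.Gamma x ≤ 2 * (n : ℝ) ^ n := by
  have hx0 : 0 < x := by linarith
  have h1 : Real.Gamma (x + 2) = (x + 1) * (x * Real.Gamma x) := by
    rw [← Real.Gamma_add_one hx0.ne', ← Real.Gamma_add_one (by linarith)]
    ring_nf
  have h2 : Real.Gamma (x + 2) ≤ Real.Gamma (n + 1) :=
    Real.Gamma_strictMonoOn_Ici.monotoneOn (by simp; linarith) (by simp; linarith) (by linarith)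
  rw [Real.Gamma_nat_eq_factorial] at h2
  have h3 : (n.factorial : ℝ) ≤ (n : ℝ) ^ n := by exact_mod_cast Nat.factorial_le_pow n
  have h4 := Real.Gamma_pos_of_pos hx0
  have h5 : 1 / 2 * Real.Gamma x ≤ (x + 1) * (x * Real.Gamma x) := by
    have h6 : 1 / 2 ≤ (x + 1) * x := by nlinarith
    calc _ ≤ ((x + 1) * x) * Real.Gamma x := by gcongr
      _ = _ := by ring
  linarith

lemma norm_LFunction_le_of_seven_le {N : ℕ} [NeZero N] (Φ : ZMod N → ℂ) {B : ℝ}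
    (hB : ∀ j, ‖Φ j‖ ≤ B) {s : ℂ} (hs : 1 / 2 ≤ s.re) (hs7 : 7 ≤ ‖s - 1‖) :
    ‖ZMod.LFunction Φ s‖ ≤ 12 * B * N * (‖s‖ + 1) ^ 2 := by
  have h1 : s ≠ 1 := by
    rintro rfl
    norm_num at hs7
  have h := norm_zmodEntire_le Φ hB hs
  rw [zmodEntire_of_ne Φ h1, norm_mul] at h
  refine le_trans ?_ h
  exact le_mul_of_one_le_left (norm_nonneg _) (by linarith)

lemma norm_LFunction_one_sub_le {N : ℕ} [NeZero N] (Φ : ZMod N → ℂ) (hΦ : ∀ j, ‖Φ j‖ ≤ 1)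
    {s : ℂ} (hs : 1 / 2 ≤ s.re) (hs7 : 7 ≤ ‖s - 1‖) {n : ℕ} (hn : s.re + 1 ≤ n) :
    ‖ZMod.LFunction Φ (1 - s)‖
      ≤ (N : ℝ) ^ s.re * (2 * (n : ℝ) ^ n) * (Real.exp (2 * ‖s‖) * (24 * N * N * (‖s‖ + 1) ^ 2)) := by
  have hN : (1 : ℝ) ≤ N := by exact_mod_cast NeZero.pos N
  have hs0 : 0 < s.re := by linarith
  rw [ZMod.LFunction_one_sub Φ (fun k hk => by rw [hk] at hs; simp at hs; linarith)
    (Or.inr (by rintro rfl; norm_num at hs7))]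
  have hdft : ∀ Ψ : ZMod N → ℂ, (∀ j, ‖Ψ j‖ ≤ 1) → ∀ k, ‖ZMod.dft Ψ k‖ ≤ N := by
    intro Ψ hΨ k
    rw [ZMod.dft_apply]
    refine (norm_sum_le _ _).trans ?_
    calc _ ≤ ∑ j : ZMod N, (1 : ℝ) := by
          refine Finset.sum_le_sum fun j _ => ?_
          rw [norm_smul, AddChar.norm_apply, one_mul]
          exact hΨ j
      _ = N := by simp [ZMod.card]
  have h1 := norm_LFunction_le_of_seven_le (ZMod.dft Φ) (hdft Φ hΦ) hs hs7
  have h2 := norm_LFunction_le_of_seven_le (ZMod.dft fun x => Φ (-x))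
    (hdft _ fun j => hΦ _) hs hs7
  have hexp : ∀ a : ℂ, ‖a‖ ≤ 2 * ‖s‖ → ‖Complex.exp a‖ ≤ Real.exp (2 * ‖s‖) := by
    intro a ha
    rw [Complex.norm_exp]
    exact Real.exp_le_exp.2 ((Complex.re_le_norm _).trans ha)
  have hpi : Real.pi * ‖s‖ / 2 ≤ 2 * ‖s‖ := by
    nlinarith [Real.pi_lt_four, norm_nonneg s]
  have h3 := hexp (Real.pi * Complex.I * s / 2) (by
    simpa [abs_of_pos Real.pi_pos] using hpi)
  have h4 := hexp (-Real.pi * Complex.I * s / 2) (by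
    simpa [abs_of_pos Real.pi_pos] using hpi)
  rw [norm_mul, norm_mul, norm_mul]
  have h5 : ‖(N : ℂ) ^ (s - 1)‖ ≤ (N : ℝ) ^ s.re := by
    rw [Complex.norm_natCast_cpow_of_pos (NeZero.pos N)]
    exact Real.rpow_le_rpow_of_exponent_le hN (by simp)
  have h6 : ‖(2 * Real.pi : ℂ) ^ (-s)‖ ≤ 1 := by
    have : (2 * Real.pi : ℂ) = ((2 * Real.pi : ℝ) : ℂ) := by push_cast; rfl
    rw [this, Complex.norm_cpow_eq_rpow_re_of_pos Real.two_pi_pos]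
    exact Real.rpow_le_one_of_one_le_of_nonpos (by linarith [Real.pi_gt_three]) (by simp; linarith)
  have h7 := (norm_Gamma_le_Gamma_re hs0).trans (Real.Gamma_le_two_mul_pow hs hn)
  have h8 : ‖Complex.exp (Real.pi * Complex.I * s / 2) * ZMod.LFunction (ZMod.dft Φ) s
      + Complex.exp (-Real.pi * Complex.I * s / 2) * ZMod.LFunction (ZMod.dft fun x => Φ (-x)) s‖
      ≤ Real.exp (2 * ‖s‖) * (24 * N * N * (‖s‖ + 1) ^ 2) := by
    refine (norm_add_le _ _).trans ?_
    rw [norm_mul, norm_mul]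
    have h9 := mul_le_mul h3 h1 (norm_nonneg _) (Real.exp_pos _).le
    have h10 := mul_le_mul h4 h2 (norm_nonneg _) (Real.exp_pos _).le
    linarith
  calc _ ≤ (N : ℝ) ^ s.re * 1 * (2 * (n : ℝ) ^ n)
        * (Real.exp (2 * ‖s‖) * (24 * N * N * (‖s‖ + 1) ^ 2)) := by gcongr
    _ = _ := by ring

lemma norm_charEntire_le_exp {q : ℕ} [NeZero q] (χ : DirichletCharacter ℂ q) {T : ℝ}
    (hT : 1 ≤ T) {z : ℂ} (hz7 : 7 ≤ ‖z‖) (hz : ‖z‖ ≤ 11 * T) :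
    ‖charEntire χ z‖ ≤ Real.exp (5000 * (q * T) ^ 2) := by
  have hq : (1 : ℝ) ≤ q := by exact_mod_cast NeZero.pos q
  set X : ℝ := q * T with hX
  have hX1 : 1 ≤ X := by nlinarith
  have hTX : T ≤ X := by nlinarith
  have hXX : X ≤ X ^ 2 := by nlinarith
  have hlin : ∀ a : ℝ, a ≤ Real.exp a := fun a => by linarith [Real.add_one_le_exp a]
  rcases le_or_gt (1 / 2) z.re with hre | hre
  · refine (norm_charEntire_le χ hre).trans ((hlin _).trans (Real.exp_le_exp.2 ?_))
    calc 12 * q * (‖z‖ + 1) ^ 2 ≤ 12 * q * (12 * T) ^ 2 := by gcongr; linarith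
      _ = 1728 * (q * T ^ 2) := by ring
      _ ≤ 1728 * X ^ 2 := by rw [hX, mul_pow]; gcongr; nlinarith
      _ ≤ _ := by nlinarith
  set s : ℂ := 1 - z with hs
  have hsz : z = 1 - s := by rw [hs]; ring
  have hs1 : 1 / 2 ≤ s.re := by rw [hs, Complex.sub_re, Complex.one_re]; linarith
  have hs7 : 7 ≤ ‖s - 1‖ := by rw [hs]; simpa using hz7
  have hsn : ‖s‖ ≤ 12 * T := by
    refine (norm_sub_le _ _).trans ?_
    rw [norm_one]; linarith
  have hsre : s.re ≤ 12 * T := (Complex.re_le_norm s).trans hsn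
  set n := ⌈s.re + 1⌉₊ with hn
  have hn1 : (n : ℝ) ≤ 14 * T := by
    have := (Nat.ceil_lt_add_one (by linarith : 0 ≤ s.re + 1)).le
    linarith
  have hL := norm_LFunction_one_sub_le χ χ.norm_le_one hs1 hs7 (Nat.le_ceil _ : s.re + 1 ≤ n)
  rw [← hsz] at hL
  have b1 : (q : ℝ) ^ s.re ≤ Real.exp (12 * X ^ 2) := by
    calc (q : ℝ) ^ s.re ≤ (Real.exp q) ^ s.re := by gcongr; exact hlin _
      _ = Real.exp (q * s.re) := by rw [← Real.exp_mul]
      _ ≤ Real.exp (q * (12 * T)) := by gcongr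
      _ ≤ _ := by rw [Real.exp_le_exp]; linarith
  have b2 : 2 * (n : ℝ) ^ n ≤ Real.exp (198 * X ^ 2) := by
    have : (n : ℝ) ^ n ≤ Real.exp (196 * X ^ 2) := by
      calc (n : ℝ) ^ n ≤ (Real.exp n) ^ n := by gcongr; exact hlin _
        _ = Real.exp (n * n) := by rw [← Real.exp_nat_mul]
        _ ≤ Real.exp ((14 * X) * (14 * X)) := by
            gcongr <;> linarith
        _ = _ := by ring_nf
    calc 2 * (n : ℝ) ^ n ≤ Real.exp (2 * X ^ 2) * Real.exp (196 * X ^ 2) := by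
          gcongr
          exact le_trans (by nlinarith) (hlin _)
      _ = _ := by rw [← Real.exp_add]; ring_nf
  have b3 : Real.exp (2 * ‖s‖) ≤ Real.exp (24 * X ^ 2) := by rw [Real.exp_le_exp]; linarith
  have b4 : 24 * q * q * (‖s‖ + 1) ^ 2 ≤ Real.exp (4056 * X ^ 2) := by
    refine le_trans ?_ (hlin _)
    calc 24 * q * q * (‖s‖ + 1) ^ 2 ≤ 24 * q * q * (13 * T) ^ 2 := by gcongr; linarith
      _ = _ := by rw [hX]; ring
  have hL2 : ‖ZMod.LFunction χ z‖ ≤ Real.exp (4290 * X ^ 2) := by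
    refine hL.trans ?_
    calc _ ≤ Real.exp (12 * X ^ 2) * Real.exp (198 * X ^ 2)
          * (Real.exp (24 * X ^ 2) * Real.exp (4056 * X ^ 2)) := by gcongr
      _ = _ := by rw [← Real.exp_add, ← Real.exp_add, ← Real.exp_add]; ring_nf
  rw [charEntire]
  split_ifs with h
  · rw [zmodEntire_of_ne _ (by rintro rfl; norm_num at hz7), norm_mul]
    have b5 : ‖z - 1‖ ≤ Real.exp (12 * X ^ 2) := by
      refine le_trans ?_ (hlin _)
      refine (norm_sub_le _ _).trans ?_
      rw [norm_one]; linarith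
    calc _ ≤ Real.exp (12 * X ^ 2) * Real.exp (4290 * X ^ 2) := by gcongr
      _ = Real.exp (4302 * X ^ 2) := by rw [← Real.exp_add]; ring_nf
      _ ≤ _ := by gcongr; norm_num
  · refine hL2.trans ?_
    gcongr
    norm_num

lemma exists_sum_zeroMult_crude_le : ∃ C : ℝ, 0 < C ∧ ∀ (q : ℕ) [NeZero q]
    (χ : DirichletCharacter ℂ q) (T : ℝ), 1 ≤ T → ∀ S : Finset ℂ,
      (∀ ρ ∈ S, 0 ≤ ρ.re ∧ ρ.re ≤ 1 ∧ |ρ.im| ≤ T) →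
        ((∑ ρ ∈ S, zeroMult χ.LFunction ρ : ℕ) : ℝ) ≤ C * (q * T) ^ 2 := by
  have hl2 : 0 < Real.log 2 := Real.log_pos one_lt_two
  have hl3 : 0 < Real.log 3 := Real.log_pos (by norm_num)
  refine ⟨(Real.log 3 + 5000) / Real.log 2, by positivity, ?_⟩
  intro q _ χ T hT S hS
  have hq : (1 : ℝ) ≤ q := by exact_mod_cast NeZero.pos q
  have hX : 1 ≤ (q * T) ^ 2 := one_le_pow₀ (by nlinarith)
  have h1 := two_pow_sum_zeroMult_le χ S (c := 2) (R := T + 2)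
    (K := Real.exp (5000 * (q * T) ^ 2)) (by linarith) ?_ ?_
  · have h2 := charEntire_two_ge χ
    have h3 : (2 : ℝ) ^ (∑ ρ ∈ S, zeroMult χ.LFunction ρ)
        ≤ 3 * Real.exp (5000 * (q * T) ^ 2) := by
      have : (2 : ℝ) ^ (∑ ρ ∈ S, zeroMult χ.LFunction ρ) * (1 / 3)
        ≤ 2 ^ (∑ ρ ∈ S, zeroMult χ.LFunction ρ) * ‖charEntire χ 2‖ := by gcongr
      linarith
    have h4 := Real.log_le_log (by positivity) h3
    rw [Real.log_pow, Real.log_mul (by norm_num) (Real.exp_pos _).ne', Real.log_exp] at h4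
    rw [div_mul_eq_mul_div, le_div_iff₀ hl2]
    nlinarith
  · intro ρ hρ
    obtain ⟨h0, h1, h2⟩ := hS ρ hρ
    refine (Complex.norm_le_abs_re_add_abs_im _).trans ?_
    simp only [Complex.sub_re, Complex.re_ofNat, Complex.sub_im, Complex.im_ofNat, zero_sub,
      abs_neg]
    rw [abs_of_nonneg (by linarith)]
    linarith
  · intro z hz
    have h1 : ‖z‖ ≤ ‖z - 2‖ + 2 := by simpa using norm_add_le (z - 2) 2
    have h2 : ‖z - 2‖ ≤ ‖z‖ + 2 := by simpa using norm_sub_le z 2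
    exact norm_charEntire_le_exp χ hT (by linarith) (by linarith)

lemma sum_conj_char_mul_char {q : ℕ} [NeZero q] (a b : ZMod q) :
    ∑ χ : DirichletCharacter ℂ q, starRingEnd ℂ (χ a) * χ b
      = if IsUnit a ∧ a = b then (q.totient : ℂ) else 0 := by
  by_cases ha : IsUnit a
  · have h : ∀ χ : DirichletCharacter ℂ q, starRingEnd ℂ (χ a) = χ a⁻¹ := by
      intro χ
      have h1 : χ a⁻¹ * χ a = 1 := by rw [← map_mul, ZMod.inv_mul_of_unit a ha, map_one]
      have h2 : ‖χ a‖ = 1 := by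
        obtain ⟨u, rfl⟩ := ha
        exact χ.unit_norm_eq_one u
      rw [← Complex.inv_eq_conj h2]
      exact (eq_inv_of_mul_eq_one_left h1).symm
    simp only [h, DirichletCharacter.sum_char_inv_mul_char_eq ℂ ha b, ha, true_and]
  · simp [MulChar.map_nonunit _ ha, ha]

lemma sum_char_norm_sq_eq {q : ℕ} [NeZero q] (f : ZMod q → ℂ) :
    ∑ χ : DirichletCharacter ℂ q, ‖∑ b, f b * χ b‖ ^ 2
      = q.totient * ∑ b with IsUnit b, ‖f b‖ ^ 2 := by
  have h : ∀ χ : DirichletCharacter ℂ q, ((‖∑ b, f b * χ b‖ ^ 2 : ℝ) : ℂ)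
      = ∑ a, ∑ b, starRingEnd ℂ (f a) * f b * (starRingEnd ℂ (χ a) * χ b) := by
    intro χ
    push_cast
    rw [← Complex.conj_mul', map_sum, Finset.sum_mul_sum]
    refine Finset.sum_congr rfl fun a _ => Finset.sum_congr rfl fun b _ => ?_
    rw [map_mul]; ring
  have h2 : ((∑ χ : DirichletCharacter ℂ q, ‖∑ b, f b * χ b‖ ^ 2 : ℝ) : ℂ)
      = ((q.totient * ∑ b with IsUnit b, ‖f b‖ ^ 2 : ℝ) : ℂ) := by
    rw [Complex.ofReal_sum, Finset.sum_congr rfl fun χ _ => h χ, Finset.sum_comm]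
    simp_rw [Finset.sum_comm (s := (Finset.univ : Finset (DirichletCharacter ℂ q))),
      ← Finset.mul_sum, sum_conj_char_mul_char]
    push_cast
    rw [Finset.sum_filter, Finset.mul_sum]
    refine Finset.sum_congr rfl fun a _ => ?_
    by_cases ha : IsUnit a
    · simp only [ha, true_and, mul_ite, mul_zero, Finset.sum_ite_eq, Finset.mem_univ, if_true]
      rw [Complex.conj_mul', mul_comm]
    · simp [ha]
  exact_mod_cast h2

lemma exists_sum_exp_neg_abs_int_le :
    ∃ K : ℝ, 0 < K ∧ ∀ (J : Finset ℤ) (i : ℤ), ∑ j ∈ J, Real.exp (-|((i - j : ℤ) : ℝ)|) ≤ K := by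
  have hs : Summable fun k : ℤ => Real.exp (-|(k : ℝ)|) := by
    have h1 : Summable fun n : ℕ => Real.exp (-(n : ℝ)) := Real.summable_exp_neg_nat
    refine Summable.of_nat_of_neg ?_ ?_
    · simpa using h1
    · simpa using h1
  refine ⟨∑' k : ℤ, Real.exp (-|(k : ℝ)|), hs.tsum_pos (fun _ => (Real.exp_pos _).le) 0
    (Real.exp_pos _), fun J i => ?_⟩
  have h2 : ∑ j ∈ J, Real.exp (-|((i - j : ℤ) : ℝ)|)
      = ∑ k ∈ J.image (fun j => i - j), Real.exp (-|(k : ℝ)|) := by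
    rw [Finset.sum_image]
    intro a _ b _ hab
    simpa using hab
  rw [h2]
  exact hs.sum_le_tsum _ fun _ _ => (Real.exp_pos _).le

lemma exp_neg_sq_div_four_le {u : ℝ} {k : ℤ} (h : |(k : ℝ)| ≤ |u| + 1) :
    Real.exp (-u ^ 2 / 4) ≤ Real.exp 2 * Real.exp (-|(k : ℝ)|) := by
  rw [← Real.exp_add, Real.exp_le_exp]
  have : |u| - 1 ≤ u ^ 2 / 4 := by
    rw [← sq_abs]
    nlinarith [sq_nonneg (|u| - 2)]
  linarith

/-- A mean value theorem for exponential sums with frequencies grouped into cells. -/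
lemma exists_integral_expSum_sq_le : ∃ C : ℝ, 0 < C ∧ ∀ {ι : Type} (A : Finset ι)
    (a : ι → ℂ) (l : ι → ℝ) (T : ℝ), 0 < T →
      ∫ v in (-T)..T, ‖∑ n ∈ A, a n * Complex.exp (-(l n * v : ℝ) * Complex.I)‖ ^ 2
        ≤ C * T * ∑ j ∈ A.image fun n => ⌊T * l n⌋,
          (∑ n ∈ A with ⌊T * l n⌋ = j, ‖a n‖) ^ 2 := by
  obtain ⟨K, hK, hKb⟩ := exists_sum_exp_neg_abs_int_le
  refine ⟨Real.exp 1 * (√Real.pi * (Real.exp 2 * K)), by positivity, ?_⟩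
  intro ι A a l T hT
  set S : ℝ → ℂ := fun v => ∑ n ∈ A, a n * Complex.exp (-(l n * v : ℝ) * Complex.I) with hS
  set J := A.image fun n => ⌊T * l n⌋ with hJ
  set B : ℤ → ℝ := fun j => ∑ n ∈ A with ⌊T * l n⌋ = j, ‖a n‖ with hB
  have hScont : Continuous S := by
    rw [hS]
    fun_prop
  have hb : 0 < (((T⁻¹ ^ 2 : ℝ) : ℂ)).re := by
    rw [Complex.ofReal_re]; positivity
  have hexpand : ∀ v : ℝ, ((Real.exp (-(T⁻¹ ^ 2) * v ^ 2) * ‖S v‖ ^ 2 : ℝ) : ℂ)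
      = ∑ m ∈ A, ∑ n ∈ A, starRingEnd ℂ (a m) * a n *
        (Complex.exp (Complex.I * ((l m - l n : ℝ) : ℂ) * v)
          * Complex.exp (-((T⁻¹ ^ 2 : ℝ) : ℂ) * (v : ℂ) ^ 2)) := by
    intro v
    rw [Complex.ofReal_mul, Complex.ofReal_pow, ← Complex.conj_mul', hS]
    simp only [map_sum]
    rw [Finset.sum_mul_sum, Finset.mul_sum]
    refine Finset.sum_congr rfl fun m _ => ?_
    rw [Finset.mul_sum]
    refine Finset.sum_congr rfl fun n _ => ?_
    rw [map_mul, ← Complex.exp_conj]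
    have e1 : Complex.exp (Complex.I * ((l m - l n : ℝ) : ℂ) * v)
        = Complex.exp (starRingEnd ℂ (-(l m * v : ℝ) * Complex.I))
          * Complex.exp (-(l n * v : ℝ) * Complex.I) := by
      rw [← Complex.exp_add]
      congr 1
      rw [map_mul, map_neg, Complex.conj_ofReal, Complex.conj_I]
      push_cast
      ring
    rw [e1, Complex.ofReal_exp]
    push_cast
    ring
  have hInt : ∀ m n, MeasureTheory.Integrable fun v : ℝ => starRingEnd ℂ (a m) * a n *
        (Complex.exp (Complex.I * ((l m - l n : ℝ) : ℂ) * v)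
          * Complex.exp (-((T⁻¹ ^ 2 : ℝ) : ℂ) * (v : ℂ) ^ 2)) := by
    intro m n
    refine MeasureTheory.Integrable.const_mul ?_ _
    have := integrable_cexp_quadratic hb (Complex.I * ((l m - l n : ℝ) : ℂ)) 0
    refine this.congr (Filter.Eventually.of_forall fun v => ?_)
    simp only
    rw [← Complex.exp_add]
    congr 1
    ring
  have hGint : MeasureTheory.Integrable fun v : ℝ => Real.exp (-(T⁻¹ ^ 2) * v ^ 2) * ‖S v‖ ^ 2 := by
    have h1 : MeasureTheory.Integrable fun v : ℝ =>
        ((Real.exp (-(T⁻¹ ^ 2) * v ^ 2) * ‖S v‖ ^ 2 : ℝ) : ℂ) := by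
      simp_rw [hexpand]
      exact MeasureTheory.integrable_finsetSum _ fun m _ =>
        MeasureTheory.integrable_finsetSum _ fun n _ => hInt m n
    exact h1.re
  have hG : ∫ v : ℝ, Real.exp (-(T⁻¹ ^ 2) * v ^ 2) * ‖S v‖ ^ 2
      ≤ ∑ m ∈ A, ∑ n ∈ A, ‖a m‖ * ‖a n‖ * (√Real.pi * T *
        Real.exp (-(T * (l m - l n)) ^ 2 / 4)) := by
    have h1 : ((∫ v : ℝ, Real.exp (-(T⁻¹ ^ 2) * v ^ 2) * ‖S v‖ ^ 2 : ℝ) : ℂ)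
        = ∑ m ∈ A, ∑ n ∈ A, starRingEnd ℂ (a m) * a n *
          ((Real.pi / ((T⁻¹ ^ 2 : ℝ) : ℂ)) ^ (1 / 2 : ℂ)
            * Complex.exp (-((l m - l n : ℝ) : ℂ) ^ 2 / (4 * ((T⁻¹ ^ 2 : ℝ) : ℂ)))) := by
      rw [← integral_complex_ofReal]
      simp_rw [hexpand]
      rw [MeasureTheory.integral_finsetSum _ fun m _ =>
        MeasureTheory.integrable_finsetSum _ fun n _ => hInt m n]
      refine Finset.sum_congr rfl fun m _ => ?_
      rw [MeasureTheory.integral_finsetSum _ fun n _ => hInt m n]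
      refine Finset.sum_congr rfl fun n _ => ?_
      rw [MeasureTheory.integral_const_mul, fourierIntegral_gaussian hb]
    have h2 : ∀ m n, ‖starRingEnd ℂ (a m) * a n *
          ((Real.pi / ((T⁻¹ ^ 2 : ℝ) : ℂ)) ^ (1 / 2 : ℂ)
            * Complex.exp (-((l m - l n : ℝ) : ℂ) ^ 2 / (4 * ((T⁻¹ ^ 2 : ℝ) : ℂ))))‖
          = ‖a m‖ * ‖a n‖ * (√Real.pi * T * Real.exp (-(T * (l m - l n)) ^ 2 / 4)) := by
      intro m n
      have e1 : ‖(Real.pi / ((T⁻¹ ^ 2 : ℝ) : ℂ)) ^ (1 / 2 : ℂ)‖ = √Real.pi * T := by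
        rw [← Complex.ofReal_div, Complex.norm_cpow_eq_rpow_re_of_pos (by positivity)]
        have : (1 / 2 : ℂ).re = 1 / 2 := by norm_num
        rw [this, ← Real.sqrt_eq_rpow, Real.sqrt_div Real.pi_pos.le, Real.sqrt_sq (by positivity)]
        field_simp
      have e2 : ‖Complex.exp (-((l m - l n : ℝ) : ℂ) ^ 2 / (4 * ((T⁻¹ ^ 2 : ℝ) : ℂ)))‖
          = Real.exp (-(T * (l m - l n)) ^ 2 / 4) := by
        have : -((l m - l n : ℝ) : ℂ) ^ 2 / (4 * ((T⁻¹ ^ 2 : ℝ) : ℂ))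
            = ((-(T * (l m - l n)) ^ 2 / 4 : ℝ) : ℂ) := by
          push_cast
          have : (T : ℂ) ≠ 0 := by exact_mod_cast hT.ne'
          field_simp
        rw [this, Complex.norm_exp, Complex.ofReal_re]
      rw [norm_mul, norm_mul, norm_mul, e1, e2, RCLike.norm_conj]
    calc _ ≤ ‖((∫ v : ℝ, Real.exp (-(T⁻¹ ^ 2) * v ^ 2) * ‖S v‖ ^ 2 : ℝ) : ℂ)‖ := by
          rw [Complex.norm_real]; exact le_abs_self _
      _ ≤ _ := by
          rw [h1]
          refine (norm_sum_le _ _).trans (Finset.sum_le_sum fun m _ => ?_)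
          refine (norm_sum_le _ _).trans (Finset.sum_le_sum fun n _ => ?_)
          exact (h2 m n).le
  have hcell : ∀ m n, Real.exp (-(T * (l m - l n)) ^ 2 / 4)
      ≤ Real.exp 2 * Real.exp (-|((⌊T * l m⌋ - ⌊T * l n⌋ : ℤ) : ℝ)|) := by
    intro m n
    refine exp_neg_sq_div_four_le ?_
    push_cast
    have h1 := Int.floor_le (T * l m)
    have h2 := Int.lt_floor_add_one (T * l m)
    have h3 := Int.floor_le (T * l n)
    have h4 := Int.lt_floor_add_one (T * l n)
    have h5 : T * (l m - l n) = T * l m - T * l n := by ring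
    rw [h5, abs_le]
    constructor
    · linarith [neg_abs_le (T * l m - T * l n)]
    · linarith [le_abs_self (T * l m - T * l n)]
  have hgroup : ∑ m ∈ A, ∑ n ∈ A, ‖a m‖ * ‖a n‖ *
      Real.exp (-|((⌊T * l m⌋ - ⌊T * l n⌋ : ℤ) : ℝ)|)
      = ∑ i ∈ J, ∑ j ∈ J, B i * B j * Real.exp (-|((i - j : ℤ) : ℝ)|) := by
    have hmem : ∀ n ∈ A, ⌊T * l n⌋ ∈ J := fun n hn => Finset.mem_image_of_mem _ hn
    rw [← Finset.sum_fiberwise_of_maps_to hmem]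
    refine Finset.sum_congr rfl fun i _ => ?_
    simp_rw [← Finset.sum_fiberwise_of_maps_to hmem (fun n => ‖a _‖ * ‖a n‖ * _)]
    rw [Finset.sum_comm]
    refine Finset.sum_congr rfl fun j _ => ?_
    rw [hB]
    simp only
    rw [Finset.sum_mul_sum, Finset.sum_mul]
    refine Finset.sum_congr rfl fun m hm => ?_
    rw [Finset.sum_mul]
    refine Finset.sum_congr rfl fun n hn => ?_
    rw [(Finset.mem_filter.1 hm).2, (Finset.mem_filter.1 hn).2]
  have hschur : ∑ i ∈ J, ∑ j ∈ J, B i * B j * Real.exp (-|((i - j : ℤ) : ℝ)|)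
      ≤ K * ∑ j ∈ J, B j ^ 2 := by
    have h1 : ∑ i ∈ J, ∑ j ∈ J, B i * B j * Real.exp (-|((i - j : ℤ) : ℝ)|)
        ≤ ∑ i ∈ J, ∑ j ∈ J, (B i ^ 2 / 2 * Real.exp (-|((i - j : ℤ) : ℝ)|)
          + B j ^ 2 / 2 * Real.exp (-|((i - j : ℤ) : ℝ)|)) := by
      refine Finset.sum_le_sum fun i _ => Finset.sum_le_sum fun j _ => ?_
      rw [← add_mul]
      gcongr
      nlinarith [sq_nonneg (B i - B j)]
    have h2 : ∑ i ∈ J, ∑ j ∈ J, B i ^ 2 / 2 * Real.exp (-|((i - j : ℤ) : ℝ)|)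
        ≤ ∑ i ∈ J, B i ^ 2 / 2 * K := by
      refine Finset.sum_le_sum fun i _ => ?_
      rw [← Finset.mul_sum]
      gcongr
      exact hKb J i
    have h3 : ∑ i ∈ J, ∑ j ∈ J, B j ^ 2 / 2 * Real.exp (-|((i - j : ℤ) : ℝ)|)
        ≤ ∑ j ∈ J, B j ^ 2 / 2 * K := by
      rw [Finset.sum_comm]
      refine Finset.sum_le_sum fun j _ => ?_
      rw [← Finset.mul_sum]
      gcongr
      refine le_of_eq_of_le (Finset.sum_congr rfl fun i _ => ?_) (hKb J j)
      push_cast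
      rw [abs_sub_comm]
    refine h1.trans ?_
    simp_rw [Finset.sum_add_distrib]
    refine (add_le_add h2 h3).trans_eq ?_
    rw [← Finset.sum_mul, ← Finset.sum_div]
    ring
  have hfirst : ∫ v in (-T)..T, ‖S v‖ ^ 2
      ≤ Real.exp 1 * ∫ v : ℝ, Real.exp (-(T⁻¹ ^ 2) * v ^ 2) * ‖S v‖ ^ 2 := by
    have h1 : ∫ v in (-T)..T, ‖S v‖ ^ 2
        ≤ ∫ v in (-T)..T, Real.exp 1 * (Real.exp (-(T⁻¹ ^ 2) * v ^ 2) * ‖S v‖ ^ 2) := by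
      refine intervalIntegral.integral_mono_on (by linarith)
        ((hScont.norm.pow 2).intervalIntegrable _ _) ?_ fun v hv => ?_
      · refine Continuous.intervalIntegrable ?_ _ _
        fun_prop
      · rw [← mul_assoc, ← Real.exp_add]
        refine le_mul_of_one_le_left (by positivity) (Real.one_le_exp ?_)
        have : T⁻¹ ^ 2 * v ^ 2 ≤ 1 := by
          rw [← mul_pow, sq_le_one_iff_abs_le_one, abs_mul, abs_of_pos (inv_pos.2 hT),
            inv_mul_le_one₀ hT, abs_le]
          exact hv
        linarith
    rw [intervalIntegral.integral_const_mul] at h1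
    refine h1.trans ?_
    gcongr
    rw [intervalIntegral.integral_of_le (by linarith)]
    exact MeasureTheory.setIntegral_le_integral hGint
      (Filter.Eventually.of_forall fun v => by positivity)
  refine hfirst.trans ?_
  calc _ ≤ Real.exp 1 * ∑ m ∈ A, ∑ n ∈ A, ‖a m‖ * ‖a n‖ * (√Real.pi * T *
        Real.exp (-(T * (l m - l n)) ^ 2 / 4)) := by gcongr
    _ ≤ Real.exp 1 * ∑ m ∈ A, ∑ n ∈ A, ‖a m‖ * ‖a n‖ * (√Real.pi * T *
        (Real.exp 2 * Real.exp (-|((⌊T * l m⌋ - ⌊T * l n⌋ : ℤ) : ℝ)|))) := by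
        gcongr with m _ n _
        exact hcell m n
    _ = Real.exp 1 * (√Real.pi * T * Real.exp 2 * ∑ m ∈ A, ∑ n ∈ A, ‖a m‖ * ‖a n‖ *
        Real.exp (-|((⌊T * l m⌋ - ⌊T * l n⌋ : ℤ) : ℝ)|)) := by
        simp_rw [Finset.mul_sum]
        refine Finset.sum_congr rfl fun m _ => Finset.sum_congr rfl fun n _ => ?_
        ring
    _ ≤ Real.exp 1 * (√Real.pi * T * Real.exp 2 * (K * ∑ j ∈ J, B j ^ 2)) := by
        rw [hgroup]
        gcongr
    _ = _ := by ring

/-- Mean value of Dirichlet polynomials with coefficients carrying a sieve weight. -/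
lemma exists_sum_char_integral_sq_le : ∃ C : ℝ, 0 < C ∧ ∀ (q : ℕ) [NeZero q], 3 ≤ q →
    ∀ T : ℝ, 1 ≤ T → ∀ (A : Finset ℕ) (β : ℕ → ℝ),
      (∀ n ∈ A, Real.exp (10 * Real.log (q * T)) ≤ n) →
      ∑ χ : DirichletCharacter ℂ q, ∫ v in (-(2 * T))..(2 * T), ‖∑ n ∈ A,
          ((β n * sieveB (Real.log (q * T)) n.primeFactors : ℝ) : ℂ) * χ n
            * Complex.exp (-(Real.log n * v : ℝ) * Complex.I)‖ ^ 2
        ≤ C / Real.log (q * T) * ∑ n ∈ A, n * β n ^ 2 := by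
  obtain ⟨C₁, hC₁, h1⟩ := exists_integral_expSum_sq_le
  obtain ⟨C₂, hC₂, h2⟩ := exists_sum_sieveB_sq_modEq_le
  refine ⟨C₁ * (C₂ * 4), by positivity, ?_⟩
  intro q _ hq T hT A β hA
  set ℒ := Real.log (q * T) with hℒ
  have hq3 : (3 : ℝ) ≤ q := by exact_mod_cast hq
  have hqT : 3 ≤ q * T := by nlinarith
  have hexp : Real.exp ℒ = q * T := Real.exp_log (by linarith)
  have hℒ1 : 1 ≤ ℒ := by
    rw [hℒ, Real.le_log_iff_exp_le (by linarith)]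
    linarith [Real.exp_one_lt_d9]
  have hφ : (0 : ℝ) < q.totient := by exact_mod_cast Nat.totient_pos.2 (NeZero.pos q)
  set s : ℕ → ℝ := fun n => sieveB ℒ n.primeFactors with hs
  set P : ℝ := 2 * T with hP
  have hP2 : 2 ≤ P := by linarith
  set Q : ZMod q → Finset ℕ := fun b => A.filter fun n : ℕ => (n : ZMod q) = b with hQ
  set f : ZMod q → ℝ → ℂ := fun b v => ∑ n ∈ Q b,
    ((β n * s n : ℝ) : ℂ) * Complex.exp (-(Real.log n * v : ℝ) * Complex.I) with hf
  have hfc : ∀ b, Continuous (f b) := by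
    intro b
    rw [hf]
    fun_prop
  have hsplit : ∀ (χ : DirichletCharacter ℂ q) (v : ℝ), ∑ n ∈ A, ((β n * s n : ℝ) : ℂ) * χ n
      * Complex.exp (-(Real.log n * v : ℝ) * Complex.I) = ∑ b, f b v * χ b := by
    intro χ v
    rw [← Finset.sum_fiberwise A fun n => (n : ZMod q)]
    refine Finset.sum_congr rfl fun b _ => ?_
    rw [hf]
    simp only
    rw [Finset.sum_mul]
    refine Finset.sum_congr rfl fun n hn => ?_
    rw [(Finset.mem_filter.1 hn).2]
    ring
  have hclass : ∀ b : ZMod q, IsUnit b → ∀ j : ℤ,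
      (∑ n ∈ Q b with ⌊P * Real.log (n : ℕ)⌋ = j,
        ‖((β n * s n : ℝ) : ℂ)‖) ^ 2
      ≤ C₂ * 4 / (P * (q.totient * ℒ)) *
        ∑ n ∈ Q b with ⌊P * Real.log (n : ℕ)⌋ = j, n * β n ^ 2 := by
    intro b hb j
    set D := (Q b).filter fun n : ℕ => ⌊P * Real.log n⌋ = j with hD
    rcases D.eq_empty_or_nonempty with h0 | ⟨n₀, hn₀⟩
    · rw [h0]; simp
    set E := Real.exp (j / P) with hE
    have hmem : ∀ n ∈ D, n ∈ A ∧ (n : ZMod q) = b ∧ E ≤ n ∧ (n : ℝ) < E * (1 + 2 / P) := by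
      intro n hn
      obtain ⟨hn1, hn2⟩ := Finset.mem_filter.1 hn
      obtain ⟨hn3, hn4⟩ := Finset.mem_filter.1 hn1
      have hn0 : (0 : ℝ) < n := lt_of_lt_of_le (Real.exp_pos _) (hA n hn3)
      rw [Int.floor_eq_iff] at hn2
      refine ⟨hn3, hn4, ?_, ?_⟩
      · rw [hE, ← Real.le_log_iff_exp_le hn0, div_le_iff₀ (by linarith)]
        linarith [hn2.1]
      · have e1 : Real.log n < j / P + 1 / P := by
          rw [← add_div, lt_div_iff₀ (by linarith)]
          linarith [hn2.2]
        rw [Real.log_lt_iff_lt_exp hn0, Real.exp_add] at e1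
        refine e1.trans_le ?_
        gcongr
        have e2 : 0 < 1 / P := by positivity
        have e3 : 1 / P ≤ 1 / 2 := one_div_le_one_div_of_le (by norm_num) hP2
        have e4 := Real.exp_bound_div_one_sub_of_interval e2.le (by linarith)
        refine e4.trans ?_
        rw [div_le_iff₀ (by linarith)]
        have : 2 / P = 2 * (1 / P) := by ring
        rw [this]
        nlinarith
    have hE0 : 0 < E := Real.exp_pos _
    have hElow : Real.exp (6 * ℒ) ≤ E := by
      obtain ⟨g1, g2, g3, g4⟩ := hmem n₀ hn₀
      have g5 := hA n₀ g1
      have g6 : E * (1 + 2 / P) ≤ E * 2 := by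
        gcongr
        have : 2 / P ≤ 1 := by rw [div_le_one (by linarith)]; exact hP2
        linarith
      have g7 : Real.exp (10 * ℒ) = Real.exp (4 * ℒ) * Real.exp (6 * ℒ) := by
        rw [← Real.exp_add]; ring_nf
      have g8 : 2 ≤ Real.exp (4 * ℒ) := by linarith [Real.add_one_le_exp (4 * ℒ)]
      have g9 := Real.exp_pos (6 * ℒ)
      nlinarith
    set y := ⌈E⌉₊ - 1 with hy
    set H := ⌈2 * E / P⌉₊ with hH
    have hceil : (y : ℝ) + 1 = ⌈E⌉₊ := by
      rw [hy, Nat.cast_sub (Nat.one_le_ceil_iff.2 hE0)]; push_cast; ring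
    have hy1 : (y : ℝ) < E := by
      have := Nat.ceil_lt_add_one hE0.le
      linarith
    have hy2 : E ≤ y + 1 := by rw [hceil]; exact Nat.le_ceil E
    have hqH : q * Real.exp (5 * ℒ) ≤ 2 * E / P := by
      rw [hP, mul_div_mul_left _ _ (by norm_num : (2 : ℝ) ≠ 0), le_div_iff₀ (by linarith)]
      calc _ = (q * T) * Real.exp (5 * ℒ) := by ring
        _ = Real.exp (6 * ℒ) := by rw [← hexp, ← Real.exp_add]; ring_nf
        _ ≤ E := hElow
    have hH1 : 2 * E / P ≤ H := Nat.le_ceil _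
    have hone : 1 ≤ 2 * E / P := by
      have := Real.one_le_exp (by linarith : 0 ≤ 5 * ℒ)
      nlinarith
    have hH2 : (H : ℝ) ≤ 4 * E / P := by
      have := (Nat.ceil_lt_add_one (by linarith : 0 ≤ 2 * E / P)).le
      have e : 4 * E / P = 2 * (2 * E / P) := by ring
      linarith
    have hbcop : b.val.Coprime q := by
      rw [← ZMod.isUnit_iff_coprime, ZMod.natCast_zmod_val]; exact hb
    have hsub : D ⊆ (Finset.Ioc y (y + H)).filter fun n => n ≡ b.val [MOD q] := by
      intro n hn
      obtain ⟨g1, g2, g3, g4⟩ := hmem n hn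
      rw [Finset.mem_filter, Finset.mem_Ioc]
      refine ⟨⟨?_, ?_⟩, ?_⟩
      · exact_mod_cast hy1.trans_le g3
      · have : (n : ℝ) < y + H + 1 := by
          have e : E * (1 + 2 / P) = E + 2 * E / P := by ring
          linarith
        have : n < y + H + 1 := by exact_mod_cast this
        omega
      · rw [← ZMod.natCast_eq_natCast_iff, ZMod.natCast_zmod_val, g2]
    have hsum := h2 ℒ hℒ1 q b.val y H (NeZero.pos q) hbcop (hqH.trans hH1)
    have hsum2 : ∑ n ∈ D, s n ^ 2 ≤ C₂ * (4 * E / P / (q.totient * ℒ)) := by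
      refine (Finset.sum_le_sum_of_subset_of_nonneg hsub fun _ _ _ => sq_nonneg _).trans
        (hsum.trans ?_)
      gcongr
    calc (∑ n ∈ D, ‖((β n * s n : ℝ) : ℂ)‖) ^ 2 = (∑ n ∈ D, |β n| * |s n|) ^ 2 := by
          simp_rw [Complex.norm_real, Real.norm_eq_abs, abs_mul]
      _ ≤ (∑ n ∈ D, |β n| ^ 2) * ∑ n ∈ D, |s n| ^ 2 := Finset.sum_mul_sq_le_sq_mul_sq _ _ _
      _ = (∑ n ∈ D, β n ^ 2) * ∑ n ∈ D, s n ^ 2 := by simp_rw [sq_abs]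
      _ ≤ (∑ n ∈ D, β n ^ 2) * (C₂ * (4 * E / P / (q.totient * ℒ))) := by
          gcongr
      _ = C₂ * 4 / (P * (q.totient * ℒ)) * ∑ n ∈ D, E * β n ^ 2 := by
          rw [← Finset.mul_sum]
          field_simp
      _ ≤ _ := by
          gcongr with n hn
          exact (hmem n hn).2.2.1
  have hcls : ∀ b : ZMod q, IsUnit b → ∫ v in (-P)..P, ‖f b v‖ ^ 2
      ≤ C₁ * (C₂ * 4) / (q.totient * ℒ) * ∑ n ∈ Q b, n * β n ^ 2 := by
    intro b hb
    refine (h1 (Q b) (fun n => ((β n * s n : ℝ) : ℂ))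
      (fun n => Real.log n) P (by linarith)).trans ?_
    calc _ ≤ C₁ * P * ∑ j ∈ (Q b).image
          (fun n : ℕ => ⌊P * Real.log n⌋), C₂ * 4 / (P * (q.totient * ℒ)) *
          ∑ n ∈ Q b with ⌊P * Real.log (n : ℕ)⌋ = j, n * β n ^ 2 := by
          gcongr with j hj
          exact hclass b hb j
      _ = _ := by
          rw [← Finset.mul_sum,
            Finset.sum_fiberwise_of_maps_to fun n hn => Finset.mem_image_of_mem _ hn]
          field_simp
  have hcont : ∀ b, IntervalIntegrable (fun v => ‖f b v‖ ^ 2) MeasureTheory.volume (-P) P :=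
    fun b => ((hfc b).norm.pow 2).intervalIntegrable _ _
  have hχc : ∀ χ : DirichletCharacter ℂ q, IntervalIntegrable
      (fun v => ‖∑ b, f b v * χ b‖ ^ 2) MeasureTheory.volume (-P) P := by
    intro χ
    refine Continuous.intervalIntegrable ?_ _ _
    fun_prop
  simp only [hs] at hsplit
  simp_rw [hsplit]
  rw [← intervalIntegral.integral_finsetSum fun χ _ => hχc χ]
  simp_rw [sum_char_norm_sq_eq]
  rw [intervalIntegral.integral_const_mul, intervalIntegral.integral_finsetSum fun b _ => hcont b]
  calc _ ≤ (q.totient : ℝ) * ∑ b : ZMod q with IsUnit b, C₁ * (C₂ * 4) / (q.totient * ℒ)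
        * ∑ n ∈ Q b, n * β n ^ 2 := by
        gcongr with b hb
        exact hcls b (Finset.mem_filter.1 hb).2
    _ ≤ (q.totient : ℝ) * ∑ b : ZMod q, C₁ * (C₂ * 4) / (q.totient * ℒ)
        * ∑ n ∈ Q b, n * β n ^ 2 := by
        gcongr
        exact Finset.subset_univ _
    _ = _ := by
        rw [← Finset.mul_sum, Finset.sum_fiberwise]
        field_simp

/-- Coefficients of the zero detector. -/
noncomputable def detCoeff (L : ℝ) (n : ℕ) : ℝ :=
  sieveB (10 * L) n.primeFactors * sieveB L n.primeFactors

/-- The Dirichlet polynomial which is large at zeros of `L(s, χ)`. -/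
noncomputable def detSum {q : ℕ} (χ : DirichletCharacter ℂ q) (L : ℝ) (N : ℕ) (s : ℂ) : ℂ :=
  ∑ n ∈ (Finset.Icc 1 N).filter (fun n : ℕ => Real.exp (10 * L) < n), (detCoeff L n : ℂ) * χ n * (n : ℂ) ^ (-s)

lemma differentiable_detSum {q : ℕ} (χ : DirichletCharacter ℂ q) (L : ℝ) (N : ℕ) :
    Differentiable ℂ (detSum χ L N) := by
  unfold detSum
  refine Differentiable.fun_sum fun n hn => ?_
  have hn1 : (n : ℂ) ≠ 0 := by
    have := (Finset.mem_Icc.1 (Finset.mem_filter.1 hn).1).1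
    exact_mod_cast (by omega : n ≠ 0)
  refine Differentiable.const_mul ?_ _
  exact fun s => (differentiableAt_id.neg).const_cpow (Or.inl hn1)

lemma exists_sum_char_integral_detSum_le (B : ℝ) (hB : 0 < B) : ∃ C : ℝ, 0 < C ∧
    ∀ (q : ℕ) [NeZero q], 3 ≤ q → ∀ T : ℝ, 1 ≤ T → ∀ (N : ℕ) (r x : ℝ),
      Real.log N ≤ B * Real.log (q * T) → 0 ≤ r → 1 - 2 * r ≤ x →
      ∑ χ : DirichletCharacter ℂ q, ∫ v in (-(2 * T))..(2 * T),
          ‖detSum χ (Real.log (q * T)) N (x + v * Complex.I)‖ ^ 2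
        ≤ C / Real.log (q * T) * Real.exp (4 * B * (r * Real.log (q * T))) := by
  obtain ⟨C₁, hC₁, h1⟩ := exists_sum_char_integral_sq_le
  obtain ⟨C₂, hC₂, h2⟩ := exists_sum_sieveB_sq_div_le B hB
  refine ⟨C₁ * C₂, by positivity, ?_⟩
  intro q _ hq T hT N r x hN hr hx
  set ℒ := Real.log (q * T) with hℒ
  have hq3 : (3 : ℝ) ≤ q := by exact_mod_cast hq
  have hqT : 3 ≤ q * T := by nlinarith
  have hℒ0 : 0 < ℒ := Real.log_pos (by linarith)
  set A := (Finset.Icc 1 N).filter fun n : ℕ => Real.exp (10 * ℒ) < n with hA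
  set β : ℕ → ℝ := fun n => sieveB (10 * ℒ) n.primeFactors * (n : ℝ) ^ (-x) with hβ
  have hA1 : ∀ n ∈ A, 1 ≤ n ∧ n ≤ N := fun n hn => Finset.mem_Icc.1 (Finset.mem_filter.1 hn).1
  have key : ∀ (χ : DirichletCharacter ℂ q) (v : ℝ), detSum χ ℒ N (x + v * Complex.I)
      = ∑ n ∈ A, ((β n * sieveB ℒ n.primeFactors : ℝ) : ℂ) * χ n
            * Complex.exp (-(Real.log n * v : ℝ) * Complex.I) := by
    intro χ v
    rw [detSum]
    refine Finset.sum_congr rfl fun n hn => ?_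
    have hn0 : (n : ℂ) ≠ 0 := by
      have := (hA1 n hn).1
      exact_mod_cast (by omega : n ≠ 0)
    have e1 : (n : ℂ) ^ (-(x + v * Complex.I)) = (((n : ℝ) ^ (-x) : ℝ) : ℂ)
        * Complex.exp (-(Real.log n * v : ℝ) * Complex.I) := by
      rw [neg_add, Complex.cpow_add _ _ hn0, Complex.ofReal_cpow (Nat.cast_nonneg n)]
      congr 1
      · push_cast; rfl
      · rw [Complex.cpow_def_of_ne_zero hn0, ← Complex.ofReal_natCast, ← Complex.ofReal_log
          (Nat.cast_nonneg n)]
        congr 1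
        push_cast
        ring
    rw [e1, detCoeff, hβ]
    push_cast
    ring
  simp_rw [key]
  refine (h1 q hq T hT A β fun n hn => (Finset.mem_filter.1 hn).2.le).trans ?_
  have hb : ∑ n ∈ A, n * β n ^ 2 ≤ C₂ * Real.exp (4 * B * (r * ℒ)) := by
    have hterm : ∀ n ∈ A, n * β n ^ 2 ≤ Real.exp (4 * B * (r * ℒ)) *
        (1 / (n : ℝ) * sieveB (10 * ℒ) n.primeFactors ^ 2) := by
      intro n hn
      obtain ⟨g1, g2⟩ := hA1 n hn
      have hn1 : (1 : ℝ) ≤ n := by exact_mod_cast g1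
      have hn0 : (0 : ℝ) < n := by linarith
      have e1 : (n : ℝ) * ((n : ℝ) ^ (-x)) ^ 2 ≤ Real.exp (4 * B * (r * ℒ)) * (1 / n) := by
        have e2 : (n : ℝ) * ((n : ℝ) ^ (-x)) ^ 2 = Real.exp (Real.log n * (2 - 2 * x)) * (1 / n) := by
          rw [Real.rpow_def_of_pos hn0, ← Real.exp_nat_mul]
          nth_rewrite 1 [← Real.exp_log hn0]
          nth_rewrite 4 [← Real.exp_log hn0]
          rw [one_div, ← Real.exp_neg, ← Real.exp_add, ← Real.exp_add]
          congr 1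
          push_cast
          ring
        rw [e2]
        have e3 : Real.log n ≤ B * ℒ := (Real.log_le_log hn0 (by exact_mod_cast g2)).trans hN
        have e4 : 0 ≤ Real.log n := Real.log_nonneg hn1
        refine mul_le_mul_of_nonneg_right (Real.exp_le_exp.2 ?_) (by positivity)
        have e5 : Real.log n * (2 - 2 * x) ≤ Real.log n * (4 * r) :=
          mul_le_mul_of_nonneg_left (by linarith) e4
        have e6 : Real.log n * (4 * r) ≤ B * ℒ * (4 * r) :=
          mul_le_mul_of_nonneg_right e3 (by positivity)
        linarith
      rw [hβ]
      simp only
      rw [mul_pow]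
      nlinarith [sq_nonneg (sieveB (10 * ℒ) n.primeFactors)]
    refine (Finset.sum_le_sum hterm).trans ?_
    rw [← Finset.mul_sum, mul_comm]
    gcongr
    refine (Finset.sum_le_sum_of_subset_of_nonneg (Finset.filter_subset _ _)
      fun n _ _ => by positivity).trans (h2 (10 * ℒ) (by linarith) N ?_)
    nlinarith
  calc _ ≤ C₁ / ℒ * (C₂ * Real.exp (4 * B * (r * ℒ))) := by gcongr
    _ = _ := by ring

lemma sum_Icc_filter_dvd {M : Type*} [AddCommMonoid M] (f : ℕ → M) (N : ℕ) {d : ℕ} (hd : 0 < d) :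
    ∑ n ∈ (Finset.Icc 1 N).filter (fun n => d ∣ n), f n = ∑ k ∈ Finset.Icc 1 (N / d), f (d * k) := by
  symm
  refine Finset.sum_bij (fun k _ => d * k) ?_ ?_ ?_ ?_
  · intro k hk
    obtain ⟨h1, h2⟩ := Finset.mem_Icc.1 hk
    refine Finset.mem_filter.2 ⟨Finset.mem_Icc.2 ⟨Nat.mul_pos hd h1, ?_⟩, dvd_mul_right _ _⟩
    rw [mul_comm]
    exact (Nat.le_div_iff_mul_le hd).1 h2
  · intro a _ b _ h
    exact Nat.eq_of_mul_eq_mul_left hd h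
  · intro n hn
    obtain ⟨h1, k, rfl⟩ := Finset.mem_filter.1 hn
    obtain ⟨h2, h3⟩ := Finset.mem_Icc.1 h1
    refine ⟨k, Finset.mem_Icc.2 ⟨Nat.pos_of_mul_pos_left h2, ?_⟩, rfl⟩
    rw [Nat.le_div_iff_mul_le hd, mul_comm]
    exact h3
  · intro k _
    rfl

lemma norm_sum_filter_dvd_sub_le {q : ℕ} [NeZero q] (χ : DirichletCharacter ℂ q) {s : ℂ}
    (hs : 0 < s.re) (hs1 : s ≠ 1) (h0 : χ.LFunction s = 0) {d : ℕ} (hd : 0 < d) {y : ℝ}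
    (hy : d ≤ y) :
    ‖∑ n ∈ (Finset.Icc 1 ⌊y⌋₊).filter (fun n => d ∣ n), χ n * (n : ℂ) ^ (-s)
      - χ d / d * ((∑ j, χ j) / q / (1 - s)) * (y : ℂ) ^ (1 - s)‖
      ≤ 3 * q * (1 + ‖s‖ / s.re) * y ^ (-s.re) := by
  have hd0 : (0 : ℝ) < d := by exact_mod_cast hd
  have hdc : (d : ℂ) ≠ 0 := by exact_mod_cast hd.ne'
  have hy0 : 0 < y := hd0.trans_le hy
  have hyd : 1 ≤ y / d := (one_le_div hd0).2 hy
  have h := norm_partialSum_sub_LFunction_le (fun j => χ j) (B := 1) (fun j => χ.norm_le_one j)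
    hyd hs hs1
  rw [sum_Icc_filter_dvd _ _ hd, ← Nat.floor_div_natCast]
  have e0 : ZMod.LFunction (fun j => χ j) s = 0 := h0
  rw [e0, sub_zero] at h
  have e1 : ∑ k ∈ Finset.Icc 1 ⌊y / d⌋₊, χ ((d * k : ℕ) : ZMod q) * ((d * k : ℕ) : ℂ) ^ (-s)
      = χ d * (d : ℂ) ^ (-s) * ∑ k ∈ Finset.Icc 1 ⌊y / d⌋₊, χ k * (k : ℂ) ^ (-s) := by
    rw [Finset.mul_sum]
    refine Finset.sum_congr rfl fun k _ => ?_
    rw [Nat.cast_mul, map_mul, Nat.cast_mul, Complex.natCast_mul_natCast_cpow]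
    ring
  have e2 : χ d / d * ((∑ j, χ j) / q / (1 - s)) * (y : ℂ) ^ (1 - s) = χ d * (d : ℂ) ^ (-s) *
      ((∑ j, χ j) / q * ((y / d : ℝ) : ℂ) ^ (1 - s) / (1 - s)) := by
    have e3 : (y : ℂ) ^ (1 - s) = (d : ℂ) ^ (1 - s) * ((y / d : ℝ) : ℂ) ^ (1 - s) := by
      have : (d : ℂ) = ((d : ℝ) : ℂ) := by simp
      rw [this, ← Complex.mul_cpow_ofReal_nonneg hd0.le (by positivity), ← Complex.ofReal_mul,
        mul_div_cancel₀ _ hd0.ne']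
    have e4 : (d : ℂ) ^ (1 - s) = d * (d : ℂ) ^ (-s) := by
      rw [sub_eq_add_neg, Complex.cpow_add _ _ hdc, Complex.cpow_one]
    rw [e3, e4]
    field_simp
  rw [e1, e2, ← mul_sub, norm_mul]
  have e5 : ‖χ d * (d : ℂ) ^ (-s)‖ ≤ (d : ℝ) ^ (-s.re) := by
    rw [norm_mul, Complex.norm_natCast_cpow_of_pos hd, Complex.neg_re]
    exact mul_le_of_le_one_left (by positivity) (χ.norm_le_one _)
  refine (mul_le_mul e5 h (norm_nonneg _) (by positivity)).trans (le_of_eq ?_)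
  rw [Real.div_rpow hy0.le hd0.le]
  have : (d : ℝ) ^ (-s.re) ≠ 0 := by positivity
  field_simp

lemma detCoeff_mul_char_eq {q : ℕ} (χ : DirichletCharacter ℂ q) {L : ℝ} (hL : 0 < L) {n : ℕ}
    (hn : n ≠ 0) : (detCoeff L n : ℂ) * χ n = ∑ x ∈ sieveIndex q (10 * L) ×ˢ sieveIndex q L,
      if ∏ p ∈ x.1 ∪ x.2, p ∣ n then
        ((sieveTheta (10 * L) x.1 * sieveTheta L x.2 : ℝ) : ℂ) * χ n else 0 := by
  by_cases hq : n.Coprime q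
  · rw [detCoeff, sieveB_primeFactors_eq (by linarith : 0 < 10 * L) hq,
      sieveB_primeFactors_eq hL hq, Finset.sum_mul_sum, ← Finset.sum_product']
    rw [Complex.ofReal_sum, Finset.sum_mul]
    refine Finset.sum_congr rfl fun x hx => ?_
    obtain ⟨h1, h2⟩ := Finset.mem_product.1 hx
    have hp : ∀ p ∈ x.1 ∪ x.2, p.Prime := by
      intro p hp
      rcases Finset.mem_union.1 hp with h | h
      · exact prime_of_mem_sieveIndex h1 p h
      · exact prime_of_mem_sieveIndex h2 p h
    simp only [prod_dvd_iff_subset_primeFactors hp hn, Finset.union_subset_iff]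
    split_ifs <;> simp_all
  · have : χ n = 0 := χ.map_nonunit (by rwa [ZMod.isUnit_iff_coprime])
    simp [this]

lemma sum_detCoeff_eq {q : ℕ} (χ : DirichletCharacter ℂ q) {L : ℝ} (hL : 0 < L) (N : ℕ) (s : ℂ) :
    ∑ n ∈ Finset.Icc 1 N, (detCoeff L n : ℂ) * χ n * (n : ℂ) ^ (-s)
      = ∑ x ∈ sieveIndex q (10 * L) ×ˢ sieveIndex q L,
        ((sieveTheta (10 * L) x.1 * sieveTheta L x.2 : ℝ) : ℂ) *
        ∑ n ∈ (Finset.Icc 1 N).filter (fun n => ∏ p ∈ x.1 ∪ x.2, p ∣ n), χ n * (n : ℂ) ^ (-s) := by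
  have h : ∀ n ∈ Finset.Icc 1 N, (detCoeff L n : ℂ) * χ n * (n : ℂ) ^ (-s) =
      ∑ x ∈ sieveIndex q (10 * L) ×ˢ sieveIndex q L, if ∏ p ∈ x.1 ∪ x.2, p ∣ n then
        ((sieveTheta (10 * L) x.1 * sieveTheta L x.2 : ℝ) : ℂ) * (χ n * (n : ℂ) ^ (-s)) else 0 := by
    intro n hn
    have hn0 : n ≠ 0 := by have := (Finset.mem_Icc.1 hn).1; omega
    rw [detCoeff_mul_char_eq χ hL hn0, Finset.sum_mul]
    refine Finset.sum_congr rfl fun x _ => ?_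
    split_ifs
    · ring
    · ring
  rw [Finset.sum_congr rfl h, Finset.sum_comm]
  refine Finset.sum_congr rfl fun x _ => ?_
  rw [Finset.mul_sum, ← Finset.sum_filter]

lemma one_add_detSum_eq {q : ℕ} (χ : DirichletCharacter ℂ q) {L : ℝ} (hL : 0 < L) {N : ℕ}
    (hN : 1 ≤ N) (s : ℂ) :
    1 + detSum χ L N s = ∑ n ∈ Finset.Icc 1 N, (detCoeff L n : ℂ) * χ n * (n : ℂ) ^ (-s) := by
  rw [← Finset.sum_filter_add_sum_filter_not (Finset.Icc 1 N)
    (fun n : ℕ => Real.exp (10 * L) < n), add_comm, detSum]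
  congr 1
  symm
  rw [Finset.sum_eq_single_of_mem 1]
  · simp [detCoeff, sieveB_empty]
  · refine Finset.mem_filter.2 ⟨Finset.mem_Icc.2 ⟨le_rfl, hN⟩, ?_⟩
    rw [not_lt, Nat.cast_one]
    exact Real.one_le_exp (by linarith)
  · intro n hn hn1
    obtain ⟨h1, h2⟩ := Finset.mem_filter.1 hn
    have h3 := (Finset.mem_Icc.1 h1).1
    have : detCoeff L n = 0 := by
      rw [detCoeff, sieveB_eq_zero (by linarith), zero_mul]
      · exact fun p hp => (Nat.prime_of_mem_primeFactors hp).one_le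
      · rw [Nat.nonempty_primeFactors]; omega
      · refine le_trans ?_ (not_lt.1 h2)
        rw [← Nat.cast_prod]
        exact_mod_cast Nat.le_of_dvd h3 (Nat.prod_primeFactors_dvd n)
    simp [this]

/-- Near a zero of `L(s, χ)` the detecting polynomial is close to `-1`, up to the contribution of
the pole. -/
lemma exists_norm_one_add_detSum_sub_le {q : ℕ} [NeZero q] (hq : 3 ≤ q)
    (χ : DirichletCharacter ℂ q) {T : ℝ} (hT : 1 ≤ T) {ρ : ℂ} (h0 : χ.LFunction ρ = 0)
    (h1 : 1 / 2 ≤ ρ.re) (h2 : ρ.re < 1) (h3 : |ρ.im| ≤ T) :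
    ∃ κ : ℂ, (χ ≠ 1 → κ = 0) ∧ ∀ y : ℝ, Real.exp (60 * Real.log (q * T)) ≤ y →
      ‖1 + detSum χ (Real.log (q * T)) ⌊y⌋₊ ρ - κ * (y : ℂ) ^ (1 - ρ)‖ ≤ 1 / 10 := by
  set ℒ := Real.log (q * T) with hℒ
  have hq3 : (3 : ℝ) ≤ q := by exact_mod_cast hq
  have hqT : 3 ≤ q * T := by nlinarith
  have hℒ0 : 0 < ℒ := Real.log_pos (by linarith)
  have hexp : Real.exp ℒ = q * T := Real.exp_log (by linarith)
  have hρ1 : ρ ≠ 1 := by rintro rfl; simp at h2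
  set I := sieveIndex q (10 * ℒ) ×ˢ sieveIndex q ℒ with hI
  set θ : Finset ℕ × Finset ℕ → ℂ :=
    fun x => ((sieveTheta (10 * ℒ) x.1 * sieveTheta ℒ x.2 : ℝ) : ℂ) with hθ
  set d : Finset ℕ × Finset ℕ → ℕ := fun x => ∏ p ∈ x.1 ∪ x.2, p with hd
  have hθ1 : ∀ x, ‖θ x‖ ≤ 1 := by
    intro x
    rw [hθ]
    simp only
    rw [Complex.norm_real, norm_mul]
    exact mul_le_one₀ (abs_sieveTheta_le_one _ _) (norm_nonneg _) (abs_sieveTheta_le_one _ _)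
  have hd0 : ∀ x ∈ I, 0 < d x := by
    intro x hx
    obtain ⟨g1, g2⟩ := Finset.mem_product.1 hx
    refine Finset.prod_pos fun p hp => ?_
    rcases Finset.mem_union.1 hp with h | h
    · exact (prime_of_mem_sieveIndex g1 p h).pos
    · exact (prime_of_mem_sieveIndex g2 p h).pos
  have hd1 : ∀ x ∈ I, (d x : ℝ) ≤ Real.exp (22 * ℒ) := by
    intro x hx
    obtain ⟨g1, g2⟩ := Finset.mem_product.1 hx
    have e1 : d x ≤ (∏ p ∈ x.1, p) * ∏ p ∈ x.2, p := by
      rw [← Finset.prod_union_inter]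
      refine Nat.le_mul_of_pos_right _ (Finset.prod_pos fun p hp => ?_)
      exact (prime_of_mem_sieveIndex g1 p (Finset.mem_inter.1 hp).1).pos
    have e2 : (d x : ℝ) ≤ (∏ p ∈ x.1, (p : ℝ)) * ∏ p ∈ x.2, (p : ℝ) := by
      refine ((Nat.cast_le (α := ℝ)).2 e1).trans_eq ?_
      push_cast
      rfl
    refine e2.trans ?_
    rw [show 22 * ℒ = 2 * (10 * ℒ) + 2 * ℒ by ring, Real.exp_add]
    exact mul_le_mul (Finset.mem_filter.1 g1).2.le (Finset.mem_filter.1 g2).2.le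
      (Finset.prod_nonneg fun p _ => Nat.cast_nonneg p) (Real.exp_pos _).le
  have hcard : (I.card : ℝ) ≤ Real.exp (22 * ℒ) := by
    rw [hI, Finset.card_product, show 22 * ℒ = 2 * (10 * ℒ) + 2 * ℒ by ring, Real.exp_add,
      Nat.cast_mul]
    exact mul_le_mul (card_sieveIndex_le _ _) (card_sieveIndex_le _ _) (Nat.cast_nonneg _)
      (Real.exp_pos _).le
  refine ⟨∑ x ∈ I, θ x * (χ (d x) / d x * ((∑ j, χ j) / q / (1 - ρ))), ?_, ?_⟩
  · intro hχ
    rw [MulChar.sum_eq_zero_of_ne_one hχ]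
    simp
  intro y hy
  have hy1 : 1 ≤ y := (Real.one_le_exp (by linarith)).trans hy
  have hy0 : 0 < y := by linarith
  rw [one_add_detSum_eq χ hℒ0 (Nat.one_le_floor_iff y |>.2 hy1), sum_detCoeff_eq χ hℒ0,
    Finset.sum_mul, ← Finset.sum_sub_distrib]
  set E := 3 * q * (1 + ‖ρ‖ / ρ.re) * y ^ (-ρ.re) with hE
  have hterm : ∀ x ∈ I, ‖θ x * ∑ n ∈ (Finset.Icc 1 ⌊y⌋₊).filter (fun n => d x ∣ n),
      χ n * (n : ℂ) ^ (-ρ) - θ x * (χ (d x) / d x * ((∑ j, χ j) / q / (1 - ρ)))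
        * (y : ℂ) ^ (1 - ρ)‖ ≤ E := by
    intro x hx
    rw [mul_assoc, ← mul_sub, norm_mul]
    have hdy : (d x : ℝ) ≤ y :=
      (hd1 x hx).trans ((Real.exp_le_exp.2 (by linarith)).trans hy)
    have := norm_sum_filter_dvd_sub_le χ (by linarith) hρ1 h0 (hd0 x hx) hdy
    exact (mul_le_of_le_one_left (norm_nonneg _) (hθ1 x)).trans this
  refine (norm_sum_le _ _).trans ((Finset.sum_le_sum hterm).trans ?_)
  rw [Finset.sum_const, nsmul_eq_mul]
  have hnorm : ‖ρ‖ ≤ 1 + T := by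
    refine (Complex.norm_le_abs_re_add_abs_im ρ).trans ?_
    rw [abs_of_nonneg (by linarith : 0 ≤ ρ.re)]
    linarith
  have hdiv : ‖ρ‖ / ρ.re ≤ 4 * T := by
    rw [div_le_iff₀ (by linarith)]
    nlinarith
  have hypow : y ^ (-ρ.re) ≤ Real.exp (-(30 * ℒ)) := by
    have e1 : y ^ (-ρ.re) ≤ y ^ (-(1 / 2) : ℝ) := Real.rpow_le_rpow_of_exponent_le hy1 (by linarith)
    have e2 : y ^ (-(1 / 2) : ℝ) ≤ (Real.exp (60 * ℒ)) ^ (-(1 / 2) : ℝ) :=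
      Real.rpow_le_rpow_of_nonpos (Real.exp_pos _) hy (by norm_num)
    rw [← Real.exp_mul] at e2
    refine e1.trans (e2.trans (le_of_eq ?_))
    congr 1; ring
  have hE1 : E ≤ 15 * Real.exp ℒ * Real.exp (-(30 * ℒ)) := by
    rw [hE, hexp]
    refine mul_le_mul ?_ hypow (by positivity) (by positivity)
    nlinarith
  have hE0 : 0 ≤ E := by
    have : 0 < ρ.re := by linarith
    positivity
  calc (I.card : ℝ) * E ≤ Real.exp (22 * ℒ) * (15 * Real.exp ℒ * Real.exp (-(30 * ℒ))) :=
        mul_le_mul hcard hE1 hE0 (Real.exp_pos _).le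
    _ = 15 * Real.exp (-(7 * ℒ)) := by
        rw [show -(7 * ℒ) = 22 * ℒ + ℒ + -(30 * ℒ) by ring, Real.exp_add, Real.exp_add]; ring
    _ ≤ 1 / 10 := by
        have e1 : Real.exp (7 * ℒ) = (q * T) ^ 7 := by
          rw [← hexp, ← Real.exp_nat_mul]; norm_num
        rw [Real.exp_neg, e1]
        have e2 : (3 : ℝ) ^ 7 ≤ (q * T) ^ 7 := by gcongr
        rw [← div_eq_mul_inv, div_le_iff₀ (by positivity)]
        norm_num at e2 ⊢
        linarith

lemma intervalIntegrable_comp_floor_exp (G : ℕ → ℝ) (c a b : ℝ) :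
    IntervalIntegrable (fun h => G ⌊Real.exp (c + h)⌋₊) MeasureTheory.volume a b := by
  have hmeas : Measurable fun h : ℝ => G ⌊Real.exp (c + h)⌋₊ :=
    (measurable_from_nat (f := G)).comp (Nat.measurable_floor.comp (by fun_prop))
  set M := ∑ n ∈ Finset.range (⌊Real.exp (c + max a b)⌋₊ + 1), |G n| with hM
  refine (intervalIntegrable_const (c := M)).mono_fun hmeas.aestronglyMeasurable ?_
  filter_upwards [MeasureTheory.ae_restrict_mem measurableSet_uIoc] with h hh
  have hh1 : h ≤ max a b := hh.2
  have hM0 : 0 ≤ M := Finset.sum_nonneg fun n _ => abs_nonneg _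
  rw [Real.norm_eq_abs, Real.norm_eq_abs, abs_of_nonneg hM0]
  refine Finset.single_le_sum (f := fun n => |G n|) (fun n _ => abs_nonneg _) ?_
  rw [Finset.mem_range, Nat.lt_succ_iff]
  exact Nat.floor_mono (Real.exp_le_exp.2 (by linarith))

lemma sq_add_sq_ge_of_approx {a b w : ℂ} {μ : ℝ} (hμ : 0 ≤ μ) (ha : ‖1 + a + μ * w‖ ≤ 1 / 10)
    (hb : ‖1 + b - w‖ ≤ 1 / 10) : 81 / 100 ≤ ‖a‖ ^ 2 + ‖b‖ ^ 2 := by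
  have h1 : ((1 + μ : ℝ) : ℂ) = (1 + a + μ * w) + μ * (1 + b - w) - (a + μ * b) := by
    push_cast; ring
  have h2 : 1 + μ ≤ 1 / 10 + μ * (1 / 10) + (‖a‖ + μ * ‖b‖) := by
    calc 1 + μ = ‖((1 + μ : ℝ) : ℂ)‖ := by
          rw [Complex.norm_real, Real.norm_of_nonneg (by linarith)]
      _ ≤ ‖(1 + a + μ * w) + μ * (1 + b - w)‖ + ‖a + μ * b‖ := by rw [h1]; exact norm_sub_le _ _
      _ ≤ (‖1 + a + μ * w‖ + ‖μ * (1 + b - w)‖) + (‖a‖ + ‖μ * b‖) := by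
          gcongr <;> exact norm_add_le _ _
      _ ≤ _ := by
          rw [norm_mul, norm_mul, Complex.norm_real, Real.norm_of_nonneg hμ]
          gcongr
  by_contra! h
  have ha1 : ‖a‖ < 9 / 10 := by nlinarith [norm_nonneg a, sq_nonneg ‖b‖]
  have hb1 : ‖b‖ < 9 / 10 := by nlinarith [norm_nonneg b, sq_nonneg ‖a‖]
  nlinarith

/-- Near a zero of `L(s, χ)` the detecting polynomial is large for most lengths. -/
lemma integral_detSum_ge {g : ℝ} (hg : 0 < g) {q : ℕ} [NeZero q] (hq : 3 ≤ q)
    (χ : DirichletCharacter ℂ q) {T : ℝ} (hT : 1 ≤ T) {ρ : ℂ} (h0 : χ.LFunction ρ = 0)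
    (h1 : 1 / 2 ≤ ρ.re) (h2 : ρ.re < 1) (h3 : |ρ.im| ≤ T) (h4 : χ = 1 → g ≤ |ρ.im|) :
    2 / 5 * (Real.pi / g) ≤ ∫ h in (0 : ℝ)..(2 * (Real.pi / g)),
      ‖detSum χ (Real.log (q * T)) ⌊Real.exp (60 * Real.log (q * T) + h)⌋₊ ρ‖ ^ 2 := by
  obtain ⟨κ, hκ, happ⟩ := exists_norm_one_add_detSum_sub_le hq χ hT h0 h1 h2 h3
  set ℒ := Real.log (q * T) with hℒ
  set H := Real.pi / g with hH
  have hH0 : 0 < H := div_pos Real.pi_pos hg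
  set S : ℝ → ℝ := fun h => ‖detSum χ ℒ ⌊Real.exp (60 * ℒ + h)⌋₊ ρ‖ ^ 2 with hS
  have hS0 : ∀ h, 0 ≤ S h := fun h => sq_nonneg _
  have hInt : ∀ a b, IntervalIntegrable S MeasureTheory.volume a b := fun a b =>
    intervalIntegrable_comp_floor_exp (fun N => ‖detSum χ ℒ N ρ‖ ^ 2) (60 * ℒ) a b
  have happ' : ∀ h : ℝ, 0 ≤ h → ‖1 + detSum χ ℒ ⌊Real.exp (60 * ℒ + h)⌋₊ ρ
      - κ * Complex.exp ((60 * ℒ + h) * (1 - ρ))‖ ≤ 1 / 10 := by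
    intro h hh
    have := happ (Real.exp (60 * ℒ + h)) (Real.exp_le_exp.2 (by linarith))
    rwa [Complex.ofReal_exp, Complex.cpow_def_of_ne_zero (Complex.exp_ne_zero _),
      ← Complex.ofReal_exp, ← Complex.ofReal_log (Real.exp_pos _).le, Real.log_exp,
      Complex.ofReal_add, Complex.ofReal_mul, Complex.ofReal_ofNat] at this
  obtain ⟨p, hp0, hpH, hp⟩ : ∃ p, 0 ≤ p ∧ p ≤ H ∧ ∀ h, 0 ≤ h → 81 / 100 ≤ S (h + p) + S h := by
    by_cases hχ : χ = 1
    · have hγ := h4 hχ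
      have hγ0 : 0 < |ρ.im| := hg.trans_le hγ
      refine ⟨Real.pi / |ρ.im|, by positivity, ?_, fun h hh => ?_⟩
      · rw [hH]; gcongr
      · set p := Real.pi / |ρ.im| with hp
        have hp0 : 0 ≤ p := by positivity
        have e1 : Complex.exp (p * (1 - ρ)) = -(Real.exp (p * (1 - ρ.re)) : ℝ) := by
          have e2 : (p : ℂ) * (1 - ρ) = ((p * (1 - ρ.re) : ℝ) : ℂ) + -((p * ρ.im : ℝ) * Complex.I) := by
            apply Complex.ext <;> simp
          rw [e2, Complex.exp_add, ← Complex.ofReal_exp]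
          have e3 : Complex.exp (-((p * ρ.im : ℝ) * Complex.I)) = -1 := by
            rcases abs_cases ρ.im with ⟨e, _⟩ | ⟨e, _⟩
            · have : p * ρ.im = Real.pi := by
                rw [hp, e]; rw [e] at hγ0; field_simp
              rw [this, Complex.exp_neg, Complex.exp_pi_mul_I]; norm_num
            · have : p * ρ.im = -Real.pi := by
                have e5 : ρ.im ≠ 0 := by rw [e] at hγ0; linarith
                rw [hp, e]; field_simp
              rw [this]; push_cast
              rw [neg_mul, neg_neg, Complex.exp_pi_mul_I]
          rw [e3]; ring
        have ha := happ' (h + p) (by positivity)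
        have hb := happ' h hh
        refine sq_add_sq_ge_of_approx (μ := Real.exp (p * (1 - ρ.re))) (Real.exp_pos _).le ?_ hb
        convert ha using 2
        rw [show (60 * (ℒ : ℂ) + ((h + p : ℝ) : ℂ)) * (1 - ρ)
          = (60 * ℒ + h) * (1 - ρ) + p * (1 - ρ) by push_cast; ring, Complex.exp_add, e1]
        ring
    · refine ⟨0, le_rfl, hH0.le, fun h hh => ?_⟩
      have := happ' h hh
      rw [hκ hχ, zero_mul] at this
      exact sq_add_sq_ge_of_approx (μ := 1) (w := 0) zero_le_one (by simpa using this)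
        (by simpa using this)
  have hInt2 : ∀ a b, IntervalIntegrable (fun h => S (h + p)) MeasureTheory.volume a b :=
    fun a b => by simpa using (hInt (a + p) (b + p)).comp_add_right p
  have k1 : ∫ h in (0 : ℝ)..H, (S (h + p) + S h) = (∫ h in p..(H + p), S h) + ∫ h in (0 : ℝ)..H, S h := by
    rw [intervalIntegral.integral_add (hInt2 _ _) (hInt _ _),
      intervalIntegral.integral_comp_add_right, zero_add]
  have k2 : 81 / 100 * H ≤ ∫ h in (0 : ℝ)..H, (S (h + p) + S h) := by
    have := intervalIntegral.integral_mono_on (a := 0) (b := H) (μ := MeasureTheory.volume)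
      (f := fun _ => (81 / 100 : ℝ)) (g := fun h => S (h + p) + S h) hH0.le intervalIntegrable_const
      ((hInt2 _ _).add (hInt _ _)) fun h hh => hp h hh.1
    simp only [intervalIntegral.integral_const, smul_eq_mul] at this
    linarith
  have k3 : ∫ h in p..(H + p), S h ≤ ∫ h in (0 : ℝ)..(2 * H), S h :=
    intervalIntegral.integral_mono_interval hp0 (by linarith) (by linarith)
      (Filter.Eventually.of_forall hS0) (hInt _ _)
  have k4 : ∫ h in (0 : ℝ)..H, S h ≤ ∫ h in (0 : ℝ)..(2 * H), S h :=
    intervalIntegral.integral_mono_interval le_rfl hH0.le (by linarith)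
      (Filter.Eventually.of_forall hS0) (hInt _ _)
  change _ ≤ ∫ h in (0 : ℝ)..(2 * H), S h
  linarith

lemma two_pi_mul_norm_sq_le {F : ℂ → ℂ} (hF : Differentiable ℂ F) (c : ℂ) (R : ℝ) :
    2 * Real.pi * ‖F c‖ ^ 2 ≤ ∫ θ in (-Real.pi)..Real.pi, ‖F (circleMap c R θ)‖ ^ 2 := by
  have h1 : Real.circleAverage (fun z => F z ^ 2) c R = F c ^ 2 :=
    DiffContOnCl.circleAverage (f := fun z => F z ^ 2) (by fun_prop : Differentiable ℂ fun z => F z ^ 2).diffContOnCl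
  rw [Real.circleAverage_eq_integral_add (-Real.pi), intervalIntegral.integral_comp_add_right
    (fun θ => F (circleMap c R θ) ^ 2)] at h1
  rw [show (0 : ℝ) + -Real.pi = -Real.pi by ring, show 2 * Real.pi + -Real.pi = Real.pi by ring] at h1
  have h2 := intervalIntegral.norm_integral_le_integral_norm (μ := MeasureTheory.volume)
    (f := fun θ => F (circleMap c R θ) ^ 2) (by linarith [Real.pi_pos] : -Real.pi ≤ Real.pi)
  have h3 : ‖F c‖ ^ 2 = (2 * Real.pi)⁻¹ *
      ‖∫ θ in (-Real.pi)..Real.pi, F (circleMap c R θ) ^ 2‖ := by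
    rw [← norm_pow, ← h1, norm_smul, Real.norm_of_nonneg (by positivity)]
  simp_rw [norm_pow] at h2
  rw [h3, ← mul_assoc, mul_inv_cancel₀ (by positivity), one_mul]
  exact h2

open MeasureTheory in
/-- The sub-mean value property of `‖F‖ ^ 2` over discs. -/
lemma ofReal_norm_sq_le_lintegral_ball {F : ℂ → ℂ} (hF : Differentiable ℂ F) (c : ℂ) {r : ℝ}
    (hr : 0 < r) : ENNReal.ofReal (Real.pi * r ^ 2 * ‖F c‖ ^ 2) ≤
      ∫⁻ z in Metric.ball c r, ENNReal.ofReal (‖F z‖ ^ 2) := by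
  set f : ℂ → ENNReal := fun z => ENNReal.ofReal (‖F z‖ ^ 2) with hf
  have hfc : Measurable f := by
    have := hF.continuous
    exact (by fun_prop : Continuous fun z => ‖F z‖ ^ 2).measurable.ennreal_ofReal
  have e1 : ∫⁻ z in Metric.ball c r, f z = ∫⁻ z, (Metric.ball c r).indicator f (c + z) := by
    rw [lintegral_add_left_eq_self, lintegral_indicator Metric.isOpen_ball.measurableSet]
  rw [e1, ← Complex.lintegral_comp_polarCoord_symm]
  have hsub : Set.Ioo 0 r ×ˢ Set.Ioo (-Real.pi) Real.pi ⊆ polarCoord.target := by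
    rw [polarCoord_target]
    exact Set.prod_mono Set.Ioo_subset_Ioi_self subset_rfl
  refine le_trans ?_ (lintegral_mono_set hsub)
  have e2 : ∫⁻ p in Set.Ioo 0 r ×ˢ Set.Ioo (-Real.pi) Real.pi, ENNReal.ofReal p.1 •
        (Metric.ball c r).indicator f (c + Complex.polarCoord.symm p) =
      ∫⁻ p in Set.Ioo 0 r ×ˢ Set.Ioo (-Real.pi) Real.pi,
        ENNReal.ofReal p.1 * f (circleMap c p.1 p.2) := by
    refine setLIntegral_congr_fun (measurableSet_Ioo.prod measurableSet_Ioo) fun p hp => ?_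
    have hp1 := hp.1
    have e3 : c + Complex.polarCoord.symm p = circleMap c p.1 p.2 := by
      rw [Complex.polarCoord_symm_apply, circleMap, Complex.exp_mul_I]
      push_cast; rfl
    have e4 : circleMap c p.1 p.2 ∈ Metric.ball c r := by
      rw [mem_ball_iff_norm, circleMap_sub_center, norm_circleMap_zero, abs_of_pos hp1.1]
      exact hp1.2
    simp only [e3, Set.indicator_of_mem e4, smul_eq_mul]
  rw [e2, Measure.volume_eq_prod, ← Measure.prod_restrict, lintegral_prod]
  swap
  · refine Measurable.aemeasurable ?_
    refine (by fun_prop : Measurable fun p : ℝ × ℝ => ENNReal.ofReal p.1).mul (hfc.comp ?_)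
    unfold circleMap
    fun_prop
  have e5 : ∀ R : ℝ, ENNReal.ofReal (2 * Real.pi * ‖F c‖ ^ 2 * R) ≤
      ∫⁻ θ in Set.Ioo (-Real.pi) Real.pi, ENNReal.ofReal R * f (circleMap c R θ) := by
    intro R
    have hcont : Continuous fun θ => ‖F (circleMap c R θ)‖ ^ 2 := by
      have := hF.continuous; fun_prop
    rw [lintegral_const_mul' _ _ ENNReal.ofReal_ne_top, mul_comm, ENNReal.ofReal_mul' (by positivity)]
    gcongr
    rw [restrict_Ioo_eq_restrict_Ioc, ← ofReal_integral_eq_lintegral_ofReal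
      (hcont.integrableOn_Ioc) (Filter.Eventually.of_forall fun _ => sq_nonneg _),
      ← intervalIntegral.integral_of_le (by linarith [Real.pi_pos])]
    exact ENNReal.ofReal_le_ofReal (two_pi_mul_norm_sq_le hF c R)
  refine le_trans ?_ (lintegral_mono e5)
  have hcont : Continuous fun R : ℝ => 2 * Real.pi * ‖F c‖ ^ 2 * R := by fun_prop
  rw [restrict_Ioo_eq_restrict_Ioc, ← ofReal_integral_eq_lintegral_ofReal hcont.integrableOn_Ioc,
    ← intervalIntegral.integral_of_le hr.le, intervalIntegral.integral_const_mul, integral_id]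
  · refine ENNReal.ofReal_le_ofReal (le_of_eq ?_); ring
  · filter_upwards [ae_restrict_mem measurableSet_Ioc] with R hR
    have := hR.1.le
    positivity

open MeasureTheory in
lemma lintegral_rect_le {ι : Type*} [Fintype ι] {F : ι → ℂ → ℂ} (hF : ∀ i, Continuous (F i))
    {a b V M : ℝ} (hab : a ≤ b) (hV : 0 ≤ V) (hM : ∀ x, a ≤ x → x ≤ b →
      ∑ i, ∫ v in (-V)..V, ‖F i (x + v * Complex.I)‖ ^ 2 ≤ M) :
    ∑ i, ∫⁻ z in {z : ℂ | (a ≤ z.re ∧ z.re ≤ b) ∧ (-V ≤ z.im ∧ z.im ≤ V)},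
      ENNReal.ofReal (‖F i z‖ ^ 2) ≤ ENNReal.ofReal ((b - a) * M) := by
  have h1 : ∀ i, ∫⁻ z in {z : ℂ | (a ≤ z.re ∧ z.re ≤ b) ∧ (-V ≤ z.im ∧ z.im ≤ V)},
      ENNReal.ofReal (‖F i z‖ ^ 2) =
      ∫⁻ x in Set.Icc a b, ENNReal.ofReal (∫ v in (-V)..V, ‖F i (x + v * Complex.I)‖ ^ 2) := by
    intro i
    have hFi := hF i
    rw [← Complex.volume_preserving_equiv_real_prod.symm.setLIntegral_comp_preimage_emb
      Complex.measurableEquivRealProd.symm.measurableEmbedding]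
    have e1 : Complex.measurableEquivRealProd.symm ⁻¹'
        {z : ℂ | (a ≤ z.re ∧ z.re ≤ b) ∧ (-V ≤ z.im ∧ z.im ≤ V)} = Set.Icc a b ×ˢ Set.Icc (-V) V := by
      ext p
      simp only [Set.mem_preimage, Complex.measurableEquivRealProd_symm_apply,
        Set.mem_ofPred_eq, Set.mem_prod, Set.mem_Icc]
    rw [e1, Measure.volume_eq_prod, ← Measure.prod_restrict, lintegral_prod]
    · refine lintegral_congr fun x => ?_
      have hcont : Continuous fun v : ℝ => ‖F i (x + v * Complex.I)‖ ^ 2 := by fun_prop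
      rw [intervalIntegral.integral_of_le (by linarith), ofReal_integral_eq_lintegral_ofReal
        hcont.integrableOn_Ioc (Filter.Eventually.of_forall fun _ => sq_nonneg _),
        restrict_Ioc_eq_restrict_Icc]
      refine lintegral_congr fun v => ?_
      rw [Complex.measurableEquivRealProd_symm_apply, Complex.mk_eq_add_mul_I]
    · refine Measurable.aemeasurable ?_
      have e2 : Measurable fun z => ENNReal.ofReal (‖F i z‖ ^ 2) :=
        (by fun_prop : Continuous fun z => ‖F i z‖ ^ 2).measurable.ennreal_ofReal
      exact e2.comp Complex.measurableEquivRealProd.symm.measurable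
  have hcont : ∀ i, Continuous fun x : ℝ => ∫ v in (-V)..V, ‖F i (x + v * Complex.I)‖ ^ 2 := by
    intro i
    have hFi := hF i
    exact intervalIntegral.continuous_parametric_intervalIntegral_of_continuous'
      (by unfold Function.uncurry; fun_prop) _ _
  simp_rw [h1]
  rw [← lintegral_finsetSum _ fun i _ => (hcont i).measurable.ennreal_ofReal]
  calc _ ≤ ∫⁻ _ in Set.Icc a b, ENNReal.ofReal M := by
        refine setLIntegral_mono measurable_const fun x hx => ?_
        rw [← ENNReal.ofReal_sum_of_nonneg]
        · exact ENNReal.ofReal_le_ofReal (hM x hx.1 hx.2)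
        · exact fun i _ => intervalIntegral.integral_nonneg (by linarith) fun _ _ => sq_nonneg _
    _ = _ := by
        rw [lintegral_const, Measure.restrict_apply_univ, Real.volume_Icc, mul_comm,
          ENNReal.ofReal_mul (by linarith)]

open MeasureTheory in
/-- Discrete mean values over weighted points with bounded overlap are controlled by
mean values over a rectangle. -/
lemma sum_mul_norm_sq_le {ι : Type*} [Fintype ι] {F : ι → ℂ → ℂ} (hF : ∀ i, Differentiable ℂ (F i))
    (S : ι → Finset ℂ) (m : ι → ℂ → ℕ) {a b V M r K : ℝ} (hab : a ≤ b) (hV : 0 ≤ V) (hr : 0 < r)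
    (hK0 : 0 ≤ K) (hM0 : 0 ≤ M)
    (hball : ∀ i, ∀ ρ ∈ S i, ∀ z ∈ Metric.ball ρ r,
      (a ≤ z.re ∧ z.re ≤ b) ∧ (-V ≤ z.im ∧ z.im ≤ V))
    (hK : ∀ i z, ((∑ ρ ∈ (S i).filter (fun ρ => z ∈ Metric.ball ρ r), m i ρ : ℕ) : ℝ) ≤ K)
    (hM : ∀ x, a ≤ x → x ≤ b → ∑ i, ∫ v in (-V)..V, ‖F i (x + v * Complex.I)‖ ^ 2 ≤ M) :
    Real.pi * r ^ 2 * ∑ i, ∑ ρ ∈ S i, (m i ρ : ℝ) * ‖F i ρ‖ ^ 2 ≤ K * ((b - a) * M) := by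
  set R : Set ℂ := {z : ℂ | (a ≤ z.re ∧ z.re ≤ b) ∧ (-V ≤ z.im ∧ z.im ≤ V)} with hR
  have hRm : MeasurableSet R := by
    refine IsClosed.measurableSet ?_
    refine ((isClosed_le continuous_const Complex.continuous_re).inter
      (isClosed_le Complex.continuous_re continuous_const)).inter
      ((isClosed_le continuous_const Complex.continuous_im).inter
      (isClosed_le Complex.continuous_im continuous_const))
  have hmeas : ∀ i, Measurable fun z => ENNReal.ofReal (‖F i z‖ ^ 2) := fun i => by
    have := (hF i).continuous
    exact (by fun_prop : Continuous fun z => ‖F i z‖ ^ 2).measurable.ennreal_ofReal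
  have h1 : ∀ i, ENNReal.ofReal (∑ ρ ∈ S i, (m i ρ : ℝ) * (Real.pi * r ^ 2 * ‖F i ρ‖ ^ 2)) ≤
      ENNReal.ofReal K * ∫⁻ z in R, ENNReal.ofReal (‖F i z‖ ^ 2) := by
    intro i
    rw [ENNReal.ofReal_sum_of_nonneg fun ρ _ => by positivity]
    calc ∑ ρ ∈ S i, ENNReal.ofReal ((m i ρ : ℝ) * (Real.pi * r ^ 2 * ‖F i ρ‖ ^ 2))
        ≤ ∑ ρ ∈ S i, ∫⁻ z in R, (Metric.ball ρ r).indicator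
            (fun z => (m i ρ : ENNReal) * ENNReal.ofReal (‖F i z‖ ^ 2)) z := by
          refine Finset.sum_le_sum fun ρ hρ => ?_
          rw [ENNReal.ofReal_mul (Nat.cast_nonneg _), ENNReal.ofReal_natCast,
            lintegral_indicator Metric.isOpen_ball.measurableSet,
            Measure.restrict_restrict Metric.isOpen_ball.measurableSet,
            show Metric.ball ρ r ∩ R = Metric.ball ρ r from
              Set.inter_eq_left.2 (fun z hz => hball i ρ hρ z hz),
            lintegral_const_mul _ (hmeas i)]
          gcongr
          exact ofReal_norm_sq_le_lintegral_ball (hF i) ρ hr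
      _ = ∫⁻ z in R, ∑ ρ ∈ S i, (Metric.ball ρ r).indicator
            (fun z => (m i ρ : ENNReal) * ENNReal.ofReal (‖F i z‖ ^ 2)) z := by
          rw [lintegral_finsetSum]
          exact fun ρ _ => ((hmeas i).const_mul _).indicator Metric.isOpen_ball.measurableSet
      _ ≤ ∫⁻ z in R, ENNReal.ofReal K * ENNReal.ofReal (‖F i z‖ ^ 2) := by
          refine lintegral_mono fun z => ?_
          simp only [Set.indicator_apply]
          rw [← Finset.sum_filter, ← Finset.sum_mul]
          gcongr
          rw [← Nat.cast_sum, ← ENNReal.ofReal_natCast]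
          exact ENNReal.ofReal_le_ofReal (hK i z)
      _ = _ := lintegral_const_mul _ (hmeas i)
  have h2 : ENNReal.ofReal (∑ i, ∑ ρ ∈ S i, (m i ρ : ℝ) * (Real.pi * r ^ 2 * ‖F i ρ‖ ^ 2)) ≤
      ENNReal.ofReal (K * ((b - a) * M)) := by
    rw [ENNReal.ofReal_sum_of_nonneg fun i _ => Finset.sum_nonneg fun ρ _ => by positivity,
      ENNReal.ofReal_mul hK0]
    refine (Finset.sum_le_sum fun i _ => h1 i).trans ?_
    rw [← Finset.mul_sum]
    gcongr
    exact lintegral_rect_le (fun i => (hF i).continuous) hab hV hM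
  have hnn : 0 ≤ K * ((b - a) * M) := mul_nonneg hK0 (mul_nonneg (by linarith) hM0)
  refine le_trans (le_of_eq ?_) ((ENNReal.ofReal_le_ofReal_iff hnn).1 h2)
  rw [Finset.mul_sum]
  refine Finset.sum_congr rfl fun i _ => ?_
  rw [Finset.mul_sum]
  exact Finset.sum_congr rfl fun ρ _ => by ring

lemma exists_zeroFree_near_one : ∃ ε : ℝ, 0 < ε ∧ ∀ (q : ℕ) [NeZero q] (s : ℂ), s ≠ 1 →
    0 < s.re → ‖s - 1‖ < ε → (1 : DirichletCharacter ℂ q).LFunction s ≠ 0 := by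
  have h1 : ∀ᶠ s in nhdsWithin (1 : ℂ) {1}ᶜ, (s - 1) * riemannZeta s ≠ 0 :=
    riemannZeta_residue_one.eventually_ne one_ne_zero
  rw [eventually_nhdsWithin_iff, Metric.eventually_nhds_iff] at h1
  obtain ⟨ε, hε, h2⟩ := h1
  refine ⟨ε, hε, fun q _ s hs hs0 hsε => ?_⟩
  have h3 : riemannZeta s ≠ 0 :=
    right_ne_zero_of_mul (h2 (by rwa [dist_eq_norm]) hs)
  have h4 := DirichletCharacter.LFunctionTrivChar_eq_mul_riemannZeta (N := q) hs
  rw [DirichletCharacter.LFunctionTrivChar] at h4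
  rw [h4]
  refine mul_ne_zero (Finset.prod_ne_zero_iff.2 fun p hp h5 => ?_) h3
  have hp1 := (Nat.prime_of_mem_primeFactors hp)
  have h6 : ‖(p : ℂ) ^ (-s)‖ < 1 := by
    rw [Complex.norm_natCast_cpow_of_pos hp1.pos, Complex.neg_re]
    exact Real.rpow_lt_one_of_one_lt_of_neg (by exact_mod_cast hp1.one_lt) (by linarith)
  rw [← sub_eq_zero.1 h5, norm_one] at h6
  exact lt_irrefl _ h6

/-- The log-free zero-density estimate close to the line `Re s = 1`. -/
lemma exists_sum_zeroMult_near_one_le : ∃ ε : ℝ, 0 < ε ∧ ε ≤ 1 / 100 ∧ ∃ c : ℝ, 0 < c ∧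
    ∃ C : ℝ, 0 < C ∧ ∀ (q : ℕ) [NeZero q], 3 ≤ q → ∀ T : ℝ, 1 ≤ T → ∀ r : ℝ, 0 < r → r ≤ ε →
      1 ≤ r * Real.log (q * T) → ∀ S : DirichletCharacter ℂ q → Finset ℂ,
      (∀ χ, ∀ ρ ∈ S χ, χ.LFunction ρ = 0 ∧ 1 - r ≤ ρ.re ∧ ρ.re < 1 ∧ |ρ.im| ≤ T) →
      ∑ χ, ∑ ρ ∈ S χ, (zeroMult χ.LFunction ρ : ℝ) ≤ C * Real.exp (c * (r * Real.log (q * T))) := by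
  obtain ⟨ε, hε, hfree⟩ := exists_zeroFree_near_one
  set g := min (ε / 2) 1 with hg
  have hg0 : 0 < g := lt_min (by linarith) one_pos
  have hg1 : g ≤ 1 := min_le_right _ _
  have hgε : g ≤ ε / 2 := min_le_left _ _
  set H := Real.pi / g with hH
  have hH0 : 0 < H := div_pos Real.pi_pos hg0
  obtain ⟨CD, hCD, hD⟩ := exists_sum_zeroMult_local_le (g := g / 2) (by linarith) (by linarith)
  obtain ⟨CF, hCF, hF⟩ := exists_sum_char_integral_detSum_le (60 + 2 * H) (by linarith)
  refine ⟨min (1 / 100) (g / 2), lt_min (by norm_num) (by linarith), min_le_left _ _,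
    4 * (60 + 2 * H), by linarith, 5 * (CD * CF), by positivity, ?_⟩
  intro q _ hq T hT r hr hrε hrL S hS
  have hr1 : r ≤ 1 / 100 := hrε.trans (min_le_left _ _)
  have hrg : r ≤ g / 2 := hrε.trans (min_le_right _ _)
  set ℒ := Real.log (q * T) with hℒ
  have hq3 : (3 : ℝ) ≤ q := by exact_mod_cast hq
  have hqT : 3 ≤ q * T := by nlinarith
  have hℒ1 : 1 ≤ ℒ := by nlinarith
  set X := Real.exp (4 * (60 + 2 * H) * (r * ℒ)) with hX
  have him : ∀ χ : DirichletCharacter ℂ q, ∀ ρ ∈ S χ, χ = 1 → g ≤ |ρ.im| := by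
    intro χ ρ hρ hχ
    obtain ⟨e1, e2, e3, e4⟩ := hS χ ρ hρ
    by_contra! h
    subst hχ
    refine hfree q ρ (by rintro rfl; simp at e3) (by linarith) ?_ e1
    refine (Complex.norm_le_abs_re_add_abs_im _).trans_lt ?_
    rw [Complex.sub_re, Complex.sub_im, Complex.one_re, Complex.one_im, sub_zero,
      abs_of_nonpos (by linarith)]
    linarith
  have hnear : ∀ χ : DirichletCharacter ℂ q, ∀ ρ ∈ S χ, ∀ z ∈ Metric.ball ρ r,
      1 - 2 * r ≤ z.re ∧ z.re ≤ 1 + r ∧ |z.im - ρ.im| ≤ r := by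
    intro χ ρ hρ z hz
    obtain ⟨e1, e2, e3, e4⟩ := hS χ ρ hρ
    rw [mem_ball_iff_norm] at hz
    have f1 := (Complex.abs_re_le_norm (z - ρ)).trans hz.le
    have f2 := (Complex.abs_im_le_norm (z - ρ)).trans hz.le
    rw [Complex.sub_re, abs_le] at f1
    rw [Complex.sub_im] at f2
    exact ⟨by linarith, by linarith, f2⟩
  have hfix : ∀ h : ℝ, 0 ≤ h → h ≤ 2 * H → ∑ χ, ∑ ρ ∈ S χ, (zeroMult χ.LFunction ρ : ℝ) *
      ‖detSum χ ℒ ⌊Real.exp (60 * ℒ + h)⌋₊ ρ‖ ^ 2 ≤ CD * CF * X := by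
    intro h hh0 hh1
    set N := ⌊Real.exp (60 * ℒ + h)⌋₊ with hN
    have hN1 : 1 ≤ N := (Nat.one_le_floor_iff _).2 (Real.one_le_exp (by linarith))
    have hlogN : Real.log N ≤ (60 + 2 * H) * ℒ := by
      have e1 : Real.log N ≤ 60 * ℒ + h := by
        rw [Real.log_le_iff_le_exp (by exact_mod_cast hN1)]
        exact Nat.floor_le (Real.exp_pos _).le
      nlinarith
    have hmain := sum_mul_norm_sq_le (F := fun χ : DirichletCharacter ℂ q => detSum χ ℒ N)
      (fun χ => differentiable_detSum χ ℒ N) S (fun χ ρ => zeroMult χ.LFunction ρ)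
      (a := 1 - 2 * r) (b := 1 + r) (V := 2 * T) (M := CF / ℒ * X) (r := r) (K := CD * (r * ℒ))
      (by linarith) (by linarith) hr (by positivity) (by positivity) ?_ ?_ ?_
    · have e1 : CD * (r * ℒ) * ((1 + r - (1 - 2 * r)) * (CF / ℒ * X)) = 3 * r ^ 2 * (CD * CF * X) := by
        field_simp
        ring
      rw [e1] at hmain
      have e2 : 3 * r ^ 2 * (CD * CF * X) ≤ Real.pi * r ^ 2 * (CD * CF * X) := by
        gcongr
        exact Real.pi_gt_three.le
      exact le_of_mul_le_mul_left (hmain.trans e2) (by positivity)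
    · intro χ ρ hρ z hz
      obtain ⟨f1, f2, f3⟩ := hnear χ ρ hρ z hz
      have f4 := (hS χ ρ hρ).2.2.2
      rw [abs_le] at f3 f4
      exact ⟨⟨f1, f2⟩, by linarith, by linarith⟩
    · intro χ z
      rcases ((S χ).filter fun ρ => z ∈ Metric.ball ρ r).eq_empty_or_nonempty with he | ⟨ρ₀, hρ₀⟩
      · rw [he]
        simp only [Finset.sum_empty, Nat.cast_zero]
        positivity
      · obtain ⟨k1, k2⟩ := Finset.mem_filter.1 hρ₀
        obtain ⟨f1, f2, f3⟩ := hnear χ ρ₀ k1 z k2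
        have f4 := (hS χ ρ₀ k1).2.2.2
        refine hD q hq χ r T z.im hr hr1 hT ?_ (fun hχ => ?_) hrL _ ?_
        · have := abs_sub_abs_le_abs_sub z.im ρ₀.im
          linarith
        · have := him χ ρ₀ k1 hχ
          have h6 := abs_sub_abs_le_abs_sub ρ₀.im z.im
          rw [abs_sub_comm] at h6
          linarith
        · intro ρ hρ
          have h7 := (Finset.mem_filter.1 hρ).2
          rw [mem_ball_iff_norm] at h7
          have e1 : (1 + r + z.im * Complex.I : ℂ) - ρ = ((1 + r - z.re : ℝ) : ℂ) + (z - ρ) := by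
            apply Complex.ext <;> simp
          rw [e1]
          refine (norm_add_le _ _).trans ?_
          rw [Complex.norm_real, Real.norm_of_nonneg (by linarith)]
          linarith
    · intro x hx1 hx2
      exact hF q hq T hT N r x hlogN hr.le hx1
  have hInt : ∀ (χ : DirichletCharacter ℂ q) (ρ : ℂ), IntervalIntegrable
      (fun h => (zeroMult χ.LFunction ρ : ℝ) * ‖detSum χ ℒ ⌊Real.exp (60 * ℒ + h)⌋₊ ρ‖ ^ 2)
      MeasureTheory.volume 0 (2 * H) := fun χ ρ =>
    (intervalIntegrable_comp_floor_exp (fun N => ‖detSum χ ℒ N ρ‖ ^ 2) (60 * ℒ) _ _).const_mul _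
  have hInt' : ∀ χ : DirichletCharacter ℂ q, IntervalIntegrable
      (fun h => ∑ ρ ∈ S χ, (zeroMult χ.LFunction ρ : ℝ) *
        ‖detSum χ ℒ ⌊Real.exp (60 * ℒ + h)⌋₊ ρ‖ ^ 2)
      MeasureTheory.volume 0 (2 * H) := fun χ => by
    simpa only [Finset.sum_fn] using IntervalIntegrable.sum (S χ) fun ρ _ => hInt χ ρ
  have hlow : 2 / 5 * H * ∑ χ, ∑ ρ ∈ S χ, (zeroMult χ.LFunction ρ : ℝ) ≤
      ∫ h in (0 : ℝ)..(2 * H), ∑ χ, ∑ ρ ∈ S χ, (zeroMult χ.LFunction ρ : ℝ) *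
        ‖detSum χ ℒ ⌊Real.exp (60 * ℒ + h)⌋₊ ρ‖ ^ 2 := by
    rw [intervalIntegral.integral_finsetSum fun χ _ => hInt' χ, Finset.mul_sum]
    refine Finset.sum_le_sum fun χ _ => ?_
    rw [intervalIntegral.integral_finsetSum fun ρ _ => hInt χ ρ, Finset.mul_sum]
    refine Finset.sum_le_sum fun ρ hρ => ?_
    obtain ⟨e1, e2, e3, e4⟩ := hS χ ρ hρ
    rw [intervalIntegral.integral_const_mul, mul_comm]
    gcongr
    exact integral_detSum_ge hg0 hq χ hT e1 (by linarith) e3 e4 (him χ ρ hρ)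
  have hup : ∫ h in (0 : ℝ)..(2 * H), ∑ χ, ∑ ρ ∈ S χ, (zeroMult χ.LFunction ρ : ℝ) *
        ‖detSum χ ℒ ⌊Real.exp (60 * ℒ + h)⌋₊ ρ‖ ^ 2 ≤ 2 * H * (CD * CF * X) := by
    have h1 : IntervalIntegrable (fun h => ∑ χ : DirichletCharacter ℂ q, ∑ ρ ∈ S χ,
        (zeroMult χ.LFunction ρ : ℝ) * ‖detSum χ ℒ ⌊Real.exp (60 * ℒ + h)⌋₊ ρ‖ ^ 2)
        MeasureTheory.volume 0 (2 * H) := by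
      simpa only [Finset.sum_fn] using IntervalIntegrable.sum Finset.univ fun χ _ => hInt' χ
    have := intervalIntegral.integral_mono_on (μ := MeasureTheory.volume)
      (g := fun _ => CD * CF * X) (by linarith : (0 : ℝ) ≤ 2 * H) h1 intervalIntegrable_const
      fun h hh => hfix h hh.1 hh.2
    simpa only [intervalIntegral.integral_const, smul_eq_mul, sub_zero] using this
  have hfin : 2 / 5 * H * ∑ χ, ∑ ρ ∈ S χ, (zeroMult χ.LFunction ρ : ℝ) ≤
      2 / 5 * H * (5 * (CD * CF) * X) := (hlow.trans hup).trans (le_of_eq (by ring))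
  exact le_of_mul_le_mul_left hfin (by positivity)

lemma zeroMult_principal_one {q : ℕ} [NeZero q] :
    zeroMult (1 : DirichletCharacter ℂ q).LFunction 1 = 0 := by
  have h := zeroMult_le_analyticOrderAt (1 : DirichletCharacter ℂ q) 1
  have h1 : charEntire (1 : DirichletCharacter ℂ q) 1 ≠ 0 := by
    rw [charEntire, if_pos rfl, zmodEntire, Function.update_self, sum_principal_char_div]
    have hq := NeZero.pos q
    have ht := Nat.totient_pos.2 hq
    exact div_ne_zero (by exact_mod_cast ht.ne') (by exact_mod_cast hq.ne')
  rw [((differentiable_charEntire _).analyticAt 1).analyticOrderAt_eq_zero.2 h1] at h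
  exact_mod_cast le_antisymm h (zero_le)

lemma exists_finset_zeroCount_eq (q : ℕ) [NeZero q] (σ T : ℝ) (χ : DirichletCharacter ℂ q) :
    ∃ S : Finset ℂ, (∀ ρ ∈ S, χ.LFunction ρ = 0 ∧ σ ≤ ρ.re ∧ ρ.re < 1 ∧ |ρ.im| ≤ T) ∧
      zeroCount q σ T χ = ∑ ρ ∈ S, zeroMult χ.LFunction ρ := by
  set Z : Set ℂ := {ρ : ℂ | χ.LFunction ρ = 0 ∧ σ ≤ ρ.re ∧ |ρ.im| ≤ T} with hZ
  by_cases hfin : (Z ∩ Function.support (zeroMult χ.LFunction)).Finite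
  · refine ⟨hfin.toFinset, fun ρ hρ => ?_, ?_⟩
    · obtain ⟨⟨h1, h2, h3⟩, h4⟩ := hfin.mem_toFinset.1 hρ
      refine ⟨h1, h2, ?_, h3⟩
      by_contra! h5
      refine DirichletCharacter.LFunction_ne_zero_of_one_le_re χ ?_ h5 h1
      by_contra! h6
      obtain ⟨rfl, rfl⟩ := h6
      exact h4 zeroMult_principal_one
    · rw [zeroCount, ← finsum_mem_inter_support]
      exact finsum_mem_eq_finite_toFinset_sum _ hfin
  · refine ⟨∅, by simp, ?_⟩
    rw [zeroCount, Finset.sum_empty]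
    exact finsum_mem_eq_zero_of_infinite hfin

lemma card_dirichletCharacter_le (q : ℕ) [NeZero q] :
    Fintype.card (DirichletCharacter ℂ q) ≤ q := by
  rw [← Nat.card_eq_fintype_card, DirichletCharacter.card_eq_totient_of_hasEnoughRootsOfUnity ℂ q]
  exact Nat.totient_le q

/-- **Log-free zero-density estimate**: there are `c₃ > 0` and `C₃ > 0` such that for every
`q ≥ 3`, `T ≥ 1` and `0 ≤ σ ≤ 1` one has `∑_{χ mod q} N(σ,T,χ) ≤ C₃ (qT)^{c₃(1-σ)}`. -/
theorem log_free_zero_density :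
    ∃ c₃ : ℝ, 0 < c₃ ∧ ∃ C₃ : ℝ, 0 < C₃ ∧
      ∀ (q : ℕ) [NeZero q], 3 ≤ q → ∀ T : ℝ, 1 ≤ T → ∀ σ : ℝ, 0 ≤ σ → σ ≤ 1 →
        (∑ χ : DirichletCharacter ℂ q, (zeroCount q σ T χ : ℝ))
          ≤ C₃ * ((q : ℝ) * T) ^ (c₃ * (1 - σ)) := by
  obtain ⟨ε, hε, -, c, hc, C, hC, hmain⟩ := exists_sum_zeroMult_near_one_le
  obtain ⟨K, hK, hcrude⟩ := exists_sum_zeroMult_crude_le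
  refine ⟨c + 3 / ε, by positivity, C * Real.exp c + K * Real.exp (3 / ε), by positivity, ?_⟩
  intro q _ hq T hT σ hσ0 hσ1
  have hq3 : (3 : ℝ) ≤ q := by exact_mod_cast hq
  have hqT : 3 ≤ q * T := by nlinarith
  have hX0 : 0 < q * T := by linarith
  set X := (q : ℝ) * T with hX
  set ℒ := Real.log X with hℒ
  have hℒ0 : 0 < ℒ := Real.log_pos (by linarith)
  have hexp : ∀ u : ℝ, X ^ u = Real.exp (ℒ * u) := fun u => Real.rpow_def_of_pos hX0 u
  choose S hS hcount using exists_finset_zeroCount_eq q σ T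
  have hδ : 0 ≤ 1 - σ := by linarith
  have hsum : ∑ χ, (zeroCount q σ T χ : ℝ) = ∑ χ, ∑ ρ ∈ S χ, (zeroMult χ.LFunction ρ : ℝ) := by
    refine Finset.sum_congr rfl fun χ _ => ?_
    rw [hcount, Nat.cast_sum]
  have hcr : ∑ χ, (zeroCount q σ T χ : ℝ) ≤ K * Real.exp (ℒ * 3) := by
    have h1 : ∀ χ ∈ (Finset.univ : Finset (DirichletCharacter ℂ q)),
        (zeroCount q σ T χ : ℝ) ≤ K * X ^ 2 := fun χ _ => by
      rw [hcount]
      refine hcrude q χ T hT (S χ) fun ρ hρ => ?_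
      obtain ⟨-, e2, e3, e4⟩ := hS χ ρ hρ
      exact ⟨hσ0.trans e2, e3.le, e4⟩
    refine (Finset.sum_le_sum h1).trans ?_
    rw [Finset.sum_const, nsmul_eq_mul, Finset.card_univ, ← hexp]
    have h2 : (Fintype.card (DirichletCharacter ℂ q) : ℝ) ≤ X := by
      have h3 : (Fintype.card (DirichletCharacter ℂ q) : ℝ) ≤ q := by
        exact_mod_cast card_dirichletCharacter_le q
      nlinarith
    calc (Fintype.card (DirichletCharacter ℂ q) : ℝ) * (K * X ^ 2) ≤ X * (K * X ^ 2) := by gcongr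
      _ = K * X ^ 3 := by ring
      _ = K * X ^ (3 : ℝ) := by norm_cast
  have hX1 : 0 ≤ ℒ * ((c + 3 / ε) * (1 - σ)) := by positivity
  rw [hexp, add_mul]
  have hp1 : 0 < C * Real.exp c * Real.exp (ℒ * ((c + 3 / ε) * (1 - σ))) := by positivity
  have hp2 : 0 < K * Real.exp (3 / ε) * Real.exp (ℒ * ((c + 3 / ε) * (1 - σ))) := by positivity
  by_cases h1 : ε ≤ 1 - σ ∨ ℒ * ε < 1
  · refine (hcr.trans ?_).trans (le_add_of_nonneg_left hp1.le)
    rw [mul_assoc, ← Real.exp_add]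
    gcongr
    rcases h1 with h1 | h1
    · have e1 : 3 ≤ (c + 3 / ε) * (1 - σ) := by
        calc (3 : ℝ) = 3 / ε * ε := by field_simp
          _ ≤ (c + 3 / ε) * (1 - σ) := by gcongr; linarith
      have e2 : ℒ * 3 ≤ ℒ * ((c + 3 / ε) * (1 - σ)) := by gcongr
      have e3 : 0 ≤ 3 / ε := by positivity
      linarith
    · have e1 : ℒ * 3 ≤ 3 / ε := by
        rw [le_div_iff₀ hε]; nlinarith
      linarith
  · push Not at h1
    obtain ⟨h1, h2⟩ := h1
    refine le_trans ?_ (le_add_of_nonneg_right hp2.le)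
    set r := max (1 - σ) (1 / ℒ) with hr
    have hr0 : 0 < r := lt_max_of_lt_right (by positivity)
    have hrε : r ≤ ε := max_le h1.le (by rw [div_le_iff₀ hℒ0]; linarith)
    have hrL : 1 ≤ r * ℒ := by
      rw [← div_le_iff₀ hℒ0]; exact le_max_right _ _
    have hrL2 : r * ℒ ≤ 1 + ℒ * (1 - σ) := by
      have e1 : r ≤ (1 - σ) + 1 / ℒ := max_le (by have : 0 < 1 / ℒ := by positivity
                                                  linarith) (by linarith)
      calc r * ℒ ≤ ((1 - σ) + 1 / ℒ) * ℒ := by gcongr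
        _ = _ := by field_simp; ring
    rw [hsum]
    refine (hmain q hq T hT r hr0 hrε hrL S fun χ ρ hρ => ?_).trans ?_
    · obtain ⟨e1, e2, e3, e4⟩ := hS χ ρ hρ
      exact ⟨e1, by linarith [le_max_left (1 - σ) (1 / ℒ)], e3, e4⟩
    · rw [mul_assoc, ← Real.exp_add]
      gcongr
      have e5 : 0 ≤ 3 / ε * (ℒ * (1 - σ)) := by positivity
      have e6 : c * (r * ℒ) ≤ c * (1 + ℒ * (1 - σ)) := by gcongr
      linarith
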